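/- (Mann–Su) Let X be a compact topological manifold. There exists a constant C, depending only on X, such that every finite abelian group A admitting an effective continuous action on X satisfies d(A) ≤ C. -/

import Mathlib

/-- The group of self-homeomorphisms of a topological space, with `(f * g) x = f (g x)`. -/
instance homeoGroup (X : Type*) [TopologicalSpace X] : Group (X ≃ₜ X) where
  mul f g := g.trans f
  one := Homeomorph.refl X
  inv := Homeomorph.symm
  mul_assoc _ _ _ := Homeomorph.ext fun _ => rfl
  one_mul _ := Homeomorph.ext fun _ => rfl
  mul_one _ := Homeomorph.ext fun _ => rfl
  inv_mul_cancel := Homeomorph.self_trans_symm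


set_option linter.unusedSectionVars false
set_option linter.unusedVariables false

namespace MS
open Set Topology

/-- Cochains on `m` points. -/
abbrev Co (T M : Type*) (m : ℕ) := (Fin m → T) → M

section basic
variable {T T' M M' : Type*} [AddCommGroup M] [AddCommGroup M']

def sl {m : ℕ} (f : Co T M (m+1)) (x : T) : Co T M m := fun s => f (Fin.cons x s)

/-- The (augmented) Alexander–Spanier differential. -/
def d : ∀ {m : ℕ}, Co T M m → Co T M (m+1)
  | 0, f => fun t => f (Fin.tail t)
  | (_+1), f => fun t => f (Fin.tail t) - d (sl f (t 0)) (Fin.tail t)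

@[simp] lemma sl_apply {m : ℕ} (f : Co T M (m+1)) (x : T) (s : Fin m → T) :
    sl f x s = f (Fin.cons x s) := rfl

lemma sl_d_zero (f : Co T M 0) (x : T) : sl (d f) x = f := by
  funext s; simp [d]

lemma sl_d {m : ℕ} (f : Co T M (m+1)) (x : T) : sl (d f) x = f - d (sl f x) := by
  funext s; simp [d]

lemma co_ext {m : ℕ} {f g : Co T M (m+1)} (h : ∀ x, sl f x = sl g x) : f = g := by
  funext t
  have := congrFun (h (t 0)) (Fin.tail t)
  simpa [sl, Fin.cons_self_tail] using this

lemma d_add {m : ℕ} (f g : Co T M m) : d (f + g) = d f + d g := by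
  induction m with
  | zero => rfl
  | succ m ih =>
    apply co_ext; intro x
    have h1 : sl (d f + d g) x = sl (d f) x + sl (d g) x := rfl
    have h2 : sl (f + g) x = sl f x + sl g x := rfl
    rw [h1, sl_d, sl_d, sl_d, h2, ih]; abel

/-- The differential as an additive map. -/
def dH (T M : Type*) [AddCommGroup M] (m : ℕ) : Co T M m →+ Co T M (m+1) where
  toFun := d
  map_zero' := by
    have := d_add (0 : Co T M m) 0
    simpa using this
  map_add' := d_add

lemma dH_apply {m : ℕ} (f : Co T M m) : dH T M m f = d f := rfl
@[simp] lemma d_zero {m : ℕ} : d (0 : Co T M m) = 0 := (dH T M m).map_zero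
lemma d_neg {m : ℕ} (f : Co T M m) : d (-f) = - d f := (dH T M m).map_neg f
lemma d_sub {m : ℕ} (f g : Co T M m) : d (f - g) = d f - d g := (dH T M m).map_sub f g
lemma d_sum {m : ℕ} {ι : Type*} (s : Finset ι) (f : ι → Co T M m) :
    d (∑ i ∈ s, f i) = ∑ i ∈ s, d (f i) := map_sum (dH T M m) f s
lemma d_nsmul {m : ℕ} (k : ℕ) (f : Co T M m) : d (k • f) = k • d f := map_nsmul (dH T M m) k f
lemma d_zsmul {m : ℕ} (k : ℤ) (f : Co T M m) : d (k • f) = k • d f := map_zsmul (dH T M m) k f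

@[simp] lemma d_d {m : ℕ} (f : Co T M m) : d (d f) = 0 := by
  induction m with
  | zero =>
    apply co_ext; intro x
    rw [sl_d, sl_d_zero, sub_self]; rfl
  | succ m ih =>
    apply co_ext; intro x
    rw [sl_d, sl_d, d_sub, ih]; simp; rfl

/-- Locality. -/
lemma d_local {m : ℕ} {f g : Co T M m} {V : Set T} (h : ∀ t, (∀ i, t i ∈ V) → f t = g t) :
    ∀ t, (∀ i, t i ∈ V) → d f t = d g t := by
  induction m with
  | zero => intro t _; exact h _ (fun i => i.elim0)
  | succ m ih =>
    intro t ht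
    have h1 : ∀ i, Fin.tail t i ∈ V := fun i => ht _
    simp only [d]
    rw [h _ h1, ih (f := sl f (t 0)) (g := sl g (t 0)) _ _ h1]
    intro s hs
    apply h
    intro i; refine Fin.cases ?_ ?_ i
    · simpa using ht 0
    · intro j; simpa using hs j

/-- Naturality in the coefficients. -/
lemma d_map {m : ℕ} (h : M →+ M') (f : Co T M m) : d (fun t => h (f t)) = fun t => h (d f t) := by
  induction m with
  | zero => rfl
  | succ m ih =>
    funext t
    simp only [d, map_sub]
    have e := congrFun (ih (sl f (t 0))) (Fin.tail t)
    rw [← e]; rfl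

/-- Pull back of cochains. -/
def pull {m : ℕ} (φ : T → T') (f : Co T' M m) : Co T M m := fun t => f (φ ∘ t)

@[simp] lemma pull_apply {m : ℕ} (φ : T → T') (f : Co T' M m) (t : Fin m → T) :
    pull φ f t = f (φ ∘ t) := rfl

lemma sl_pull {m : ℕ} (φ : T → T') (f : Co T' M (m+1)) (x : T) :
    sl (pull φ f) x = pull φ (sl f (φ x)) := by
  funext s
  simp only [sl_apply, pull_apply]
  congr 1
  funext i; refine Fin.cases ?_ ?_ i <;> simp

lemma d_pull {m : ℕ} (φ : T → T') (f : Co T' M m) : d (pull φ f) = pull φ (d f) := by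
  induction m with
  | zero =>
    apply co_ext; intro x
    rw [sl_pull, sl_d_zero, sl_d_zero]
  | succ m ih =>
    apply co_ext; intro x
    rw [sl_pull, sl_d, sl_d, sl_pull, ih]; rfl

lemma pull_pull {T'' : Type*} {m : ℕ} (φ : T → T') (ψ : T' → T'') (f : Co T'' M m) :
    pull φ (pull ψ f) = pull (ψ ∘ φ) f := rfl

lemma pull_add {m : ℕ} (φ : T → T') (f g : Co T' M m) :
    pull φ (f + g) = pull φ f + pull φ g := rfl
lemma pull_sub {m : ℕ} (φ : T → T') (f g : Co T' M m) :
    pull φ (f - g) = pull φ f - pull φ g := rfl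
lemma pull_sum {m : ℕ} {ι : Type*} (φ : T → T') (s : Finset ι) (f : ι → Co T' M m) :
    pull φ (∑ i ∈ s, f i) = ∑ i ∈ s, pull φ (f i) := by
  funext t; simp

/-- Cone formula. -/
lemma cone {m : ℕ} (f : Co T M (m+1)) (x : T) : f = d (sl f x) + sl (d f) x := by
  rw [sl_d]; abel

/-- The prism operator. -/
def prism (φ ψ : T → T') : ∀ {m : ℕ}, Co T' M (m+1) → Co T M m
  | 0, _ => fun _ => 0
  | (_+1), f => fun t => f (Fin.cons (φ (t 0)) (ψ ∘ t)) - prism φ ψ (sl f (φ (t 0))) (Fin.tail t)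

lemma sl_prism (φ ψ : T → T') {m : ℕ} (f : Co T' M (m+2)) (x : T) :
    sl (prism φ ψ f) x = pull ψ (sl (sl f (φ x)) (ψ x)) - prism φ ψ (sl f (φ x)) := by
  funext s
  have : ψ ∘ (Fin.cons x s : Fin (m+1) → T) = Fin.cons (ψ x) (ψ ∘ s) := by
    funext i; refine Fin.cases ?_ ?_ i <;> simp
  simp [prism, this]

lemma prism_add (φ ψ : T → T') {m : ℕ} (f g : Co T' M (m+1)) :
    prism φ ψ (f + g) = prism φ ψ f + prism φ ψ g := by
  induction m with
  | zero => funext t; simp [prism]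
  | succ m ih =>
    apply co_ext; intro x
    have h1 : sl (prism φ ψ f + prism φ ψ g) x = sl (prism φ ψ f) x + sl (prism φ ψ g) x := rfl
    have h2 : sl (f + g) (φ x) = sl f (φ x) + sl g (φ x) := rfl
    have h3 : sl (sl f (φ x) + sl g (φ x)) (ψ x)
      = sl (sl f (φ x)) (ψ x) + sl (sl g (φ x)) (ψ x) := rfl
    rw [h1, sl_prism, sl_prism, sl_prism, h2, ih, h3, pull_add]; abel

lemma prism_neg (φ ψ : T → T') {m : ℕ} (f : Co T' M (m+1)) :
    prism φ ψ (-f) = - prism φ ψ f :=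
  (AddMonoidHom.mk' (prism φ ψ (M := M) (m := m)) (prism_add φ ψ)).map_neg f

lemma prism_sub (φ ψ : T → T') {m : ℕ} (f g : Co T' M (m+1)) :
    prism φ ψ (f - g) = prism φ ψ f - prism φ ψ g :=
  (AddMonoidHom.mk' (prism φ ψ (M := M) (m := m)) (prism_add φ ψ)).map_sub f g

lemma prism_homotopy (φ ψ : T → T') {m : ℕ} (f : Co T' M (m+1)) :
    d (prism φ ψ f) + prism φ ψ (d f) = pull ψ f - pull φ f := by
  induction m with
  | zero =>
    apply co_ext; intro x
    have h0 : prism φ ψ f = 0 := rfl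
    have e : sl (prism φ ψ (d f)) x = _ := sl_prism φ ψ (d f) x
    have h1 : prism φ ψ (sl (d f) (φ x)) = 0 := rfl
    rw [h0, d_zero, zero_add, e, h1, sub_zero, sl_d]
    have h2 : sl (pull ψ f - pull φ f) x = sl (pull ψ f) x - sl (pull φ f) x := rfl
    rw [h2, sl_pull, sl_pull]
    funext s
    simp only [pull_apply, sl_apply, Pi.sub_apply]
    have hs : ∀ u : Fin 0 → T', u = Fin.elim0 := fun u => Subsingleton.elim _ _
    simp only [d, Fin.tail_cons, sl_apply]
    rw [hs (φ ∘ s), hs (ψ ∘ s)]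
  | succ m ih =>
    apply co_ext; intro x
    have e0 : sl (d (prism φ ψ f) + prism φ ψ (d f)) x
      = sl (d (prism φ ψ f)) x + sl (prism φ ψ (d f)) x := rfl
    have h2 : sl (pull ψ f - pull φ f) x = sl (pull ψ f) x - sl (pull φ f) x := rfl
    have h3 : sl (f - d (sl f (φ x))) (ψ x) = sl f (ψ x) - sl (d (sl f (φ x))) (ψ x) := rfl
    rw [e0, h2, sl_d, sl_prism, sl_prism, sl_pull, sl_pull, sl_d, h3, sl_d, d_sub, d_pull,
      prism_sub, pull_sub, pull_sub]
    have := ih (sl f (φ x))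
    rw [← sub_eq_zero] at this ⊢
    rw [← this]; abel
end basic
end MS


set_option linter.unusedSectionVars false
set_option linter.unusedVariables false

namespace MS
open Set Topology

/-- A subcomplex of the complex of all integral cochains. -/
structure Sub (X : Type*) where
  c : ∀ m, AddSubgroup (Co X ℤ m)
  dc : ∀ {m : ℕ} {f : Co X ℤ m}, f ∈ c m → d f ∈ c (m+1)

section abstr
variable {X : Type*}

instance : CoeFun (Sub X) (fun _ => ∀ m, AddSubgroup (Co X ℤ m)) := ⟨Sub.c⟩
instance : LE (Sub X) := ⟨fun P Q => ∀ m, P m ≤ Q m⟩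
instance : Min (Sub X) := ⟨fun P Q => ⟨fun m => P m ⊓ Q m, fun h => ⟨P.dc h.1, Q.dc h.2⟩⟩⟩
instance : Max (Sub X) := ⟨fun P Q => ⟨fun m => P m ⊔ Q m, by
  intro m f h
  obtain ⟨a, ha, b, hb, rfl⟩ := AddSubgroup.mem_sup.1 h
  rw [d_add]
  exact AddSubgroup.mem_sup.2 ⟨_, P.dc ha, _, Q.dc hb, rfl⟩⟩⟩

lemma Sub.le_refl (P : Sub X) : P ≤ P := fun _ => _root_.le_refl _

lemma mem_inf {P Q : Sub X} {m : ℕ} {f : Co X ℤ m} : f ∈ (P ⊓ Q) m ↔ f ∈ P m ∧ f ∈ Q m := Iff.rfl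

lemma mem_sup {P Q : Sub X} {m : ℕ} {f : Co X ℤ m} :
    f ∈ (P ⊔ Q) m ↔ ∃ a ∈ P m, ∃ b ∈ Q m, a + b = f := AddSubgroup.mem_sup

/-- Coboundaries of elements of `P`. -/
def cob (P : Sub X) : ∀ m, AddSubgroup (Co X ℤ m)
  | 0 => ⊥
  | (m+1) => (P m).map (dH X ℤ m)

lemma cob_succ {P : Sub X} {m : ℕ} {f : Co X ℤ (m+1)} :
    f ∈ cob P (m+1) ↔ ∃ g ∈ P m, d g = f := AddSubgroup.mem_map

lemma cob_zero {P : Sub X} {f : Co X ℤ 0} : f ∈ cob P 0 ↔ f = 0 := AddSubgroup.mem_bot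

lemma cob_le (P : Sub X) (m : ℕ) : cob P m ≤ P m := by
  cases m with
  | zero => exact bot_le
  | succ m => intro f hf; obtain ⟨g, hg, rfl⟩ := cob_succ.1 hf; exact P.dc hg

lemma d_cob {P : Sub X} {m : ℕ} {f : Co X ℤ m} (hf : f ∈ cob P m) : d f = 0 := by
  cases m with
  | zero => rw [cob_zero.1 hf, d_zero]
  | succ m => obtain ⟨g, hg, rfl⟩ := cob_succ.1 hf; exact d_d g

lemma cob_mono {P Q : Sub X} (h : P ≤ Q) (m : ℕ) : cob P m ≤ cob Q m := by
  cases m with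
  | zero => exact bot_le
  | succ m => exact AddSubgroup.map_mono (h m)

/-- Vanishing of `H^m(P/N)`. -/
def V (P N : Sub X) (m : ℕ) : Prop := ∀ f ∈ P m, d f ∈ N (m+1) → f ∈ cob P m ⊔ N m

lemma mvN {P N1 N2 N Ns : Sub X} {m : ℕ} {f : Co X ℤ m}
    (h1 : f ∈ cob P m ⊔ N1 m) (h2 : f ∈ cob P m ⊔ N2 m)
    (hs : ∀ k, m = k + 1 → V P Ns k) (hsup : ∀ k, m = k + 1 → Ns k ≤ N1 k ⊔ N2 k)
    (h1s : N1 ≤ Ns) (h2s : N2 ≤ Ns) (h1P : N1 ≤ P) (hN : N1 ⊓ N2 ≤ N) :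
    f ∈ cob P m ⊔ N m := by
  obtain ⟨a1, ha1, b1, hb1, e1⟩ := AddSubgroup.mem_sup.1 h1
  obtain ⟨a2, ha2, b2, hb2, e2⟩ := AddSubgroup.mem_sup.1 h2
  cases m with
  | zero =>
    rw [cob_zero.1 ha1, zero_add] at e1
    rw [cob_zero.1 ha2, zero_add] at e2
    exact AddSubgroup.mem_sup.2 ⟨0, zero_mem _, f, hN _ ⟨e1 ▸ hb1, e2 ▸ hb2⟩, zero_add _⟩
  | succ k =>
    obtain ⟨g1, hg1, rfl⟩ := cob_succ.1 ha1
    obtain ⟨g2, hg2, rfl⟩ := cob_succ.1 ha2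
    have hd : d (g1 - g2) = b2 - b1 := by
      rw [d_sub, sub_eq_sub_iff_add_eq_add, e1, add_comm b2, e2]
    have := hs k rfl (g1 - g2) (sub_mem hg1 hg2)
      (hd ▸ sub_mem (h2s _ hb2) (h1s _ hb1))
    obtain ⟨c, hc, s, hs', e⟩ := AddSubgroup.mem_sup.1 this
    obtain ⟨s1, hs1, s2, hs2, rfl⟩ := AddSubgroup.mem_sup.1 (hsup k rfl hs')
    refine AddSubgroup.mem_sup.2 ⟨d (g1 - s1 - c), cob_succ.2
      ⟨_, sub_mem (sub_mem hg1 (h1P _ hs1)) (cob_le P _ hc), rfl⟩,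
      f - d (g1 - s1 - c), hN _ (mem_inf.2 ⟨?_, ?_⟩), by abel⟩
    · have : f - d (g1 - s1 - c) = b1 + d s1 := by
        rw [d_sub, d_sub, d_cob hc, ← e1]; abel
      rw [this]; exact add_mem hb1 (N1.dc hs1)
    · have : g1 - s1 - c = g2 + s2 := by
        rw [← sub_eq_zero] at e ⊢; rw [← neg_eq_zero, ← e]; abel
      rw [this, d_add, ← e2]
      have : d g2 + b2 - (d g2 + d s2) = b2 - d s2 := by abel
      rw [this]; exact sub_mem hb2 (N2.dc hs2)

lemma V_trans {R P N : Sub X} {m : ℕ} (hNP : N ≤ P) (hPR : P ≤ R) (h1 : V R P m) (h2 : V P N m) :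
    V R N m := by
  intro f hf hdf
  obtain ⟨a, ha, b, hb, rfl⟩ := AddSubgroup.mem_sup.1 (h1 f hf (hNP _ hdf))
  rw [d_add, d_cob ha, zero_add] at hdf
  exact add_mem (AddSubgroup.mem_sup_left ha)
    (sup_le_sup_right (cob_mono hPR m) _ (h2 b hb hdf))

lemma V_sub {R P N : Sub X} {m : ℕ} (hNP : N ≤ P) (hPR : P ≤ R) (h1 : V R N m)
    (h2 : ∀ k, m = k + 1 → V R P k) : V P N m := by
  intro f hf hdf
  obtain ⟨a, ha, b, hb, e⟩ := AddSubgroup.mem_sup.1 (h1 f (hPR _ hf) hdf)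
  refine AddSubgroup.mem_sup.2 ⟨a, ?_, b, hb, e⟩
  cases m with
  | zero => exact ha
  | succ k =>
    obtain ⟨g, hg, rfl⟩ := cob_succ.1 ha
    have : d g ∈ P (k+1) := by
      rw [← eq_sub_iff_add_eq] at e; rw [e]; exact sub_mem hf (hNP _ hb)
    obtain ⟨a', ha', b', hb', rfl⟩ := AddSubgroup.mem_sup.1 (h2 k rfl g hg this)
    exact cob_succ.2 ⟨b', hb', by rw [d_add, d_cob ha', zero_add]⟩

lemma V_exc1 {P N : Sub X} {m : ℕ} (h : V P (P ⊓ N) m) {R : Sub X} (hPR : P ≤ R)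
    (hR : R m ≤ P m ⊔ N m) : V R N m := by
  intro f hf hdf
  obtain ⟨p, hp, q, hq, rfl⟩ := AddSubgroup.mem_sup.1 (hR hf)
  have : d p ∈ N (m+1) := by
    rw [d_add] at hdf; simpa using sub_mem hdf (N.dc hq)
  obtain ⟨a, ha, b, hb, rfl⟩ := AddSubgroup.mem_sup.1 (h p hp ⟨P.dc hp, this⟩)
  rw [add_assoc]
  exact AddSubgroup.mem_sup.2 ⟨a, cob_mono hPR m ha, _, add_mem hb.2 hq, rfl⟩

lemma V_exc2 {P N : Sub X} {m : ℕ} {R : Sub X} (h : V R N m) (hPR : P ≤ R)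
    (hR : ∀ k, m = k + 1 → R k ≤ P k ⊔ N k) : V P (P ⊓ N) m := by
  intro f hf hdf
  obtain ⟨a, ha, b, hb, e⟩ := AddSubgroup.mem_sup.1 (h f (hPR _ hf) hdf.2)
  cases m with
  | zero =>
    rw [cob_zero.1 ha, zero_add] at e
    exact AddSubgroup.mem_sup.2 ⟨0, zero_mem _, f, ⟨hf, e ▸ hb⟩, zero_add _⟩
  | succ k =>
    obtain ⟨g, hg, rfl⟩ := cob_succ.1 ha
    obtain ⟨p, hp, q, hq, rfl⟩ := AddSubgroup.mem_sup.1 (hR k rfl hg)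
    refine AddSubgroup.mem_sup.2 ⟨d p, cob_succ.2 ⟨p, hp, rfl⟩, f - d p,
      mem_inf.2 ⟨sub_mem hf (P.dc hp), ?_⟩, by abel⟩
    have : f - d p = d q + b := by rw [← e, d_add]; abel
    rw [this]; exact add_mem (N.dc hq) hb

end abstr
end MS


set_option linter.unusedSectionVars false
set_option linter.unusedVariables false

namespace MS
open Set Topology

section top
variable {X : Type*} [TopologicalSpace X]

/-- Local vanishing near the point `x` of the diagonal. -/
def LZ {m : ℕ} (f : Co X ℤ m) (x : X) : Prop := ∃ W ∈ 𝓝 x, ∀ t, (∀ i, t i ∈ W) → f t = 0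

lemma LZ.add {m : ℕ} {f g : Co X ℤ m} {x : X} (hf : LZ f x) (hg : LZ g x) : LZ (f + g) x := by
  obtain ⟨U, hU, h⟩ := hf
  obtain ⟨W, hW, h'⟩ := hg
  refine ⟨U ∩ W, Filter.inter_mem hU hW, fun t ht => ?_⟩
  simp [h t fun i => (ht i).1, h' t fun i => (ht i).2]

lemma LZ.neg {m : ℕ} {f : Co X ℤ m} {x : X} (hf : LZ f x) : LZ (-f) x := by
  obtain ⟨U, hU, h⟩ := hf
  exact ⟨U, hU, fun t ht => by simp [h t ht]⟩

lemma LZ.d {m : ℕ} {f : Co X ℤ m} {x : X} (hf : LZ f x) : LZ (d f) x := by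
  obtain ⟨U, hU, h⟩ := hf
  refine ⟨U, hU, fun t ht => ?_⟩
  rw [d_local (g := 0) h t ht, d_zero]; rfl

lemma LZ_zero {m : ℕ} (x : X) : LZ (0 : Co X ℤ m) x := ⟨univ, Filter.univ_mem, fun _ _ => rfl⟩

lemma isOpen_LZ {m : ℕ} (f : Co X ℤ m) : IsOpen {x | LZ f x} := by
  rw [isOpen_iff_mem_nhds]
  rintro x ⟨W, hW, h⟩
  filter_upwards [eventually_mem_nhds_iff.2 hW] with y hy
  exact ⟨W, hy, h⟩

/-- Cochains vanishing near the points of `S`. -/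
def N (S : Set X) : Sub X where
  c m := { carrier := {f | ∀ x ∈ S, LZ f x}
           zero_mem' := fun x _ => LZ_zero x
           add_mem' := fun hf hg x hx => (hf x hx).add (hg x hx)
           neg_mem' := fun hf x hx => (hf x hx).neg }
  dc := fun hf x hx => (hf x hx).d

lemma mem_N {S : Set X} {m : ℕ} {f : Co X ℤ m} : f ∈ N S m ↔ ∀ x ∈ S, LZ f x := Iff.rfl

lemma N_anti {S T : Set X} (h : S ⊆ T) : N T ≤ N S := fun _ _ hf x hx => hf x (h hx)

lemma mem_N_union {S T : Set X} {m : ℕ} {f : Co X ℤ m} :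
    f ∈ N (S ∪ T) m ↔ f ∈ N S m ∧ f ∈ N T m := by
  simp only [mem_N]
  exact ⟨fun h => ⟨fun x hx => h x (Or.inl hx), fun x hx => h x (Or.inr hx)⟩,
    fun h x hx => hx.elim (h.1 x) (h.2 x)⟩

lemma N_union (S T : Set X) : N (S ∪ T) = N S ⊓ N T := by
  have : (N (S ∪ T)).c = (N S ⊓ N T).c := by
    funext m; ext f; exact mem_N_union
  cases h1 : N (S ∪ T); cases h2 : N S ⊓ N T
  simp_all

lemma mem_N_empty {m : ℕ} (f : Co X ℤ m) : f ∈ N (∅ : Set X) m := fun x hx => hx.elim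

open Classical in
/-- Cutting off a cochain by its first argument. -/
noncomputable def cut {m : ℕ} (P : Set X) (f : Co X ℤ (m+1)) : Co X ℤ (m+1) :=
  fun t => if t 0 ∈ P then f t else 0

lemma cut_of_mem {m : ℕ} {P : Set X} (f : Co X ℤ (m+1)) {t : Fin (m+1) → X} (h : t 0 ∈ P) :
    cut P f t = f t := by classical exact if_pos h
lemma cut_of_notMem {m : ℕ} {P : Set X} (f : Co X ℤ (m+1)) {t : Fin (m+1) → X} (h : t 0 ∉ P) :
    cut P f t = 0 := by classical exact if_neg h

lemma cut_add {m : ℕ} (P : Set X) (f g : Co X ℤ (m+1)) :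
    cut P (f + g) = cut P f + cut P g := by
  funext t; by_cases h : t 0 ∈ P <;> simp [cut_of_mem, cut_of_notMem, h]

lemma cut_compl {m : ℕ} (P : Set X) (f : Co X ℤ (m+1)) : cut P f + cut Pᶜ f = f := by
  funext t; by_cases h : t 0 ∈ P
  · simp [cut_of_mem, cut_of_notMem, h]
  · have h' : t 0 ∈ Pᶜ := h
    simp [cut_of_mem, cut_of_notMem, h, h']

lemma LZ_cut {m : ℕ} {P : Set X} {f : Co X ℤ (m+1)} {x : X} (h : LZ f x) : LZ (cut P f) x := by
  obtain ⟨W, hW, hf⟩ := h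
  refine ⟨W, hW, fun t ht => ?_⟩
  by_cases h : t 0 ∈ P
  · rw [cut_of_mem f h, hf t ht]
  · rw [cut_of_notMem f h]

lemma LZ_cut_of_notMem {m : ℕ} {P : Set X} {f : Co X ℤ (m+1)} {x : X} (h : x ∉ closure P) :
    LZ (cut P f) x :=
  ⟨Pᶜ, by
    have : (closure P)ᶜ ∈ 𝓝 x := isClosed_closure.isOpen_compl.mem_nhds h
    exact Filter.mem_of_superset this (compl_subset_compl.2 subset_closure),
    fun t ht => cut_of_notMem f (ht 0)⟩

lemma LZ_cut_compl {m : ℕ} {P : Set X} {f : Co X ℤ (m+1)} {x : X} (h : P ∈ 𝓝 x) :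
    LZ (cut Pᶜ f) x :=
  ⟨P, h, fun t ht => cut_of_notMem f (fun h => h (ht 0))⟩

lemma LZ_sub_cut {m : ℕ} {P : Set X} {f : Co X ℤ (m+1)} {x : X} (h : P ∈ 𝓝 x) :
    LZ (f - cut P f) x := by
  have := LZ_cut_compl (f := f) h
  rwa [eq_sub_of_add_eq' (cut_compl P f)] at this

/-- Decomposition along two closed sets. -/
lemma N_inter_le [NormalSpace X] {S T : Set X} (hS : IsClosed S) (hT : IsClosed T) {m : ℕ}
    (h : m ≠ 0 ∨ (S ∩ T).Nonempty ∨ S = ∅ ∨ T = ∅) : N (S ∩ T) m ≤ N S m ⊔ N T m := by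
  intro f hf
  rcases m with _ | m
  · rcases h with h | ⟨x, hx⟩ | rfl | rfl
    · exact absurd rfl h
    · obtain ⟨W, -, hW⟩ := hf x hx
      have : f = 0 := by funext t; exact hW t (fun i => i.elim0)
      rw [this]; exact zero_mem _
    · exact AddSubgroup.mem_sup_left (mem_N_empty f)
    · exact AddSubgroup.mem_sup_right (mem_N_empty f)
  have hO := (isOpen_LZ f).isClosed_compl
  obtain ⟨P, hPo, hP1, hP2⟩ := normal_exists_closure_subset (hT.inter hO)
    (hS.inter hO).isOpen_compl (fun x hx hx' => hx.2 (hf x ⟨hx'.1, hx.1⟩))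
  refine AddSubgroup.mem_sup.2 ⟨cut P f, fun x hx => ?_, cut Pᶜ f, fun x hx => ?_, cut_compl P f⟩
  · by_cases hx' : LZ f x
    · exact LZ_cut hx'
    · exact LZ_cut_of_notMem fun h => hP2 h ⟨hx, hx'⟩
  · by_cases hx' : LZ f x
    · exact LZ_cut hx'
    · exact LZ_cut_compl (hPo.mem_nhds (hP1 ⟨hx, hx'⟩))

section act
variable (A : Type*) [Group A] [MulAction A X]

/-- Invariant cochains. -/
def inv : Sub X where
  c m := { carrier := {f | ∀ a : A, pull (a • · : X → X) f = f}
           zero_mem' := fun _ => rfl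
           add_mem' := fun hf hg a => by rw [pull_add, hf a, hg a]
           neg_mem' := fun {f} hf a => by
            have : pull (a • · : X → X) (-f) = - pull (a • · : X → X) f := rfl
            rw [this, hf a] }
  dc := fun hf a => by rw [← d_pull, hf a]

variable {A}
lemma mem_inv {m : ℕ} {f : Co X ℤ m} : f ∈ inv A m ↔ ∀ a : A, pull (a • · : X → X) f = f := Iff.rfl

lemma inv_apply {m : ℕ} {f : Co X ℤ m} (hf : f ∈ inv A m) (a : A) (t : Fin m → X) :
    f (fun i => a • t i) = f t := congrFun (hf a) t

lemma inv_zero (f : Co X ℤ 0) : f ∈ inv A 0 := by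
  intro a; funext t; rw [pull_apply]; congr 1; exact Subsingleton.elim _ _

variable (A) in
/-- Invariant cochains vanishing near `S`. -/
def NA (S : Set X) : Sub X := N S ⊓ inv A

lemma mem_NA {S : Set X} {m : ℕ} {f : Co X ℤ m} :
    f ∈ NA A S m ↔ f ∈ N S m ∧ f ∈ inv A m := Iff.rfl

lemma NA_anti {S T : Set X} (h : S ⊆ T) : NA A T ≤ NA A S :=
  fun _ _ hf => ⟨N_anti h _ hf.1, hf.2⟩

lemma mem_NA_union {S T : Set X} {m : ℕ} {f : Co X ℤ m} :
    f ∈ NA A (S ∪ T) m ↔ f ∈ NA A S m ∧ f ∈ NA A T m := by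
  simp only [mem_NA, mem_N_union]; tauto

variable (A) in
/-- Invariant sets. -/
def Inv (S : Set X) : Prop := ∀ (a : A), ∀ x ∈ S, a • x ∈ S

lemma Inv.iff {S : Set X} (h : Inv A S) (a : A) (x : X) : a • x ∈ S ↔ x ∈ S :=
  ⟨fun hx => by simpa using h a⁻¹ _ hx, h a x⟩

lemma Inv.compl {S : Set X} (h : Inv A S) : Inv A Sᶜ := fun a x hx hx' => hx ((h.iff a x).1 hx')
lemma Inv.union {S T : Set X} (h : Inv A S) (h' : Inv A T) : Inv A (S ∪ T) :=
  fun a x hx => hx.imp (h a x) (h' a x)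
lemma Inv.inter {S T : Set X} (h : Inv A S) (h' : Inv A T) : Inv A (S ∩ T) :=
  fun a x hx => ⟨h a x hx.1, h' a x hx.2⟩
lemma Inv.diff {S T : Set X} (h : Inv A S) (h' : Inv A T) : Inv A (S \ T) :=
  h.inter h'.compl

variable (A) in
/-- Saturation. -/
def sat (S : Set X) : Set X := {y | ∃ a : A, a • y ∈ S}

lemma subset_sat (S : Set X) : S ⊆ sat A S := fun x hx => ⟨1, by simpa using hx⟩
lemma Inv_sat (S : Set X) : Inv A (sat A S) := fun a x ⟨b, hb⟩ => ⟨b * a⁻¹, by simpa [mul_smul]⟩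
lemma sat_eq_iUnion (S : Set X) : sat A S = ⋃ a : A, (a • · : X → X) ⁻¹' S := by
  ext x; simp [sat]
lemma sat_subset {S T : Set X} (hT : Inv A T) (h : S ⊆ T) : sat A S ⊆ T :=
  fun x ⟨a, ha⟩ => (hT.iff a x).1 (h ha)
lemma sat_mono {S T : Set X} (h : S ⊆ T) : sat A S ⊆ sat A T := fun _ ⟨a, ha⟩ => ⟨a, h ha⟩

lemma cut_mem_inv {m : ℕ} {P : Set X} (hP : Inv A P) {f : Co X ℤ (m+1)} (hf : f ∈ inv A (m+1)) :
    cut P f ∈ inv A (m+1) := by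
  intro a; funext t
  by_cases h : t 0 ∈ P
  · rw [cut_of_mem f h, pull_apply, cut_of_mem f (hP a _ h)]; exact congrFun (hf a) t
  · rw [cut_of_notMem f h, pull_apply, cut_of_notMem f (fun h' => h ((hP.iff a _).1 h'))]

variable [ContinuousConstSMul A X]

lemma isOpen_sat {S : Set X} (h : IsOpen S) : IsOpen (sat A S) := by
  rw [sat_eq_iUnion]; exact isOpen_iUnion fun a => h.preimage (continuous_const_smul a)
lemma isClosed_sat [Finite A] {S : Set X} (h : IsClosed S) : IsClosed (sat A S) := by
  rw [sat_eq_iUnion]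
  exact isClosed_iUnion_of_finite fun a => h.preimage (continuous_const_smul a)

lemma LZ_smul {m : ℕ} {f : Co X ℤ m} (a : A) {x : X} (h : LZ f (a • x)) :
    LZ (pull (a • · : X → X) f) x := by
  obtain ⟨W, hW, hf⟩ := h
  exact ⟨_, (continuous_const_smul a).continuousAt.preimage_mem_nhds hW, fun t ht => hf _ ht⟩

lemma LZ_inv {m : ℕ} {f : Co X ℤ m} (hf : f ∈ inv A m) : Inv A {x | LZ f x} := by
  intro a x hx
  have := LZ_smul (f := f) a⁻¹ (x := a • x) (by simpa using hx)
  rwa [hf] at this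

lemma N_sat {m : ℕ} {S : Set X} {f : Co X ℤ m} (hf : f ∈ N S m) (hi : f ∈ inv A m) :
    f ∈ NA A (sat A S) m :=
  ⟨fun x ⟨a, ha⟩ => ((LZ_inv hi).iff a x).1 (hf _ ha), hi⟩

lemma NA_inter_le [NormalSpace X] [Finite A] {S T : Set X} (hS : IsClosed S) (hT : IsClosed T)
    (iS : Inv A S) (iT : Inv A T) {m : ℕ} (h : m ≠ 0) :
    NA A (S ∩ T) m ≤ NA A S m ⊔ NA A T m := by
  rintro f ⟨hf, hi⟩
  rcases m with _ | m
  · exact absurd rfl h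
  have hO := (isOpen_LZ f).isClosed_compl
  have iO := (LZ_inv hi).compl
  obtain ⟨P, hPo, hP1, hP2⟩ := normal_exists_closure_subset (hT.inter hO)
    (hS.inter hO).isOpen_compl (fun x hx hx' => hx.2 (hf x ⟨hx'.1, hx.1⟩))
  have hQ : closure (sat A P) ⊆ (S ∩ {x | LZ f x}ᶜ)ᶜ := by
    refine (closure_minimal (sat_mono subset_closure) (isClosed_sat isClosed_closure)).trans ?_
    exact sat_subset (iS.inter iO).compl hP2
  refine AddSubgroup.mem_sup.2 ⟨cut (sat A P) f, ⟨fun x hx => ?_, cut_mem_inv (Inv_sat P) hi⟩,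
    cut (sat A P)ᶜ f, ⟨fun x hx => ?_, cut_mem_inv (Inv_sat P).compl hi⟩, cut_compl _ f⟩
  · by_cases hx' : LZ f x
    · exact LZ_cut hx'
    · exact LZ_cut_of_notMem fun h => hQ h ⟨hx, hx'⟩
  · by_cases hx' : LZ f x
    · exact LZ_cut hx'
    · exact LZ_cut_compl ((isOpen_sat hPo).mem_nhds (subset_sat _ (hP1 ⟨hx, hx'⟩)))

end act

lemma V_exc [NormalSpace X] {S T K : Set X} (hS : IsClosed S) (hT : IsClosed T) (hK : IsClosed K)
    (e : S ∩ K = T ∩ K) {m : ℕ} (h : 2 ≤ m ∨ (S ∩ K).Nonempty)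
    (hV : V (N S) (N (S ∪ K)) m) : V (N T) (N (T ∪ K)) m := by
  rw [N_union] at hV ⊢
  have h0 : ∀ k, k + 1 = m ∨ k = m → k ≠ 0 ∨ (S ∩ K).Nonempty ∨ S = ∅ ∨ K = ∅ := by
    intro k hk; rcases h with h | h
    · left; omega
    · exact Or.inr (Or.inl h)
  have h1 : V (N (S ∩ K)) (N K) m :=
    V_exc1 hV (N_anti inter_subset_left) (N_inter_le hS hK (h0 m (Or.inr rfl)))
  refine V_exc2 h1 (e ▸ N_anti inter_subset_left) fun k hk => ?_
  rw [e]
  refine N_inter_le hT hK ?_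
  rcases h0 k (Or.inl hk.symm) with h | h | h | h
  · exact Or.inl h
  · exact Or.inr (Or.inl (e ▸ h))
  · rw [h, empty_inter] at e
    rcases (h0 k (Or.inl hk.symm)) with h' | h' | h' 
    · exact Or.inl h'
    · simp [h] at h'
    · rcases ‹2 ≤ m ∨ (S ∩ K).Nonempty› with h3 | h3
      · left; omega
      · simp [h] at h3
  · exact Or.inr (Or.inr (Or.inr h))

/-- Relative acyclicity. -/
lemma relAcyc [NormalSpace X] {T K : Set X} (hT : IsClosed T) (hK : IsClosed K)
    (hne : (T ∩ K).Nonempty) (h1 : ∀ m, V (N ∅) (N K) m) (h2 : ∀ m, V (N ∅) (N (T ∩ K)) m)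
    (m : ℕ) : V (N T) (N (T ∪ K)) m := by
  refine V_exc (hT.inter hK) hT hK (by rw [inter_assoc, inter_self]) (Or.inr (by
    rwa [inter_assoc, inter_self])) ?_
  rw [union_eq_self_of_subset_left inter_subset_right]
  exact V_sub (N_anti inter_subset_right) (N_anti (empty_subset _)) (h1 m) (fun k _ => h2 k)

end top
end MS


set_option linter.unusedSectionVars false
set_option linter.unusedVariables false

namespace MS
open Set Topology

section principle
variable {X : Type*}

/-- Hypotheses for cutting along a real coordinate. -/
structure CutOK (P : Sub X) (NF : Set X → Sub X) (Fam : Set X → Prop) (D : ℕ → ℕ → Prop)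
    (c : X → ℝ) : Prop where
  fam : ∀ F, Fam F → ∀ s t, Fam (F ∩ c ⁻¹' Icc s t)
  bdd : ∀ F, Fam F → ∃ a b, F ⊆ c ⁻¹' Icc a b
  inf : ∀ F, Fam F → ∀ s t u, s ≤ t → t ≤ u →
    NF (F ∩ c ⁻¹' Icc s t) ⊓ NF (F ∩ c ⁻¹' Icc t u) ≤ NF (F ∩ c ⁻¹' Icc s u)
  sup : ∀ F, Fam F → ∀ s t u, s ≤ t → t ≤ u → ∀ j k, D j k →
    NF (F ∩ c ⁻¹' Icc t t) k ≤ NF (F ∩ c ⁻¹' Icc s t) k ⊔ NF (F ∩ c ⁻¹' Icc t u) k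
  cont : ∀ F, Fam F → ∀ t m, ∀ f ∈ NF (F ∩ c ⁻¹' Icc t t) m,
    ∃ ε > 0, f ∈ NF (F ∩ c ⁻¹' Icc (t - ε) (t + ε)) m

lemma step1 {P : Sub X} {NF : Set X → Sub X} {Fam : Set X → Prop} {D : ℕ → ℕ → Prop}
    {c : X → ℝ} (h : CutOK P NF Fam D c) (hP : ∀ F, NF F ≤ P)
    (mono : ∀ F G, F ⊆ G → NF G ≤ NF F) {j m : ℕ} (hD : ∀ k, m = k + 1 → D j k)
    {F : Set X} (hF : Fam F) (h1 : ∀ t, V P (NF (F ∩ c ⁻¹' Icc t t)) m)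
    (h2 : ∀ k, m = k + 1 → ∀ t, V P (NF (F ∩ c ⁻¹' Icc t t)) k) : V P (NF F) m := by
  intro f hf hdf
  obtain ⟨a, b, hab⟩ := h.bdd F hF
  rcases lt_or_ge b a with hba | hba
  · have : F = F ∩ c ⁻¹' Icc a a := by
      rw [Icc_eq_empty (not_le.2 hba)] at hab
      simp only [preimage_empty, subset_empty_iff] at hab
      simp [hab]
    rw [this] at hdf ⊢
    exact h1 a f hf hdf
  let Pr : ℝ → ℝ → Prop := fun s t => f ∈ cob P m ⊔ NF (F ∩ c ⁻¹' Icc s t) m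
  have hmono : ∀ s t s' t', s ≤ s' → t' ≤ t → Pr s t → Pr s' t' := by
    intro s t s' t' hs ht hp
    refine sup_le_sup_left (mono _ _ ?_ m) _ hp
    exact inter_subset_inter_right _ (preimage_mono (Icc_subset_Icc hs ht))
  have hloc : ∀ t, ∃ ε > 0, Pr (t - ε) (t + ε) := by
    intro t
    obtain ⟨p, hp, q, hq, e⟩ := AddSubgroup.mem_sup.1
      (h1 t f hf (mono _ _ inter_subset_left _ hdf))
    obtain ⟨ε, hε, hq'⟩ := h.cont F hF t m q hq
    exact ⟨ε, hε, AddSubgroup.mem_sup.2 ⟨p, hp, q, hq', e⟩⟩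
  have hcomb : ∀ s t u, s ≤ t → t ≤ u → Pr s t → Pr t u → Pr s u := by
    intro s t u hst htu p1 p2
    refine mvN p1 p2 (fun k hk => h2 k hk t) (fun k hk => h.sup F hF s t u hst htu j k (hD k hk))
      (mono _ _ ?_) (mono _ _ ?_) (hP _) (h.inf F hF s t u hst htu)
    · exact inter_subset_inter_right _ (preimage_mono (Icc_subset_Icc hst le_rfl))
    · exact inter_subset_inter_right _ (preimage_mono (Icc_subset_Icc le_rfl htu))
  choose ε hε hPr using hloc
  obtain ⟨t, ht0, htm, ⟨M, hM⟩, ht⟩ := exists_monotone_Icc_subset_open_cover_Icc hba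
    (c := fun i : ℝ => {x : Icc a b | i - ε i < x ∧ (x : ℝ) < i + ε i})
    (fun i => (isOpen_lt continuous_const continuous_subtype_val).inter
      (isOpen_lt continuous_subtype_val continuous_const))
    (fun x _ => mem_iUnion.2 ⟨x, by constructor <;> linarith [hε x]⟩)
  have key : ∀ n, Pr a (t n) := by
    intro n
    induction n with
    | zero =>
      rw [ht0]
      exact hmono _ _ _ _ (by linarith [hε a]) (by linarith [hε a]) (hPr a)
    | succ n ih =>
      refine hcomb a (t n) (t (n+1)) (t n).2.1 (htm (Nat.le_succ n)) ih ?_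
      obtain ⟨i, hi⟩ := ht n
      have h1 := hi (left_mem_Icc.2 (htm (Nat.le_succ n)))
      have h2 := hi (right_mem_Icc.2 (htm (Nat.le_succ n)))
      exact hmono _ _ _ _ h1.1.le h2.2.le (hPr i)
  have := key M
  rw [hM M le_rfl] at this
  have e : F ∩ c ⁻¹' Icc a b = F := inter_eq_left.2 hab
  simpa only [Pr, e] using this

/-- The bisection principle. -/
lemma bisect {P : Sub X} {NF : Set X → Sub X} {D : ℕ → ℕ → Prop}
    (hP : ∀ F, NF F ≤ P) (mono : ∀ F G, F ⊆ G → NF G ≤ NF F)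
    (hD1 : ∀ j m, D (j+1) m → D j m) (hD2 : ∀ j m, D (j+1) (m+1) → D j m)
    (l : List (X → ℝ)) : ∀ (Fam : Set X → Prop) (h : ∀ c ∈ l, CutOK P NF Fam D c)
    (base : ∀ F, Fam F → (∀ c ∈ l, ∀ x ∈ F, ∀ y ∈ F, c x = c y) → ∀ m, D 0 m → V P (NF F) m),
    ∀ F, Fam F → ∀ m, D l.length m → V P (NF F) m := by
  induction l with
  | nil => intro Fam h base F hF m hm; exact base F hF (by simp) m hm
  | cons c l ih =>
    intro Fam h base F hF m hm
    have hc := h c (by simp)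
    have ih' := ih (fun G => Fam G ∧ ∀ x ∈ G, ∀ y ∈ G, c x = c y)
      (fun e he => by
        have := h e (by simp [he])
        exact { fam := fun F hF s t => ⟨this.fam F hF.1 s t,
                  fun x hx y hy => hF.2 x hx.1 y hy.1⟩
                bdd := fun F hF => this.bdd F hF.1
                inf := fun F hF => this.inf F hF.1
                sup := fun F hF => this.sup F hF.1
                cont := fun F hF => this.cont F hF.1 })
      (fun F hF hl m hm => base F hF.1 (by
        intro e he
        rcases List.mem_cons.1 he with rfl | he
        · exact hF.2
        · exact hl e he) m hm)
    have hG : ∀ t, Fam (F ∩ c ⁻¹' Icc t t) ∧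
        ∀ x ∈ F ∩ c ⁻¹' Icc t t, ∀ y ∈ F ∩ c ⁻¹' Icc t t, c x = c y := fun t =>
      ⟨hc.fam F hF t t, fun x hx y hy => by
        have h1 := hx.2; have h2 := hy.2
        simp only [Icc_self, mem_preimage, mem_singleton_iff] at h1 h2; rw [h1, h2]⟩
    exact step1 hc hP mono (j := l.length) (fun k hk => hD2 _ _ (by subst hk; exact hm)) hF
      (fun t => ih' _ (hG t) m (hD1 _ _ hm))
      (fun k hk t => ih' _ (hG t) k (hD2 _ _ (by subst hk; exact hm)))

lemma V_refl (P : Sub X) (m : ℕ) : V P P m := fun _ hf _ => AddSubgroup.mem_sup_right hf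

end principle

section N
variable {X : Type*} [TopologicalSpace X] [T2Space X] [CompactSpace X]

lemma slab {F O : Set X} (hF : IsClosed F) (hO : IsOpen O) {c : X → ℝ} (hc : ContinuousOn c F)
    {t : ℝ} (h : F ∩ c ⁻¹' Icc t t ⊆ O) : ∃ ε > 0, F ∩ c ⁻¹' Icc (t - ε) (t + ε) ⊆ O := by
  have hK : IsCompact (F \ O) := (hF.sdiff hO).isCompact
  rcases (F \ O).eq_empty_or_nonempty with he | hne
  · exact ⟨1, one_pos, fun x hx => by_contra fun h' => (he ▸ (⟨hx.1, h'⟩ : x ∈ F \ O) : x ∈ (∅ : Set X))⟩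
  obtain ⟨x, hx, hmin⟩ := hK.exists_isMinOn hne
    (f := fun x => |c x - t|) (((hc.mono sdiff_subset).sub continuousOn_const).abs)
  have hpos : 0 < |c x - t| := by
    rw [abs_pos, sub_ne_zero]
    intro e
    exact hx.2 (h ⟨hx.1, by simp [e]⟩)
  refine ⟨|c x - t| / 2, by positivity, fun y hy => by_contra fun hyO => ?_⟩
  have h1 : |c x - t| ≤ |c y - t| := hmin (⟨hy.1, hyO⟩ : y ∈ F \ O)
  have h2 : |c y - t| ≤ |c x - t| / 2 := by
    have := hy.2
    simp only [mem_preimage, mem_Icc] at this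
    rw [abs_le]; constructor <;> linarith [this.1, this.2]
  linarith

lemma isClosed_slab {F : Set X} (hF : IsClosed F) {c : X → ℝ} (hc : ContinuousOn c F) (s t : ℝ) :
    IsClosed (F ∩ c ⁻¹' Icc s t) := hc.preimage_isClosed_of_isClosed hF isClosed_Icc

lemma slab_union (F : Set X) (c : X → ℝ) {s t u : ℝ} (h1 : s ≤ t) (h2 : t ≤ u) :
    F ∩ c ⁻¹' Icc s u = F ∩ c ⁻¹' Icc s t ∪ F ∩ c ⁻¹' Icc t u := by
  rw [← inter_union_distrib_left, ← preimage_union, Icc_union_Icc_eq_Icc h1 h2]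

lemma slab_inter (F : Set X) (c : X → ℝ) {s t u : ℝ} (h1 : s ≤ t) (h2 : t ≤ u) :
    (F ∩ c ⁻¹' Icc s t) ∩ (F ∩ c ⁻¹' Icc t u) = F ∩ c ⁻¹' Icc t t := by
  rw [← inter_inter_distrib_left, ← preimage_inter, Icc_inter_Icc_eq_singleton h1 h2, Icc_self]

lemma cutOK_N {T : Set X} (hT : IsClosed T) {Fam : Set X → Prop} {D : ℕ → ℕ → Prop} {c : X → ℝ}
    (fam : ∀ F, Fam F → ∀ s t, Fam (F ∩ c ⁻¹' Icc s t)) (hcl : ∀ F, Fam F → IsClosed F)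
    (hc : ∀ F, Fam F → ContinuousOn c F)
    (hne : ∀ F, Fam F → ∀ s t u, s ≤ t → t ≤ u → ∀ j k, D j k → k ≠ 0 ∨
      (T ∪ (F ∩ c ⁻¹' Icc t t)).Nonempty ∨ T ∪ (F ∩ c ⁻¹' Icc s t) = ∅ ∨
      T ∪ (F ∩ c ⁻¹' Icc t u) = ∅) :
    CutOK (N T) (fun F => N (T ∪ F)) Fam D c where
  fam := fam
  bdd F hF := by
    obtain ⟨b, hb⟩ := (hcl F hF).isCompact.exists_bound_of_continuousOn (hc F hF)
    exact ⟨-b, b, fun x hx => abs_le.1 (hb x hx)⟩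
  inf F hF s t u h1 h2 := by
    intro m f hf
    show f ∈ N _ m
    rw [slab_union F c h1 h2, mem_N_union, mem_N_union]
    have a1 := mem_N_union.1 hf.1
    exact ⟨a1.1, a1.2, (mem_N_union.1 hf.2).2⟩
  sup F hF s t u h1 h2 j k hD := by
    have e : T ∪ (F ∩ c ⁻¹' Icc t t)
      = (T ∪ (F ∩ c ⁻¹' Icc s t)) ∩ (T ∪ (F ∩ c ⁻¹' Icc t u)) := by
      rw [← union_inter_distrib_left, slab_inter F c h1 h2]
    have := hne F hF s t u h1 h2 j k hD
    rw [e] at this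
    show N _ k ≤ _
    rw [e]
    exact N_inter_le (hT.union (isClosed_slab (hcl F hF) (hc F hF) _ _))
      (hT.union (isClosed_slab (hcl F hF) (hc F hF) _ _)) this
  cont F hF t m f hf := by
    have h := mem_N_union.1 hf
    obtain ⟨ε, hε, h'⟩ := slab (hcl F hF) (isOpen_LZ f) (hc F hF) (t := t) h.2
    exact ⟨ε, hε, mem_N_union.2 ⟨h.1, h'⟩⟩

lemma exists_closed_nhd {T : Set X} (hT : IsClosed T) {x : X} (hx : x ∉ T) :
    ∃ W, IsOpen W ∧ x ∈ W ∧ closure W ∩ T = ∅ := by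
  obtain ⟨W, hW, h1, h2⟩ := normal_exists_closure_subset (isClosed_singleton (x := x))
    hT.isOpen_compl (by simpa using hx)
  exact ⟨W, hW, by simpa using h1, by
    rw [← disjoint_iff_inter_eq_empty]; exact Set.disjoint_left.2 fun y hy hy' => h2 hy hy'⟩

lemma cone_local {m : ℕ} {f : Co X ℤ (m+1)} {x : X} {g : Co X ℤ m} {W : Set X} (hW : W ∈ 𝓝 x)
    (hg : ∀ t, (∀ i, t i ∈ W) → g t = sl f x t) (h : LZ (d f) x) : LZ (f - d g) x := by
  obtain ⟨W', hW', h'⟩ := h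
  refine ⟨W ∩ W', Filter.inter_mem hW hW', fun t ht => ?_⟩
  have h1 : d g t = d (sl f x) t := d_local hg t fun i => (ht i).1
  have h2 := congrFun (cone f x) t
  have h3 : sl (d f) x t = 0 := h' _ fun i => by
    refine Fin.cases ?_ (fun j => ?_) i
    · simpa using mem_of_mem_nhds hW'
    · simpa using (ht j).2
  rw [Pi.sub_apply, h1, h2, Pi.add_apply, h3]; ring

lemma V_point (x : X) (m : ℕ) : V (N ∅) (N {x}) m := by
  intro f hf hdf
  have hx := hdf x rfl
  rcases m with _ | m
  · obtain ⟨W, hW, h⟩ := hx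
    have : f = 0 := by
      rw [← sl_d_zero f x]; funext t
      refine h _ fun i => ?_
      refine Fin.cases ?_ (fun j => j.elim0) i
      simpa using mem_of_mem_nhds hW
    rw [this]; exact zero_mem _
  · refine AddSubgroup.mem_sup.2 ⟨d (sl f x), cob_succ.2 ⟨_, mem_N_empty _, rfl⟩,
      f - d (sl f x), ?_, by abel⟩
    rintro _ rfl
    exact cone_local Filter.univ_mem (fun _ _ => rfl) hx

lemma V_point_rel {T : Set X} (hT : IsClosed T) (x : X) {m : ℕ} (hm : 2 ≤ m) :
    V (N T) (N (T ∪ {x})) m := by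
  by_cases hxT : x ∈ T
  · rw [union_eq_self_of_subset_right (by simpa using hxT)]; exact V_refl _ _
  intro f hf hdf
  obtain ⟨k, rfl⟩ := Nat.exists_eq_add_of_le' hm
  obtain ⟨W, hWo, hxW, hWT⟩ := exists_closed_nhd hT hxT
  have hg : cut W (sl f x) ∈ N T (k+1) := fun y hy =>
    LZ_cut_of_notMem fun h => (hWT ▸ (⟨h, hy⟩ : y ∈ closure W ∩ T) : y ∈ (∅ : Set X))
  refine AddSubgroup.mem_sup.2 ⟨d (cut W (sl f x)), cob_succ.2 ⟨_, hg, rfl⟩,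
    f - d (cut W (sl f x)), mem_N_union.2 ⟨sub_mem hf ((N T).dc hg), ?_⟩, by abel⟩
  rintro _ rfl
  exact cone_local (hWo.mem_nhds hxW) (fun t ht => cut_of_mem _ (ht 0)) (hdf _ (Or.inr rfl))

section act
variable {A : Type*} [Group A] [Finite A] [MulAction A X] [ContinuousConstSMul A X]

variable (A) in
/-- Small neighbourhoods for a finite group action. -/
lemma exists_small (x : X) {U : Set X} (hU : U ∈ 𝓝 x) :
    ∃ W, IsOpen W ∧ x ∈ W ∧ W ⊆ U ∧ ∀ a : A, a • x ≠ x → ∀ y ∈ W, a • y ∉ W := by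
  have : ∀ a : A, ∃ W ∈ 𝓝 x, a • x ≠ x → ∀ y ∈ W, a • y ∉ W := by
    intro a
    by_cases h : a • x = x
    · exact ⟨univ, Filter.univ_mem, fun h' => absurd h h'⟩
    obtain ⟨u, v, hu, hv, hau, hxv, huv⟩ := t2_separation h
    refine ⟨v ∩ (a • ·) ⁻¹' u, Filter.inter_mem (hv.mem_nhds hxv)
      ((continuous_const_smul a).continuousAt.preimage_mem_nhds (hu.mem_nhds hau)), ?_⟩
    intro _ y hy hy'
    exact Set.disjoint_left.1 huv hy.2 hy'.1
  choose W hW h using this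
  refine ⟨interior ((⋂ a, W a) ∩ U), isOpen_interior, mem_interior_iff_mem_nhds.2
    (Filter.inter_mem (Filter.iInter_mem.2 hW) hU), interior_subset.trans inter_subset_right, ?_⟩
  intro a ha y hy hy'
  have h1 := mem_iInter.1 (interior_subset hy).1 a
  have h2 := mem_iInter.1 (interior_subset hy').1 a
  exact h a ha y h1 h2

lemma V_orbit {T : Set X} (hT : IsClosed T) (iT : Inv A T) (x : X) {m : ℕ} (hm : 2 ≤ m) :
    V (NA A T) (NA A (T ∪ sat A {x})) m := by
  by_cases hxT : x ∈ T
  · rw [union_eq_self_of_subset_right (sat_subset iT (by simpa using hxT))]; exact V_refl _ _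
  intro f hf hdf
  obtain ⟨k, rfl⟩ := Nat.exists_eq_add_of_le' hm
  obtain ⟨W1, hW1o, hxW1, hWT⟩ := exists_closed_nhd hT hxT
  obtain ⟨W, hWo, hxW, hWW1, hW⟩ := exists_small A x (hW1o.mem_nhds hxW1)
  classical
  let ρ : X → X := fun y => if h : y ∈ sat A W then (h.choose)⁻¹ • x else x
  have hρ : ∀ (a : A) y, a • y ∈ W → ρ y = a⁻¹ • x := by
    intro a y hy
    have h : y ∈ sat A W := ⟨a, hy⟩
    have e : ρ y = (h.choose)⁻¹ • x := dif_pos h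
    have h2 : h.choose • y ∈ W := h.choose_spec
    rw [e]
    generalize h.choose = b at *
    have : (b * a⁻¹) • x = x := by
      by_contra hne
      exact hW _ hne _ hy (by rwa [mul_smul, inv_smul_smul])
    rw [inv_smul_eq_iff, ← mul_smul, this]
  let g : Co X ℤ (k+1) := cut (sat A W) fun t => f (Fin.cons (ρ (t 0)) t)
  have hgi : g ∈ inv A (k+1) := by
    intro a; funext t
    rw [pull_apply]
    simp only [g]
    by_cases h : t 0 ∈ sat A W
    · have h' : ((fun x => a • x) ∘ t) 0 ∈ sat A W := Inv_sat W a _ h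
      rw [cut_of_mem _ h', cut_of_mem _ h]
      obtain ⟨b, hb⟩ := h
      have e1 := hρ b (t 0) hb
      have e2 := hρ (b * a⁻¹) (a • t 0) (by simpa [mul_smul] using hb)
      rw [← congrFun (hf.2 a) (Fin.cons (ρ (t 0)) t), pull_apply]
      congr 1
      funext i
      refine Fin.cases ?_ (fun j => ?_) i
      · simp [e1, e2, mul_smul]
      · simp
    · have h' : ((fun x => a • x) ∘ t) 0 ∉ sat A W := fun h' => h (((Inv_sat W).iff a _).1 h')
      rw [cut_of_notMem _ h', cut_of_notMem _ h]
  have hgN : g ∈ N T (k+1) := fun y hy => LZ_cut_of_notMem fun h => by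
    obtain ⟨a, ha⟩ := (closure_minimal (sat_mono subset_closure) (isClosed_sat isClosed_closure)) h
    exact (hWT ▸ (⟨closure_mono hWW1 ha, iT a y hy⟩ : a • y ∈ closure W1 ∩ T) :
      a • y ∈ (∅ : Set X))
  have hg : g ∈ NA A T (k+1) := ⟨hgN, hgi⟩
  have h3 : f - d g ∈ NA A T (k+2) := sub_mem hf ((NA A T).dc hg)
  refine AddSubgroup.mem_sup.2 ⟨d g, cob_succ.2 ⟨_, hg, rfl⟩, f - d g, ?_, by abel⟩
  refine mem_NA_union.2 ⟨h3, N_sat ?_ h3.2⟩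
  rintro _ rfl
  refine cone_local (hWo.mem_nhds hxW) (fun t ht => ?_) (hdf.1 _ (Or.inr (subset_sat _ rfl)))
  have e : g t = f (Fin.cons (ρ (t 0)) t) := cut_of_mem _ (subset_sat _ (ht 0))
  rw [e, hρ 1 (t 0) (by simpa using ht 0)]; simp

end act
end N
end MS


set_option linter.unusedSectionVars false
set_option linter.unusedVariables false

namespace MS
open Set Topology

lemma V_lift {X : Type*} {R P N : Sub X} {m : ℕ} (hNP : N ≤ P) (hPR : P ≤ R)
    (h1 : V P N (m+1)) (h2 : V R N m) : V R P m := by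
  intro f hf hdf
  have h0 : d (d f) ∈ N (m+2) := by rw [d_d]; exact zero_mem _
  obtain ⟨a, ha, ν, hν, e⟩ := AddSubgroup.mem_sup.1 (h1 _ hdf h0)
  obtain ⟨k, hk, rfl⟩ := cob_succ.1 ha
  have h3 : d (f - k) ∈ N (m+1) := by rw [d_sub, ← e]; simpa using hν
  have := h2 (f - k) (sub_mem hf (hPR _ hk)) h3
  have h4 : f - k + k ∈ cob R m ⊔ P m :=
    add_mem (sup_le_sup_left (hNP m) _ this) (AddSubgroup.mem_sup_right hk)
  simpa using h4

/-- Euclidean space. -/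
abbrev Eu (n : ℕ) := EuclideanSpace ℝ (Fin n)

section chart
variable {X : Type*} [TopologicalSpace X] [T2Space X] [CompactSpace X]

lemma bisect_fib {T F0 : Set X} (hT : IsClosed T) (hF0 : IsClosed F0) (l : List (X → ℝ))
    (hc : ∀ c ∈ l, ContinuousOn c F0) (D : ℕ → ℕ → Prop)
    (hD1 : ∀ j m, D (j+1) m → D j m) (hD2 : ∀ j m, D (j+1) (m+1) → D j m)
    (hne : T.Nonempty ∨ ∀ j k, D j k → k ≠ 0)
    (base : ∀ x ∈ F0, ∀ m, D 0 m → V (N T) (N (T ∪ {y ∈ F0 | ∀ c ∈ l, c y = c x})) m)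
    (m : ℕ) (hm : D l.length m) : V (N T) (N (T ∪ F0)) m := by
  refine bisect (NF := fun F => N (T ∪ F)) (fun F => N_anti subset_union_left)
    (fun F G h => N_anti (union_subset_union_right _ h)) hD1 hD2 l
    (fun F => IsClosed F ∧ F ⊆ F0 ∧ ∀ x ∈ F, ∀ y ∈ F0, (∀ c ∈ l, c x = c y) → y ∈ F)
    (fun c hcl => cutOK_N hT ?_ (fun F hF => hF.1) (fun F hF => (hc c hcl).mono hF.2.1) ?_) ?_
    F0 ⟨hF0, Subset.rfl, fun x _ y hy _ => hy⟩ m hm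
  · rintro F ⟨h1, h2, h3⟩ s t
    refine ⟨isClosed_slab h1 ((hc c hcl).mono h2) s t, inter_subset_left.trans h2, ?_⟩
    rintro x ⟨hx, hx'⟩ y hy h
    refine ⟨h3 x hx y hy h, ?_⟩
    rw [mem_preimage] at hx' ⊢
    rwa [← h c hcl]
  · intro F hF s t u _ _ j k hD
    rcases hne with h | h
    · exact Or.inr (Or.inl (h.mono subset_union_left))
    · exact Or.inl (h j k hD)
  · rintro F ⟨h1, h2, h3⟩ hconst m hm
    rcases F.eq_empty_or_nonempty with rfl | ⟨x, hx⟩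
    · show V (N T) (N _) m
      rw [union_empty]; exact V_refl _ _
    · have : F = {y ∈ F0 | ∀ c ∈ l, c y = c x} := by
        ext y
        exact ⟨fun hy => ⟨h2 hy, fun c hcl => hconst c hcl y hy x hx⟩,
          fun hy => h3 x hx y hy.1 fun c hcl => (hy.2 c hcl).symm⟩
      rw [this]; exact base x (h2 hx) m hm

variable {n : ℕ}

/-- Preimage of a set under a chart. -/
def Om (e : OpenPartialHomeomorph X (Eu n)) (K : Set (Eu n)) : Set X := e.source ∩ e ⁻¹' K

variable {e : OpenPartialHomeomorph X (Eu n)}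

lemma mem_Om {K : Set (Eu n)} {x : X} : x ∈ Om e K ↔ x ∈ e.source ∧ e x ∈ K := Iff.rfl

lemma Om_mono {K L : Set (Eu n)} (h : K ⊆ L) : Om e K ⊆ Om e L := fun _ hx => ⟨hx.1, h hx.2⟩

lemma symm_mem_Om {K : Set (Eu n)} (hK : K ⊆ e.target) {y : (Eu n)} (hy : y ∈ K) : e.symm y ∈ Om e K :=
  ⟨e.map_target (hK hy), by simpa [e.right_inv (hK hy)] using hy⟩

lemma isClosed_Om {K : Set (Eu n)} (hK : IsCompact K) (h : K ⊆ e.target) : IsClosed (Om e K) := by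
  have : Om e K = e.symm '' K := by
    rw [e.symm.image_eq_target_inter_inv_preimage h]; rfl
  rw [this]
  exact (hK.image_of_continuousOn (e.continuousOn_symm.mono h)).isClosed

lemma isOpen_Om {K : Set (Eu n)} (hK : IsOpen K) : IsOpen (Om e K) := e.isOpen_inter_preimage hK

lemma contOn_Om (K : Set (Eu n)) : ContinuousOn e (Om e K) := e.continuousOn.mono inter_subset_left

/-- Chart coordinates. -/
def coords (e : OpenPartialHomeomorph X (Eu n)) : List (X → ℝ) :=
  (List.finRange n).map fun i x => e x i

lemma forall_coords {p : (X → ℝ) → Prop} :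
    (∀ c ∈ coords e, p c) ↔ ∀ i, p (fun x => e x i) := by
  simp [coords]

lemma length_coords : (coords e).length = n := by simp [coords]

lemma cont_coord {F : Set X} (hF : F ⊆ e.source) (i : Fin n) :
    ContinuousOn (fun x => e x i) F := by
  have h : Continuous fun y : (Eu n) => y i := by fun_prop
  exact h.comp_continuousOn (e.continuousOn.mono hF)

lemma V_convex {K : Set (Eu n)} (hK : IsCompact K) (hc : Convex ℝ K) (hne : K.Nonempty)
    (hKt : K ⊆ e.target) (m : ℕ) : V (N ∅) (N (Om e K)) m := by
  have := bisect (P := N ∅) (NF := fun F => N (∅ ∪ F)) (D := fun _ _ => True)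
    (fun F => N_anti (empty_subset _))
    (fun F G h => N_anti (union_subset_union_right _ h)) (by simp) (by simp) (coords e)
    (fun F => ∃ K : Set (Eu n), IsCompact K ∧ Convex ℝ K ∧ K ⊆ e.target ∧ F = Om e K)
    ?_ ?_ (Om e K) ⟨K, hK, hc, hKt, rfl⟩ m trivial
  · simpa only [empty_union] using this
  · rw [forall_coords]
    intro i
    have hlin : IsLinearMap ℝ fun y : (Eu n) => y i := ⟨fun _ _ => rfl, fun _ _ => rfl⟩
    have hcont : Continuous fun y : (Eu n) => y i := by fun_prop
    refine cutOK_N isClosed_empty ?_ ?_ ?_ ?_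
    · rintro F ⟨K, h1, h2, h3, rfl⟩ s t
      refine ⟨K ∩ (fun y : (Eu n) => y i) ⁻¹' Icc s t, h1.inter_right (isClosed_Icc.preimage hcont),
        h2.inter ((convex_Icc s t).is_linear_preimage hlin), inter_subset_left.trans h3, ?_⟩
      ext x; simp only [Om, mem_inter_iff, mem_preimage]; tauto
    · rintro F ⟨K, h1, h2, h3, rfl⟩; exact isClosed_Om h1 h3
    · rintro F ⟨K, h1, h2, h3, rfl⟩; exact cont_coord inter_subset_left i
    · rintro F ⟨K, h1, h2, h3, rfl⟩ s t u hst htu j k _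
      right
      simp only [empty_union]
      by_contra! hcon
      obtain ⟨h4, h5, h6⟩ := hcon
      obtain ⟨x, hx⟩ := h5
      obtain ⟨y, hy⟩ := h6
      obtain ⟨z, hz, hzt⟩ := h2.isPreconnected.intermediate_value hx.1.2 hy.1.2 hcont.continuousOn
        (⟨hx.2.2, hy.2.1⟩ : t ∈ Icc (e x i) (e y i))
      have : e.symm z ∈ Om e K ∩ (fun x => e x i) ⁻¹' Icc t t :=
        ⟨symm_mem_Om h3 hz, by simpa [e.right_inv (h3 hz)] using hzt⟩
      rw [h4] at this; exact this
  · rintro F ⟨K, h1, h2, h3, rfl⟩ hconst m _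
    show V (N ∅) (N _) m
    rw [empty_union]
    rcases (Om e K).eq_empty_or_nonempty with h | ⟨x, hx⟩
    · rw [h]; exact V_refl _ _
    · have : Om e K = {x} := by
        refine Subset.antisymm (fun y hy => ?_) (by simpa using hx)
        rw [forall_coords] at hconst
        refine e.injOn hy.1 hx.1 ?_
        ext i
        exact hconst i y hy x hx
      rw [this]; exact V_point x m

/-- Vanishing above the dimension inside a chart. -/
lemma NE1 {T F : Set X} (hT : IsClosed T) (hF : IsClosed F) (hFe : F ⊆ e.source) {m : ℕ}
    (hm : n + 2 ≤ m) : V (N T) (N (T ∪ F)) m := by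
  refine bisect_fib hT hF (coords e) (forall_coords.2 fun i => cont_coord hFe i)
    (fun j m => 2 + j ≤ m) (fun j m h => by omega) (fun j m h => by omega)
    (Or.inr fun j k h => by omega) ?_ m (by rw [length_coords]; omega)
  intro x hx m hm
  have : {y ∈ F | ∀ c ∈ coords e, c y = c x} = {x} := by
    ext y
    simp only [forall_coords, mem_ofPred_eq, mem_singleton_iff]
    constructor
    · rintro ⟨h1, h2⟩
      refine e.injOn (hFe h1) (hFe hx) ?_
      ext i; exact h2 i
    · rintro rfl; exact ⟨hx, fun _ => rfl⟩
  rw [this]; exact V_point_rel hT x (by omega)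

lemma relAcyc_chart {T : Set X} (hT : IsClosed T) {K : Set (Eu n)} (hK : IsCompact K)
    (hc : Convex ℝ K) (hKt : K ⊆ e.target) {y : X} (hy : T ∩ Om e K = {y}) (m : ℕ) :
    V (N T) (N (T ∪ Om e K)) m := by
  refine relAcyc hT (isClosed_Om hK hKt) (by rw [hy]; simp) (V_convex hK hc ?_ hKt)
    (by rw [hy]; exact V_point y) m
  have : y ∈ T ∩ Om e K := by rw [hy]; simp
  exact ⟨_, this.2.2⟩

/-- Pushing radially to the sphere. -/
lemma push {c : (Eu n)} {r R : ℝ} (hr : 0 < r) (hrR : r < R) (hQ : Metric.closedBall c R ⊆ e.target)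
    (hn : 0 < n) (m : ℕ) : V (N (Om e (Metric.sphere c R)))
      (N (Om e (Metric.sphere c R) ∪ Om e (Metric.closedBall c R \ Metric.ball c r))) m := by
  have hS : Metric.sphere c R ⊆ e.target := Metric.sphere_subset_closedBall.trans hQ
  have hSc : IsClosed (Om e (Metric.sphere c R)) := isClosed_Om (isCompact_sphere c R) hS
  have hR : 0 < R := hr.trans hrR
  haveI : Nonempty (Fin n) := ⟨⟨0, hn⟩⟩
  have hFc : IsClosed (Om e (Metric.closedBall c R \ Metric.ball c r)) :=
    isClosed_Om ((isCompact_closedBall c R).diff Metric.isOpen_ball) (sdiff_subset.trans hQ)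
  refine bisect_fib hSc hFc
    ((List.finRange n).map fun i x => (e x - c) i / ‖e x - c‖) ?_ (fun _ _ => True)
    (by simp) (by simp) (Or.inl ?_) ?_ m trivial
  · simp only [List.mem_map, List.mem_finRange, true_and, forall_exists_index,
      forall_apply_eq_imp_iff]
    intro i
    have h1 : ContinuousOn (fun y : (Eu n) => (y - c) i / ‖y - c‖)
        (Metric.closedBall c R \ Metric.ball c r) := by
      refine ContinuousOn.div (by fun_prop) (by fun_prop) ?_
      intro y hy h0
      apply hy.2
      rw [Metric.mem_ball, dist_eq_norm, h0]; exact hr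
    exact h1.comp (contOn_Om _) fun x hx => hx.2
  · obtain ⟨y, hy⟩ := (NormedSpace.sphere_nonempty (x := c) (r := R)).2 hR.le
    exact ⟨_, symm_mem_Om hS hy⟩
  · intro x hx m _
    have hx2 := hx.2
    have hxn : r ≤ ‖e x - c‖ := by
      have := hx2.2
      rwa [Metric.mem_ball, not_lt, dist_eq_norm] at this
    have hx0 : ‖e x - c‖ ≠ 0 := (hr.trans_le hxn).ne'
    set u : (Eu n) := (‖e x - c‖)⁻¹ • (e x - c) with hu
    have hu1 : ‖u‖ = 1 := by rw [hu, norm_smul, norm_inv, norm_norm, inv_mul_cancel₀ hx0]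
    have hex : e x - c = ‖e x - c‖ • u := by rw [hu, smul_inv_smul₀ hx0]
    let γ : ℝ →ᵃ[ℝ] (Eu n) := AffineMap.lineMap c (c + u)
    have hγ : ∀ t, γ t = c + t • u := fun t => by simp [γ, AffineMap.lineMap_apply, add_comm]
    have hγn : ∀ t, 0 ≤ t → ‖γ t - c‖ = t := fun t ht => by
      rw [hγ, add_sub_cancel_left, norm_smul, hu1, mul_one, Real.norm_of_nonneg ht]
    have hγt : γ '' Icc r R ⊆ e.target := by
      rintro _ ⟨t, ht, rfl⟩
      refine hQ ?_
      rw [Metric.mem_closedBall, dist_eq_norm, hγn t (hr.le.trans ht.1)]; exact ht.2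
    have heq : {y ∈ Om e (Metric.closedBall c R \ Metric.ball c r) |
        ∀ p ∈ (List.finRange n).map fun i x => (e x - c) i / ‖e x - c‖, p y = p x}
        = Om e (γ '' Icc r R) := by
      ext y
      simp only [List.mem_map, List.mem_finRange, true_and, forall_exists_index,
        forall_apply_eq_imp_iff, mem_ofPred_eq, mem_Om, mem_sdiff, Metric.mem_closedBall,
        Metric.mem_ball, not_lt, dist_eq_norm]
      constructor
      · rintro ⟨⟨h1, h2, h3⟩, h4⟩
        refine ⟨h1, ‖e y - c‖, ⟨h3, h2⟩, ?_⟩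
        have hy0 : ‖e y - c‖ ≠ 0 := (hr.trans_le h3).ne'
        have : e y - c = ‖e y - c‖ • u := by
          ext i
          have := h4 i
          rw [div_eq_iff hy0] at this
          rw [this, hu]; simp; ring
        rw [hγ, ← this]; simp
      · rintro ⟨h1, t, ht, h2⟩
        have ht0 : 0 < t := hr.trans_le ht.1
        have h3 : e y - c = t • u := by rw [← h2, hγ]; simp
        have h4 : ‖e y - c‖ = t := by rw [← h2]; exact hγn t ht0.le
        refine ⟨⟨h1, by rw [h4]; exact ht.2, by rw [h4]; exact ht.1⟩, fun i => ?_⟩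
        rw [h4, h3]
        simp only [PiLp.smul_apply, smul_eq_mul]
        rw [mul_div_cancel_left₀ _ ht0.ne', hu]
        simp only [PiLp.smul_apply, smul_eq_mul]
        rw [inv_mul_eq_div]
    rw [heq]
    refine relAcyc_chart hSc (isCompact_Icc.image ?_) ((convex_Icc r R).affine_image γ) hγt
      (y := e.symm (γ R)) ?_ m
    · exact γ.continuous_of_finiteDimensional
    · have hR' : γ R ∈ γ '' Icc r R := ⟨R, ⟨hrR.le, le_rfl⟩, rfl⟩
      ext y
      simp only [mem_inter_iff, mem_Om, mem_sphere_iff_norm, mem_singleton_iff]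
      constructor
      · rintro ⟨⟨h1, h2⟩, -, t, ht, h3⟩
        rw [← h3, hγn t (hr.le.trans ht.1)] at h2
        rw [← h2, h3, e.left_inv h1]
      · rintro rfl
        have := symm_mem_Om hγt hR'
        refine ⟨⟨this.1, ?_⟩, this⟩
        rw [e.right_inv (hγt hR'), hγn R hR.le]

/-- Vanishing in the top degree for proper closed subsets of a ball. -/
lemma NE2 {c : (Eu n)} {R : ℝ} (hQ : Metric.closedBall c R ⊆ e.target) (hR : 0 < R) (hn : 0 < n)
    {F : Set X} (hF : IsClosed F) (hcF : e.symm c ∉ F) {S : Set X}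
    (hS : S = Om e (Metric.sphere c R)) :
    V (N S) (N (S ∪ (F ∩ Om e (Metric.closedBall c R)))) (n+1) := by
  subst hS
  have hSc : IsClosed (Om e (Metric.sphere c R)) :=
    isClosed_Om (isCompact_sphere c R) (Metric.sphere_subset_closedBall.trans hQ)
  have hQc := isClosed_Om (isCompact_closedBall c R) hQ
  have hct : c ∈ e.target := hQ (Metric.mem_closedBall_self hR.le)
  have h1 : e.symm ⁻¹' Fᶜ ∈ 𝓝 c :=
    (e.symm.continuousAt hct).preimage_mem_nhds (hF.isOpen_compl.mem_nhds hcF)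
  obtain ⟨r0, hr0, hr⟩ := Metric.mem_nhds_iff.1 h1
  set r := min r0 (R/2) with hrdef
  have hrpos : 0 < r := lt_min hr0 (by positivity)
  have hrR : r < R := (min_le_right _ _).trans_lt (by linarith)
  have hsub : F ∩ Om e (Metric.closedBall c R) ⊆
      Om e (Metric.closedBall c R \ Metric.ball c r) := by
    rintro x ⟨hxF, hx⟩
    refine ⟨hx.1, hx.2, fun h => ?_⟩
    have := hr (Metric.ball_subset_ball (min_le_left _ _) h)
    rw [mem_preimage, e.left_inv hx.1] at this
    exact this hxF
  have hFc : IsClosed (Om e (Metric.closedBall c R \ Metric.ball c r)) :=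
    isClosed_Om ((isCompact_closedBall c R).diff Metric.isOpen_ball) (sdiff_subset.trans hQ)
  refine V_lift (N := N (Om e (Metric.sphere c R) ∪
      Om e (Metric.closedBall c R \ Metric.ball c r))) (N_anti (union_subset_union_right _ hsub))
      (N_anti subset_union_left) ?_ (push hrpos hrR hQ hn (n+1))
  have := NE1 (e := e) (hSc.union (hF.inter hQc)) hFc inter_subset_left (m := n + 1 + 1) le_rfl
  rwa [union_assoc, union_eq_self_of_subset_left hsub] at this

end chart
end MS


set_option linter.unusedSectionVars false
set_option linter.unusedVariables false

namespace MS
open Set Topology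

/-- Locally Euclidean spaces. -/
def LocE (n : ℕ) (X : Type*) [TopologicalSpace X] : Prop :=
  ∀ x : X, ∃ e : OpenPartialHomeomorph X (Eu n), x ∈ e.source

section equi
variable {X : Type*} [TopologicalSpace X] [T2Space X] [CompactSpace X]
variable {A : Type*} [Group A] [Finite A] [MulAction A X] [ContinuousConstSMul A X]
variable {n : ℕ}

lemma NA_le_N (S : Set X) : NA A S ≤ N S := fun _ _ h => h.1

lemma compare {S F0 : Set X} (hS : IsClosed S) (iS : Inv A S) (hF0 : IsClosed F0)
    {e : OpenPartialHomeomorph X (Eu n)} (hFe : F0 ⊆ e.source)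
    (hgood : ∀ a : A, ∀ y ∈ F0, a • y ∈ F0 → y ∉ S → a • y = y) (m : ℕ) :
    V (N S) (NA A S ⊔ N (S ∪ F0)) m := by
  have h00 : ∀ f : Co X ℤ 0, f ∈ N S 0 → f ∈ NA A S 0 := fun f hf => ⟨hf, inv_zero f⟩
  refine bisect (NF := fun F => NA A S ⊔ N (S ∪ F)) (D := fun _ _ => True)
    (fun F m => sup_le (NA_le_N S m) (N_anti subset_union_left m))
    (fun F G h m => sup_le_sup_left (N_anti (union_subset_union_right _ h) m) _)
    (by simp) (by simp) (coords e) (fun F => IsClosed F ∧ F ⊆ F0) ?_ ?_ F0 ⟨hF0, Subset.rfl⟩ m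
    trivial
  · rw [forall_coords]
    intro i
    have hc : ∀ F ⊆ F0, ContinuousOn (fun x => e x i) F := fun F hF => cont_coord (hF.trans hFe) i
    refine { fam := ?_, bdd := ?_, inf := ?_, sup := ?_, cont := ?_ }
    · rintro F ⟨h1, h2⟩ s t
      exact ⟨isClosed_slab h1 (hc F h2) s t, inter_subset_left.trans h2⟩
    · rintro F ⟨h1, h2⟩
      obtain ⟨b, hb⟩ := h1.isCompact.exists_bound_of_continuousOn (hc F h2)
      exact ⟨-b, b, fun x hx => abs_le.1 (hb x hx)⟩
    · rintro F ⟨h1, h2⟩ s t u hst htu m f ⟨hf1, hf2⟩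
      obtain ⟨α1, hα1, β1, hβ1, e1⟩ := mem_sup.1 hf1
      obtain ⟨α2, hα2, β2, hβ2, e2⟩ := mem_sup.1 hf2
      show f ∈ NA A S m ⊔ N _ m
      rcases m with _ | m
      · refine AddSubgroup.mem_sup_left (h00 f ?_)
        rw [← e1]; exact add_mem hα1.1 (N_anti subset_union_left _ hβ1)
      set F1 := F ∩ (fun x => e x i) ⁻¹' Icc s t with hF1
      set F2 := F ∩ (fun x => e x i) ⁻¹' Icc t u with hF2
      have c1 : IsClosed F1 := isClosed_slab h1 (hc F h2) s t
      have c2 : IsClosed F2 := isClosed_slab h1 (hc F h2) t u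
      have hα : α1 - α2 ∈ NA A ((S ∪ sat A F1) ∩ (S ∪ sat A F2)) (m+1) := by
        have h3 : α1 - α2 ∈ NA A S (m+1) := sub_mem hα1 hα2
        refine ⟨?_, h3.2⟩
        rw [← union_inter_distrib_left]
        refine mem_N_union.2 ⟨h3.1, ?_⟩
        rintro z ⟨⟨b, hb⟩, ⟨c, hcz⟩⟩
        by_cases hz : z ∈ S
        · exact h3.1 z hz
        have hbz : b • z ∉ S := fun h => hz ((iS.iff b z).1 h)
        have key : (c * b⁻¹) • (b • z) = b • z :=
          hgood _ _ (h2 hb.1) (by rw [mul_smul, inv_smul_smul]; exact h2 hcz.1) hbz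
        rw [mul_smul, inv_smul_smul] at key
        rw [key] at hcz
        have h4 : α1 - α2 = β2 - β1 := by
          rw [sub_eq_sub_iff_add_eq_add, e1, add_comm β2, e2]
        refine ((LZ_inv h3.2).iff b z).1 ?_
        show LZ _ _
        rw [h4, sub_eq_add_neg]
        exact (hβ2 _ (Or.inr hcz)).add (hβ1 _ (Or.inr hb)).neg
      obtain ⟨γ1, hγ1, γ2, hγ2, e3⟩ := AddSubgroup.mem_sup.1 (NA_inter_le
        (hS.union (isClosed_sat c1)) (hS.union (isClosed_sat c2)) (iS.union (Inv_sat F1))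
        (iS.union (Inv_sat F2)) (Nat.succ_ne_zero m) hα)
      refine AddSubgroup.mem_sup.2 ⟨α1 - γ1, sub_mem hα1 (NA_anti subset_union_left _ hγ1),
        f - (α1 - γ1), ?_, by abel⟩
      rw [slab_union F _ hst htu, ← hF1, ← hF2]
      have q1 : f - (α1 - γ1) ∈ N (S ∪ F1) (m+1) := by
        have : f - (α1 - γ1) = β1 + γ1 := by rw [← e1]; abel
        rw [this]
        exact add_mem hβ1 (N_anti (union_subset_union_right _ (subset_sat _)) _ hγ1.1)
      have q2 : f - (α1 - γ1) ∈ N (S ∪ F2) (m+1) := by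
        have : f - (α1 - γ1) = β2 - γ2 := by
          have h5 : α1 = γ1 + γ2 + α2 := by rw [e3]; abel
          rw [← e2, h5]; abel
        rw [this]
        exact sub_mem hβ2 (N_anti (union_subset_union_right _ (subset_sat _)) _ hγ2.1)
      rw [mem_N_union, mem_N_union]
      exact ⟨(mem_N_union.1 q1).1, (mem_N_union.1 q1).2, (mem_N_union.1 q2).2⟩
    · rintro F ⟨h1, h2⟩ s t u hst htu j k -
      show NA A S k ⊔ N _ k ≤ (NA A S k ⊔ N _ k) ⊔ (NA A S k ⊔ N _ k)
      refine sup_le (le_sup_left.trans le_sup_left) ?_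
      rcases k with _ | k
      · intro f hf
        exact AddSubgroup.mem_sup_left (AddSubgroup.mem_sup_left (h00 f (N_anti subset_union_left _ hf)))
      · have e : S ∪ (F ∩ (fun x => e x i) ⁻¹' Icc t t)
          = (S ∪ (F ∩ (fun x => e x i) ⁻¹' Icc s t)) ∩ (S ∪ (F ∩ (fun x => e x i) ⁻¹' Icc t u)) := by
          rw [← union_inter_distrib_left, slab_inter F _ hst htu]
        rw [e]
        refine (N_inter_le (hS.union (isClosed_slab h1 (hc F h2) _ _))
          (hS.union (isClosed_slab h1 (hc F h2) _ _)) (Or.inl (Nat.succ_ne_zero k))).trans ?_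
        exact sup_le_sup le_sup_right le_sup_right
    · rintro F ⟨h1, h2⟩ t m f hf
      obtain ⟨α, hα, β, hβ, rfl⟩ := mem_sup.1 hf
      obtain ⟨ε, hε, h'⟩ := slab h1 (isOpen_LZ β) (hc F h2) (t := t) (mem_N_union.1 hβ).2
      exact ⟨ε, hε, mem_sup.2 ⟨α, hα, β, mem_N_union.2 ⟨(mem_N_union.1 hβ).1, h'⟩, rfl⟩⟩
  · rintro F ⟨h1, h2⟩ hconst m -
    show V (N S) (NA A S ⊔ N (S ∪ F)) m
    have triv : F ⊆ S → V (N S) (NA A S ⊔ N (S ∪ F)) m := by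
      intro hFS f hf _
      refine AddSubgroup.mem_sup_right (AddSubgroup.mem_sup_right ?_)
      rwa [union_eq_self_of_subset_right hFS]
    rcases F.eq_empty_or_nonempty with rfl | ⟨x, hx⟩
    · exact triv (empty_subset _)
    have hFx : F = {x} := by
      refine Subset.antisymm (fun y hy => ?_) (by simpa using hx)
      rw [forall_coords] at hconst
      refine e.injOn (hFe (h2 hy)) (hFe (h2 hx)) ?_
      ext i; exact hconst i y hy x hx
    subst hFx
    by_cases hxS : x ∈ S
    · exact triv (by simpa using hxS)
    intro f hf hdf
    rcases m with _ | m
    · exact AddSubgroup.mem_sup_right (AddSubgroup.mem_sup_left (h00 f hf))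
    obtain ⟨α, hα, β, hβ, hαβ⟩ := mem_sup.1 hdf
    have hdα : d α ∈ NA A (S ∪ sat A {x}) (m+3) := by
      have h3 : d α ∈ NA A S (m+3) := (NA A S).dc hα
      refine mem_NA_union.2 ⟨h3, N_sat ?_ h3.2⟩
      have h4 : d α + d β = 0 := by rw [← d_add, hαβ, d_d]
      rw [eq_neg_of_add_eq_zero_left h4]
      exact neg_mem (N_anti subset_union_right _ ((N _).dc hβ))
    obtain ⟨a, ha, β', hβ', e2⟩ := AddSubgroup.mem_sup.1
      (V_orbit hS iS x (by omega : 2 ≤ m + 2) α hα hdα)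
    obtain ⟨α', hα', rfl⟩ := cob_succ.1 ha
    have hf1 : f - α' ∈ N S (m+1) := sub_mem hf hα'.1
    have hdf1 : d (f - α') ∈ N (S ∪ {x}) (m+2) := by
      have : d (f - α') = β' + β := by rw [d_sub, ← hαβ, ← e2]; abel
      rw [this]
      exact add_mem (N_anti (union_subset_union_right _ (subset_sat _)) _ hβ'.1) hβ
    have goal1 : f - α' ∈ cob (N S) (m+1) ⊔ (NA A S ⊔ N (S ∪ {x})) (m+1) := by
      rcases m with _ | m
      · -- locally constant function
        obtain ⟨W1, hW1o, hxW1, hWT⟩ := exists_closed_nhd hS hxS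
        have hcl : closure (sat A W1) ∩ S = ∅ := by
          rw [eq_empty_iff_forall_notMem]
          rintro y ⟨hy, hyS⟩
          obtain ⟨b, hb⟩ := (closure_minimal (sat_mono subset_closure)
            (isClosed_sat isClosed_closure)) hy
          exact (hWT ▸ (⟨hb, iS b y hyS⟩ : b • y ∈ closure W1 ∩ S) : b • y ∈ (∅ : Set X))
        let g : Co X ℤ 1 := cut (sat A W1) fun _ => (f - α') fun _ => x
        have hg : g ∈ NA A S 1 := ⟨fun y hy => LZ_cut_of_notMem fun h =>
          (hcl ▸ (⟨h, hy⟩ : y ∈ closure (sat A W1) ∩ S) : y ∈ (∅ : Set X)),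
          cut_mem_inv (Inv_sat W1) fun _ => rfl⟩
        refine AddSubgroup.mem_sup_right (mem_sup.2 ⟨g, hg, f - α' - g, ?_, by abel⟩)
        refine mem_N_union.2 ⟨sub_mem hf1 hg.1, ?_⟩
        rintro _ rfl
        obtain ⟨W, hW, hW'⟩ := hdf1 _ (Or.inr rfl)
        refine ⟨W ∩ sat A W1, Filter.inter_mem hW
          ((isOpen_sat hW1o).mem_nhds (subset_sat _ hxW1)), fun t ht => ?_⟩
        have e5 : g t = (f - α') fun _ => _ := cut_of_mem _ (ht 0).2
        have e6 := hW' (Fin.cons (t 0) fun _ => _) (fun i => by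
          refine Fin.cases ?_ (fun j => ?_) i
          · simpa using (ht 0).1
          · simpa using mem_of_mem_nhds hW)
        have e7 : (Fin.cons (t 0) Fin.elim0 : Fin 1 → X) = t := by
          funext j; obtain rfl : j = 0 := Subsingleton.elim (α := Fin 1) j 0; rfl
        simp only [d, Fin.tail_cons, sl_apply, Fin.cons_zero] at e6
        have e8 : ∀ u : Fin 0 → X, (Fin.cons (t 0) u : Fin 1 → X) = t := fun u => by
          rw [← e7]; congr 1; exact Subsingleton.elim _ _
        rw [e8] at e6
        rw [Pi.sub_apply, e5]; linarith
      · obtain ⟨a, ha, b, hb, e⟩ := AddSubgroup.mem_sup.1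
          (V_point_rel hS x (by omega : 2 ≤ m + 1 + 1) _ hf1 hdf1)
        exact AddSubgroup.mem_sup.2 ⟨a, ha, b, mem_sup.2 ⟨0, zero_mem _, b, hb, zero_add _⟩, e⟩
    have := add_mem goal1 (AddSubgroup.mem_sup_right (S := cob (N S) (m+1))
      (AddSubgroup.mem_sup_left (T := N (S ∪ {x}) (m+1)) hα'))
    rwa [sub_add_cancel] at this

lemma localInv {S F : Set X} (hS : IsClosed S) (iS : Inv A S) (hF : IsClosed F)
    {e : OpenPartialHomeomorph X (Eu n)} (hFe : F ⊆ e.source)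
    (hgood : ∀ a : A, ∀ y ∈ F, a • y ∈ F → y ∉ S → a • y = y) {m : ℕ}
    (h : V (N S) (N (S ∪ F)) m) : V (NA A S) (NA A (S ∪ sat A F)) m := by
  intro f hf hdf
  obtain ⟨a, ha, ν, hν, e1⟩ := AddSubgroup.mem_sup.1 (h f hf.1
    (N_anti (union_subset_union_right _ (subset_sat _)) _ hdf.1))
  have fin : ∀ b ∈ cob (NA A S) m, f - b ∈ N F m → f ∈ cob (NA A S) m ⊔ NA A (S ∪ sat A F) m := by
    intro b hb hfb
    have h1 : f - b ∈ NA A S m := sub_mem hf (cob_le _ _ hb)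
    exact AddSubgroup.mem_sup.2 ⟨b, hb, f - b, mem_NA_union.2 ⟨h1, N_sat hfb h1.2⟩, by abel⟩
  rcases m with _ | m
  · refine fin 0 (zero_mem _) ?_
    rw [cob_zero.1 ha, zero_add] at e1
    rw [sub_zero, ← e1]; exact N_anti subset_union_right _ hν
  obtain ⟨g, hg, rfl⟩ := cob_succ.1 ha
  have hdg : d g ∈ (NA A S ⊔ N (S ∪ F)) (m+1) := by
    rw [eq_sub_of_add_eq e1, sub_eq_add_neg]
    exact mem_sup.2 ⟨f, hf, -ν, neg_mem hν, rfl⟩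
  obtain ⟨b, hb, q, hq, rfl⟩ := AddSubgroup.mem_sup.1 (compare hS iS hF hFe hgood m g hg hdg)
  obtain ⟨α, hα, β, hβ, rfl⟩ := mem_sup.1 hq
  refine fin (d α) (cob_succ.2 ⟨α, hα, rfl⟩) ?_
  have : f - d α = d β + ν := by rw [← e1, d_add, d_cob hb, d_add]; abel
  rw [this]
  exact N_anti subset_union_right _ (add_mem ((N _).dc hβ) hν)

/-- Local to global. -/
lemma LG {S1 S2 : Set X} (h1 : IsClosed S1) (i1 : Inv A S1) (hsub : S2 ⊆ S1) {m : ℕ} (hm : m ≠ 0)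
    (𝒰 : Set (Set X)) (hU : ∀ U ∈ 𝒰, IsOpen U ∧ Inv A U ∧ Disjoint U S2 ∧
      V (NA A (S1 \ U)) (NA A S1) m ∧ ∀ T, IsClosed T → Inv A T → T ⊆ S1 → S1 \ T ⊆ U →
        V (NA A T) (NA A S1) (m+1))
    (hcov : ∀ x ∈ S1 \ S2, ∃ U ∈ 𝒰, x ∈ U) : V (NA A S2) (NA A S1) m := by
  have main : ∀ L : Finset 𝒰, ∀ f ∈ NA A (S1 \ ⋃ U ∈ L, (U : Set X)) m, d f ∈ NA A S1 (m+1) →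
      f ∈ cob (NA A S2) m ⊔ NA A S1 m := by
    classical
    intro L
    induction L using Finset.induction_on with
    | empty =>
      intro f hf _
      simp only [Finset.notMem_empty, iUnion_of_empty, iUnion_empty, sdiff_empty] at hf
      exact AddSubgroup.mem_sup_right hf
    | insert U L _ ih =>
      intro f hf hdf
      obtain ⟨oU, iU, dU, v1, v2⟩ := hU U.1 U.2
      set T1 := S1 \ ⋃ U ∈ L, (U : Set X) with hT1
      set T2 := S1 \ U.1 with hT2
      have oL : IsOpen (⋃ U ∈ L, (U : Set X)) := isOpen_biUnion fun U _ => (hU U.1 U.2).1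
      have iL : Inv A (⋃ U ∈ L, (U : Set X)) := by
        intro a x hx
        simp only [mem_iUnion, exists_prop] at hx ⊢
        obtain ⟨W, hW, hx⟩ := hx
        exact ⟨W, hW, (hU W.1 W.2).2.1 a x hx⟩
      have dL : ∀ x ∈ S2, x ∉ ⋃ U ∈ L, (U : Set X) := by
        intro x hx hx'
        simp only [mem_iUnion, exists_prop] at hx'
        obtain ⟨W, hW, hx'⟩ := hx'
        exact Set.disjoint_left.1 (hU W.1 W.2).2.2.1 hx' hx
      have cT1 : IsClosed T1 := h1.sdiff oL
      have cT2 : IsClosed T2 := h1.sdiff oU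
      have iT1 : Inv A T1 := i1.diff iL
      have iT2 : Inv A T2 := i1.diff iU
      have hT : S1 \ ⋃ W ∈ insert U L, (W : Set X) = T1 ∩ T2 := by
        rw [Finset.set_biUnion_insert, inter_comm, hT1, hT2, sdiff_inter_sdiff]
      rw [hT] at hf
      obtain ⟨f1, hf1, f2, hf2, rfl⟩ := AddSubgroup.mem_sup.1
        (NA_inter_le cT1 cT2 iT1 iT2 hm hf)
      have hd1 : d f1 ∈ NA A (T1 ∪ T2) (m+1) := by
        refine mem_NA_union.2 ⟨(NA A _).dc hf1, ?_⟩
        have : d f1 = d (f1 + f2) - d f2 := by rw [d_add]; abel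
        rw [this]
        exact sub_mem (NA_anti sdiff_subset _ hdf) ((NA A _).dc hf2)
      have := v2 (T1 ∪ T2) (cT1.union cT2) (iT1.union iT2)
        (union_subset sdiff_subset sdiff_subset) (fun x hx => by
          by_contra hxU; exact hx.2 (Or.inr ⟨hx.1, hxU⟩)) _ hd1
        (by rw [d_d]; exact zero_mem _)
      obtain ⟨a, ha, ν, hν, e⟩ := AddSubgroup.mem_sup.1 this
      obtain ⟨k, hk, rfl⟩ := cob_succ.1 ha
      have hk' := mem_NA_union.1 hk
      have g1 := ih (f1 - k) (sub_mem hf1 hk'.1) (by rw [d_sub, ← e]; simpa using hν)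
      have g2 := v1 (f2 + k) (add_mem hf2 hk'.2) (by
        have : d (f2 + k) = d (f1 + f2) - ν := by rw [d_add, d_add, ← e]; abel
        rw [this]; exact sub_mem hdf hν)
      have hle : NA A T2 ≤ NA A S2 := NA_anti fun x hx =>
        ⟨hsub hx, fun hxU => Set.disjoint_left.1 dU hxU hx⟩
      have := add_mem g1 (sup_le_sup_right (cob_mono hle m) _ g2)
      have e' : f1 - k + (f2 + k) = f1 + f2 := by abel
      rwa [e'] at this
  intro f hf hdf
  have hK : IsCompact (S1 ∩ {x | LZ f x}ᶜ) := (h1.inter (isOpen_LZ f).isClosed_compl).isCompact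
  obtain ⟨L, hL⟩ := hK.elim_finite_subcover (fun U : 𝒰 => (U : Set X)) (fun U => (hU U.1 U.2).1)
    (fun x hx => by
      obtain ⟨U, hU, hxU⟩ := hcov x ⟨hx.1, fun h => hx.2 (hf.1 x h)⟩
      exact mem_iUnion.2 ⟨⟨U, hU⟩, hxU⟩)
  refine main L f ⟨fun x hx => ?_, hf.2⟩ hdf
  by_contra hne
  exact hx.2 (hL ⟨hx.1, hne⟩)

variable (A) in
/-- Pure pairs. -/
def Pure (S1 S2 : Set X) : Prop := ∀ x ∈ S1 \ S2, ∀ y ∈ S1 \ S2,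
  Nat.card (MulAction.stabilizer A x) = Nat.card (MulAction.stabilizer A y)

lemma Pure.good {S1 S2 : Set X} (hp : Pure A S1 S2) (hS2 : IsClosed S2) {x : X}
    (hx : x ∈ S1 \ S2) {U : Set X} (hU : U ∈ 𝓝 x) :
    ∃ W, IsOpen W ∧ x ∈ W ∧ W ⊆ U ∧ Disjoint W S2 ∧
      ∀ a : A, ∀ y ∈ W ∩ S1, a • y ∈ W → a • y = y := by
  obtain ⟨W, oW, hxW, hWU, hW⟩ := exists_small A x
    (Filter.inter_mem hU (hS2.isOpen_compl.mem_nhds hx.2))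
  refine ⟨W, oW, hxW, hWU.trans inter_subset_left, Set.disjoint_left.2 fun y hy => (hWU hy).2, ?_⟩
  intro a y hy hay
  have hle : MulAction.stabilizer A y ≤ MulAction.stabilizer A x := by
    intro b hb
    by_contra hne
    refine hW b hne y hy.1 ?_
    rw [MulAction.mem_stabilizer_iff.1 hb]; exact hy.1
  have heq : MulAction.stabilizer A y = MulAction.stabilizer A x :=
    Subgroup.eq_of_le_of_card_ge hle (hp x hx y ⟨hy.2, (hWU hy.1).2⟩).le
  have hax : a ∈ MulAction.stabilizer A x := by
    by_contra hne
    exact hW a hne y hy.1 hay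
  rw [← heq] at hax; exact hax

/-- A closed neighbourhood inside an open one. -/
lemma exists_closed_subnhd {U : Set X} {x : X} (hU : IsOpen U) (hx : x ∈ U) :
    ∃ W, IsOpen W ∧ x ∈ W ∧ closure W ⊆ U := by
  obtain ⟨W, h1, h2, h3⟩ := exists_closed_nhd hU.isClosed_compl (x := x) (by simpa using hx)
  exact ⟨W, h1, h2, by
    rwa [← disjoint_iff_inter_eq_empty, disjoint_compl_right_iff_subset] at h3⟩

lemma pureLocal (hX : LocE n X) {S1 S2 : Set X} (hp : Pure A S1 S2) (h1 : IsClosed S1)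
    (h2 : IsClosed S2) (i1 : Inv A S1) (i2 : Inv A S2) {x : X} (hx : x ∈ S1 \ S2) :
    ∃ U, IsOpen U ∧ Inv A U ∧ x ∈ U ∧ Disjoint U S2 ∧ ∀ T, IsClosed T → Inv A T → T ⊆ S1 →
      S1 \ T ⊆ U → ∀ m, n + 2 ≤ m → V (NA A T) (NA A S1) m := by
  obtain ⟨e, hxe⟩ := hX x
  obtain ⟨W, oW, hxW, hWe, hWS, hW⟩ := hp.good h2 hx (e.open_source.mem_nhds hxe)
  obtain ⟨W', oW', hxW', hWW'⟩ := exists_closed_subnhd oW hxW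
  refine ⟨sat A W', isOpen_sat oW', Inv_sat _, subset_sat _ hxW', ?_, ?_⟩
  · refine Set.disjoint_left.2 fun y ⟨a, ha⟩ hy => ?_
    exact Set.disjoint_left.1 hWS (hWW' (subset_closure ha)) (i2 a y hy)
  · intro T cT iT hT hTU m hm
    have cF : IsClosed (S1 ∩ closure W') := h1.inter isClosed_closure
    have hFe : S1 ∩ closure W' ⊆ e.source := (inter_subset_right.trans hWW').trans hWe
    have := localInv (A := A) cT iT cF hFe
      (fun a y hy hay _ => hW a y ⟨hWW' hy.2, hy.1⟩ (hWW' hay.2)) (NE1 cT cF hFe hm)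
    have e1 : T ∪ sat A (S1 ∩ closure W') = S1 := by
      refine Subset.antisymm (union_subset hT (sat_subset i1 inter_subset_left)) fun y hy => ?_
      by_cases hyT : y ∈ T
      · exact Or.inl hyT
      · obtain ⟨a, ha⟩ := hTU ⟨hy, hyT⟩
        exact Or.inr ⟨a, i1 a y hy, subset_closure ha⟩
    rwa [e1] at this

/-- Vanishing above the dimension. -/
lemma pureD (hX : LocE n X) {S1 S2 : Set X} (hp : Pure A S1 S2) (h1 : IsClosed S1)
    (h2 : IsClosed S2) (i1 : Inv A S1) (i2 : Inv A S2) (hsub : S2 ⊆ S1) {m : ℕ} (hm : n + 2 ≤ m) :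
    V (NA A S2) (NA A S1) m := by
  refine LG h1 i1 hsub (by omega) {U | IsOpen U ∧ Inv A U ∧ Disjoint U S2 ∧ ∀ T, IsClosed T →
    Inv A T → T ⊆ S1 → S1 \ T ⊆ U → ∀ m, n + 2 ≤ m → V (NA A T) (NA A S1) m} ?_ ?_
  · rintro U ⟨u1, u2, u3, u4⟩
    refine ⟨u1, u2, u3, u4 _ (h1.sdiff u1) (i1.diff u2) sdiff_subset (fun y hy => ?_) m hm,
      fun T a b c e => u4 T a b c e _ (by omega)⟩
    by_contra h; exact hy.2 ⟨hy.1, h⟩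
  · intro x hx
    obtain ⟨U, u1, u2, u3, u4, u5⟩ := pureLocal hX hp h1 h2 i1 i2 hx
    exact ⟨U, ⟨u1, u2, u4, u5⟩, u3⟩

/-- Balls around points off a nowhere dense set. -/
lemma exists_ball {e : OpenPartialHomeomorph X (Eu n)} {x : X} {W B : Set X} (oW : IsOpen W)
    (hxW : x ∈ W) (hWe : W ⊆ e.source) (hB : x ∈ closure B) : ∃ (c : Eu n) (R : ℝ), 0 < R ∧
      Metric.closedBall c R ⊆ e.target ∧ Om e (Metric.closedBall c R) ⊆ W ∧
      x ∈ Om e (Metric.ball c R) ∧ e.symm c ∈ B := by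
  have hxe := hWe hxW
  have h1 : e.target ∩ e.symm ⁻¹' W ∈ 𝓝 (e x) := by
    refine (e.isOpen_inter_preimage_symm oW).mem_nhds ⟨e.map_source hxe, ?_⟩
    rw [mem_preimage, e.left_inv hxe]; exact hxW
  obtain ⟨ρ, hρ, hρW⟩ := Metric.mem_nhds_iff.1 h1
  have h2 : Om e (Metric.ball (e x) (ρ/3)) ∩ W ∈ 𝓝 x :=
    ((isOpen_Om Metric.isOpen_ball).inter oW).mem_nhds
      ⟨⟨hxe, Metric.mem_ball_self (by positivity)⟩, hxW⟩
  obtain ⟨z, hz, hzB⟩ := mem_closure_iff_nhds.1 hB _ h2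
  have hd : dist (e z) (e x) < ρ/3 := hz.1.2
  have hsub : Metric.closedBall (e z) (ρ/3) ⊆ e.target ∩ e.symm ⁻¹' W := by
    refine Subset.trans (fun y hy => ?_) hρW
    rw [Metric.mem_closedBall] at hy
    rw [Metric.mem_ball]
    linarith [dist_triangle y (e z) (e x)]
  refine ⟨e z, ρ/3, by positivity, hsub.trans inter_subset_left, fun y hy => ?_,
    ⟨hxe, by rwa [mem_preimage, Metric.mem_ball, dist_comm]⟩, by rwa [e.left_inv hz.1.1]⟩
  have := (hsub hy.2).2
  rwa [mem_preimage, e.left_inv hy.1] at this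

lemma NE2_inv {e : OpenPartialHomeomorph X (Eu n)} (hn : 0 < n) {c : Eu n} {R : ℝ} (hR : 0 < R)
    (hQ : Metric.closedBall c R ⊆ e.target) {S1 : Set X} (h1 : IsClosed S1) (i1 : Inv A S1)
    (hc : e.symm c ∉ S1)
    (hgood : ∀ a : A, ∀ y ∈ Om e (Metric.closedBall c R) ∩ S1,
      a • y ∈ Om e (Metric.closedBall c R) → a • y = y) :
    V (NA A (S1 \ sat A (Om e (Metric.ball c R)))) (NA A S1) (n+1) := by
  set Q := Om e (Metric.closedBall c R) with hQdef
  set B := Om e (Metric.ball c R) with hBdef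
  set S := Om e (Metric.sphere c R) with hSdef
  have cQ : IsClosed Q := isClosed_Om (isCompact_closedBall c R) hQ
  have oB : IsOpen B := isOpen_Om Metric.isOpen_ball
  have hBQ : B ⊆ Q := Om_mono Metric.ball_subset_closedBall
  have cS : IsClosed S := isClosed_Om (isCompact_sphere c R)
    (Metric.sphere_subset_closedBall.trans hQ)
  have cT : IsClosed (S1 \ sat A B) := h1.sdiff (isOpen_sat oB)
  have iT : Inv A (S1 \ sat A B) := i1.diff (Inv_sat B)
  have v := NE2 hQ hR hn h1 hc (S := S) rfl
  rw [← hQdef] at v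
  have heq : S ∩ (S1 ∩ Q) = (S1 \ sat A B) ∩ (S1 ∩ Q) := by
    ext y
    constructor
    · rintro ⟨hy, hy1, hyQ⟩
      refine ⟨⟨hy1, ?_⟩, hy1, hyQ⟩
      rintro ⟨a, ha⟩
      rw [hgood a y ⟨hyQ, hy1⟩ (hBQ ha)] at ha
      have h3 := ha.2; have h4 := hy.2
      rw [mem_preimage, Metric.mem_ball] at h3
      rw [mem_preimage, Metric.mem_sphere] at h4
      linarith
    · rintro ⟨⟨_, hyB⟩, hy1, hyQ⟩
      refine ⟨⟨hyQ.1, ?_⟩, hy1, hyQ⟩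
      have h3 := hyQ.2
      rw [mem_preimage, Metric.mem_closedBall] at h3
      rw [mem_preimage, Metric.mem_sphere]
      refine le_antisymm h3 (not_lt.1 fun h => hyB (subset_sat _ ⟨hyQ.1, h⟩))
  have v2 := V_exc cS cT (h1.inter cQ) heq (Or.inl (by omega)) v
  have := localInv (A := A) (e := e) cT iT (h1.inter cQ) (inter_subset_right.trans inter_subset_left)
    (fun a y hy hay _ => hgood a y ⟨hy.2, hy.1⟩ hay.2) v2
  have e1 : (S1 \ sat A B) ∪ sat A (S1 ∩ Q) = S1 := by
    refine Subset.antisymm (union_subset sdiff_subset (sat_subset i1 inter_subset_left)) ?_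
    intro y hy
    by_cases hyB : y ∈ sat A B
    · obtain ⟨a, ha⟩ := hyB
      exact Or.inr ⟨a, i1 a y hy, hBQ ha⟩
    · exact Or.inl ⟨hy, hyB⟩
  rwa [e1] at this

/-- Vanishing in the top degree for nowhere dense sets. -/
lemma pureD' (hX : LocE n X) (hn : 0 < n) {S1 S2 : Set X} (hp : Pure A S1 S2) (h1 : IsClosed S1)
    (h2 : IsClosed S2) (i1 : Inv A S1) (i2 : Inv A S2) (hsub : S2 ⊆ S1) (hitr : interior S1 = ∅) :
    V (NA A S2) (NA A S1) (n+1) := by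
  refine LG h1 i1 hsub (by omega) {U | IsOpen U ∧ Inv A U ∧ Disjoint U S2 ∧
      V (NA A (S1 \ U)) (NA A S1) (n+1) ∧ ∀ T, IsClosed T → Inv A T → T ⊆ S1 → S1 \ T ⊆ U →
        V (NA A T) (NA A S1) (n+1+1)} (fun U h => h) ?_
  intro x hx
  obtain ⟨U, u1, u2, u3, u4, u5⟩ := pureLocal hX hp h1 h2 i1 i2 hx
  obtain ⟨e, hxe⟩ := hX x
  obtain ⟨W, oW, hxW, hWe, hWS, hW⟩ := hp.good h2 hx
    ((e.open_source.inter u1).mem_nhds ⟨hxe, u3⟩)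
  obtain ⟨c, R, hR, hQ, hQW, hxB, hc⟩ := exists_ball (e := e) (B := S1ᶜ) oW hxW
    (hWe.trans inter_subset_left) (by
      rw [closure_compl, hitr]; simp)
  have hBU : sat A (Om e (Metric.ball c R)) ⊆ U := sat_subset u2
    (((Om_mono Metric.ball_subset_closedBall).trans hQW).trans (hWe.trans inter_subset_right))
  refine ⟨sat A (Om e (Metric.ball c R)), ⟨isOpen_sat (isOpen_Om Metric.isOpen_ball), Inv_sat _,
    u4.mono_left hBU, ?_, fun T a b c' f => u5 T a b c' (f.trans hBU) _ le_rfl⟩, subset_sat _ hxB⟩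
  exact NE2_inv hn hR hQ h1 i1 hc fun a y hy hay => hW a y ⟨hQW hy.1, hy.2⟩ (hQW hay)

variable (A) in
/-- Strata. -/
def Str (X : Type*) [MulAction A X] (k : ℕ) : Set X :=
  {x : X | k ≤ Nat.card (MulAction.stabilizer A x)}

lemma Inv_Str (k : ℕ) : Inv A (Str A X k) := by
  intro a x hx
  have : Nat.card (MulAction.stabilizer A (a • x)) = Nat.card (MulAction.stabilizer A x) :=
    (Nat.card_congr (MulAction.stabilizerEquivStabilizer (g := a) (a := x) (b := a • x)
      rfl).toEquiv).symm
  exact hx.trans this.ge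

lemma isClosed_Str (k : ℕ) : IsClosed (Str A X k) := by
  rw [← isOpen_compl_iff, isOpen_iff_mem_nhds]
  intro x hx
  obtain ⟨W, oW, hxW, -, hW⟩ := exists_small A x (U := univ) Filter.univ_mem
  refine Filter.mem_of_superset (oW.mem_nhds hxW) fun y hy hy' => hx ?_
  refine le_trans (show k ≤ _ from hy') (Nat.card_le_card_of_injective
    (Subgroup.inclusion (H := MulAction.stabilizer A y) (K := MulAction.stabilizer A x) ?_)
    (Subgroup.inclusion_injective _))
  intro b hb
  by_contra hne
  exact hW b hne y hy ((MulAction.mem_stabilizer_iff.1 hb).symm ▸ hy)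

lemma strata (hX : LocE n X) (hn : 0 < n) (hitr : interior (Str A X 2) = ∅) :
    V (NA A ∅) (NA A (Str A X 2)) (n+1) := by
  have key : ∀ j, V (NA A (Str A X (2+j))) (NA A (Str A X 2)) (n+1) := by
    intro j
    induction j with
    | zero => exact V_refl _ _
    | succ j ih =>
      have hs : Str A X (2+(j+1)) ⊆ Str A X (2+j) := fun x hx => by
        simp only [Str, mem_ofPred_eq] at hx ⊢; omega
      have hs2 : Str A X (2+j) ⊆ Str A X 2 := fun x hx => by
        simp only [Str, mem_ofPred_eq] at hx ⊢; omega
      refine V_trans (NA_anti hs2) (NA_anti hs) (pureD' hX hn ?_ (isClosed_Str _) (isClosed_Str _)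
        (Inv_Str _) (Inv_Str _) hs ?_) ih
      · intro x hx y hy
        simp only [Str, mem_sdiff, mem_ofPred_eq] at hx hy; omega
      · exact subset_eq_empty (interior_mono hs2) hitr
  have := key (Nat.card A)
  have he : Str A X (2 + Nat.card A) = ∅ := by
    rw [eq_empty_iff_forall_notMem]
    intro x hx
    have : Nat.card (MulAction.stabilizer A x) ≤ Nat.card A := Subgroup.card_le_card_group _
    simp only [Str, mem_ofPred_eq] at hx; omega
  rwa [he] at this

end equi
end MS

set_option linter.unusedSectionVars false
set_option linter.unusedVariables false
namespace MS
open Set Topology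

section ZB
variable {X : Type*}

/-- Relative cocycles. -/
def Z (P N : Sub X) (m : ℕ) : AddSubgroup (Co X ℤ m) where
  carrier := {f | f ∈ P m ∧ d f ∈ N (m+1)}
  zero_mem' := ⟨zero_mem _, by rw [d_zero]; exact zero_mem _⟩
  add_mem' := fun hf hg => ⟨add_mem hf.1 hg.1, by rw [d_add]; exact add_mem hf.2 hg.2⟩
  neg_mem' := fun hf => ⟨neg_mem hf.1, by rw [d_neg]; exact neg_mem hf.2⟩

lemma mem_Z {P N : Sub X} {m : ℕ} {f : Co X ℤ m} : f ∈ Z P N m ↔ f ∈ P m ∧ d f ∈ N (m+1) := Iff.rfl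

lemma Z_mono {P P' N : Sub X} (h : P ≤ P') (m : ℕ) : Z P N m ≤ Z P' N m :=
  fun _ hf => ⟨h _ hf.1, hf.2⟩

/-- Relative coboundaries. -/
def B (P N : Sub X) (m : ℕ) : AddSubgroup (Co X ℤ m) := cob P m ⊔ N m

lemma B_mono {P P' N : Sub X} (h : P ≤ P') (m : ℕ) : B P N m ≤ B P' N m :=
  sup_le_sup (cob_mono h m) le_rfl

lemma mem_B_succ {P N : Sub X} {m : ℕ} {f : Co X ℤ (m+1)} :
    f ∈ B P N (m+1) ↔ ∃ g ∈ P m, f - d g ∈ N (m+1) := by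
  constructor
  · intro h
    obtain ⟨a, ha, b, hb, rfl⟩ := AddSubgroup.mem_sup.1 h
    obtain ⟨g, hg, rfl⟩ := cob_succ.1 ha
    exact ⟨g, hg, by simpa using hb⟩
  · rintro ⟨g, hg, h⟩
    exact AddSubgroup.mem_sup.2 ⟨d g, cob_succ.2 ⟨g, hg, rfl⟩, _, h, by abel⟩

lemma B_le_Z {P N : Sub X} (h : N ≤ P) (m : ℕ) : B P N m ≤ Z P N m := by
  refine sup_le (fun f hf => ⟨cob_le _ _ hf, ?_⟩) (fun f hf => ⟨h _ hf, N.dc hf⟩)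
  rw [d_cob hf]; exact zero_mem _

end ZB

section dec
variable {X : Type*} [TopologicalSpace X] [T2Space X] [CompactSpace X]
variable {A : Type*} [Group A] [Finite A] [MulAction A X] [ContinuousConstSMul A X]
variable {n : ℕ}

lemma dec2 (hX : LocE n X) {U1 U2 : Set X} (o1 : IsOpen U1) (o2 : IsOpen U2) (i1 : Inv A U1)
    (i2 : Inv A U2) (hp : Pure A univ (U1 ∩ U2)ᶜ) {f : Co X ℤ (n+1)}
    (hf : f ∈ Z (NA A (U1 ∪ U2)ᶜ) (N univ) (n+1)) :
    ∃ f1 ∈ Z (NA A U1ᶜ) (N univ) (n+1), ∃ f2 ∈ Z (NA A U2ᶜ) (N univ) (n+1), f1 + f2 = f := by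
  have h0 := hf.1
  rw [compl_union] at h0
  obtain ⟨α, hα, β, hβ, e⟩ := AddSubgroup.mem_sup.1 (NA_inter_le o1.isClosed_compl o2.isClosed_compl
    i1.compl i2.compl (Nat.succ_ne_zero n) h0)
  have hdα : d α ∈ NA A (U1 ∩ U2)ᶜ (n+2) := by
    rw [compl_inter, mem_NA_union]
    refine ⟨(NA A _).dc hα, ⟨?_, ((NA A _).dc hα).2⟩⟩
    have : d α = d f - d β := by rw [← e, d_add]; abel
    rw [this]
    show _ ∈ N U2ᶜ (n+2)
    exact sub_mem (N_anti (subset_univ _) _ hf.2) ((N U2ᶜ).dc hβ.1)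
  have hcl : IsClosed (U1 ∩ U2)ᶜ := (o1.inter o2).isClosed_compl
  have key := pureD hX hp isClosed_univ hcl (fun _ _ _ => mem_univ _) (i1.inter i2).compl
    (subset_univ _) (le_refl (n+2)) _ hdα (by rw [d_d]; exact zero_mem _)
  obtain ⟨x, hx, μ, hμ, e2⟩ := AddSubgroup.mem_sup.1 key
  obtain ⟨h, hh, rfl⟩ := cob_succ.1 hx
  have hd1 : d (α - h) ∈ N univ (n+2) := by
    have : d (α - h) = μ := by rw [d_sub, ← e2]; abel
    rw [this]; exact hμ.1
  refine ⟨α - h, ⟨sub_mem hα (NA_anti ?_ _ hh), hd1⟩, β + h, ⟨add_mem hβ (NA_anti ?_ _ hh), ?_⟩, ?_⟩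
  · exact compl_subset_compl.2 inter_subset_left
  · exact compl_subset_compl.2 inter_subset_right
  · have : d (β + h) = d f - d (α - h) := by rw [← e, d_add, d_add, d_sub]; abel
    rw [this]; exact sub_mem hf.2 hd1
  · rw [← e]; abel

lemma dec (hX : LocE n X) {W : Set X} (hp : Pure A univ Wᶜ)
    (G : AddSubgroup (Co X ℤ (n+1))) (h0 : NA A univ (n+1) ≤ G)
    (hU : ∀ x ∈ W, ∃ U, IsOpen U ∧ Inv A U ∧ x ∈ U ∧ U ⊆ W ∧
      Z (NA A Uᶜ) (N univ) (n+1) ≤ G) : Z (NA A Wᶜ) (N univ) (n+1) ≤ G := by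
  intro f hf
  have hK : IsClosed {x | LZ f x}ᶜ := (isOpen_LZ f).isClosed_compl
  have : ∃ U, IsOpen U ∧ Inv A U ∧ {x | LZ f x}ᶜ ⊆ U ∧ U ⊆ W ∧
      Z (NA A Uᶜ) (N univ) (n+1) ≤ G := by
    refine hK.isCompact.induction_on (p := fun s => ∃ U, IsOpen U ∧ Inv A U ∧ s ⊆ U ∧ U ⊆ W ∧
      Z (NA A Uᶜ) (N univ) (n+1) ≤ G) ?_ ?_ ?_ ?_
    · refine ⟨∅, isOpen_empty, fun _ _ h => h.elim, subset_rfl, empty_subset _, ?_⟩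
      rw [compl_empty]; exact fun f hf => h0 hf.1
    · rintro s t hst ⟨U, h1, h2, h3, h4⟩
      exact ⟨U, h1, h2, hst.trans h3, h4⟩
    · rintro s t ⟨U, h1, h2, h3, h4, h5⟩ ⟨U', h1', h2', h3', h4', h5'⟩
      refine ⟨U ∪ U', h1.union h1', h2.union h2', union_subset_union h3 h3',
        union_subset h4 h4', ?_⟩
      intro g hg
      obtain ⟨f1, hf1, f2, hf2, rfl⟩ := dec2 hX h1 h1' h2 h2' (fun x hx y hy => hp x ⟨trivial,
        fun h => h (h4 (by simpa using hx.2 : x ∈ U ∧ x ∈ U').1)⟩ y ⟨trivial,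
        fun h => h (h4 (by simpa using hy.2 : y ∈ U ∧ y ∈ U').1)⟩) hg
      exact add_mem (h5 hf1) (h5' hf2)
    · intro x hx
      have hxW : x ∈ W := by
        by_contra h; exact hx (hf.1.1 x h)
      obtain ⟨U, h1, h2, h3, h4, h5⟩ := hU x hxW
      exact ⟨U, mem_nhdsWithin_of_mem_nhds (h1.mem_nhds h3), U, h1, h2, subset_rfl, h4, h5⟩
  obtain ⟨U, h1, h2, h3, h4, h5⟩ := this
  refine h5 ⟨⟨fun x hx => ?_, hf.1.2⟩, hf.2⟩
  by_contra h
  exact hx (h3 h)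

/-- An integral on cocycles of degree `n+1`, invariant under the group. -/
structure Integral (A : Type*) [Group A] [MulAction A X] (n : ℕ) (I : Co X ℤ (n+1) → ℤ) : Prop where
  add : ∀ f g, d f ∈ N univ (n+2) → d g ∈ N univ (n+2) → I (f + g) = I f + I g
  cob : ∀ g : Co X ℤ n, I (d g) = 0
  zero : ∀ f ∈ N univ (n+1), I f = 0
  one : ∀ O : Set X, IsOpen O → O.Nonempty → ∃ f ∈ Z (N Oᶜ) (N univ) (n+1), I f = 1
  inv : ∀ (a : A) f, d f ∈ N univ (n+2) → I (pull (a • · : X → X) f) = I f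

variable {I : Co X ℤ (n+1) → ℤ}

lemma Integral.congr (hI : Integral A n I) {f g : Co X ℤ (n+1)} (hg : d g ∈ N univ (n+2))
    (h : f - g ∈ N univ (n+1)) : I f = I g := by
  have := hI.add (f - g) g ((N _).dc h) hg
  rwa [sub_add_cancel, hI.zero _ h, zero_add] at this

lemma Integral.sum (hI : Integral A n I) {ι : Type*} (s : Finset ι) (F : ι → Co X ℤ (n+1))
    (hF : ∀ i ∈ s, d (F i) ∈ N univ (n+2)) : I (∑ i ∈ s, F i) = ∑ i ∈ s, I (F i) := by
  classical
  induction s using Finset.induction_on with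
  | empty => simpa using hI.zero 0 (zero_mem _)
  | insert i s his ih =>
    rw [Finset.sum_insert his, Finset.sum_insert his, hI.add _ _ (hF _ (Finset.mem_insert_self _ _)),
      ih fun j hj => hF j (Finset.mem_insert_of_mem hj)]
    rw [d_sum]
    exact sum_mem fun j hj => hF j (Finset.mem_insert_of_mem hj)

lemma Integral.neg (hI : Integral A n I) {f : Co X ℤ (n+1)} (hf : d f ∈ N univ (n+2)) :
    I (-f) = - I f := by
  have := hI.add f (-f) hf (by rw [d_neg]; exact neg_mem hf)
  rw [add_neg_cancel, hI.zero 0 (zero_mem _)] at this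
  linarith

lemma Integral.nsmul (hI : Integral A n I) {f : Co X ℤ (n+1)} (hf : d f ∈ N univ (n+2)) (k : ℕ) :
    I (k • f) = k * I f := by
  have := hI.sum (Finset.range k) (fun _ => f) fun _ _ => hf
  simpa using this

/-- Restriction to a subgroup. -/
lemma Integral.sub (hI : Integral A n I) (H : Subgroup A) : Integral H n I :=
  ⟨hI.add, hI.cob, hI.zero, hI.one, fun a f hf => hI.inv a f hf⟩

lemma freeLemma (hX : LocE n X) (hI : Integral A n I) {S : Set X} (hS : Str A X 2 ⊆ S)
    {f : Co X ℤ (n+1)}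
    (hf : f ∈ Z (NA A S) (N univ) (n+1)) : (Nat.card A : ℤ) ∣ I f := by
  classical
  haveI := Fintype.ofFinite A
  have hcard : ∀ x ∉ Str A X 2, Nat.card (MulAction.stabilizer A x) = 1 := by
    intro x hx
    have h1 : ¬ 2 ≤ Nat.card (MulAction.stabilizer A x) := hx
    have h2 : 0 < Nat.card (MulAction.stabilizer A x) := Nat.card_pos
    omega
  let G : AddSubgroup (Co X ℤ (n+1)) :=
    { carrier := {f | d f ∈ N univ (n+2) ∧ (Nat.card A : ℤ) ∣ I f}
      zero_mem' := ⟨by rw [d_zero]; exact zero_mem _, by rw [hI.zero 0 (zero_mem _)]; exact dvd_zero _⟩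
      add_mem' := fun {a b} ha hb => ⟨by rw [d_add]; exact add_mem ha.1 hb.1, by
        rw [hI.add _ _ ha.1 hb.1]; exact dvd_add ha.2 hb.2⟩
      neg_mem' := fun {a} ha => ⟨by rw [d_neg]; exact neg_mem ha.1, by
        rw [hI.neg ha.1]; exact (dvd_neg).2 ha.2⟩ }
  have hp : Pure A univ (Str A X 2)ᶜᶜ := by
    intro x hx y hy
    rw [hcard x (by simpa using hx.2), hcard y (by simpa using hy.2)]
  have key : Z (NA A (Str A X 2)ᶜᶜ) (N univ) (n+1) ≤ G := by
    refine dec hX hp G (fun g hg => ⟨(N _).dc hg.1, by rw [hI.zero g hg.1]; exact dvd_zero _⟩) ?_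
    intro x hx
    have hstab : ∀ a : A, a ≠ 1 → a • x ≠ x := by
      intro a ha hax
      have h1 := hcard x hx
      rw [Nat.card_eq_one_iff_unique] at h1
      haveI := h1.1
      have : (⟨a, hax⟩ : MulAction.stabilizer A x) = 1 := Subsingleton.elim _ _
      exact ha (congrArg Subtype.val this)
    obtain ⟨D, oD, hxD, hDU, hD⟩ := exists_small A x
      ((isClosed_Str (A := A) (X := X) 2).isOpen_compl.mem_nhds hx)
    refine ⟨sat A D, isOpen_sat oD, Inv_sat D, subset_sat _ hxD,
      sat_subset (Inv_Str 2).compl hDU, ?_⟩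
    intro g hg
    refine ⟨hg.2, ?_⟩
    have hgS : ∀ y ∉ sat A D, LZ g y := fun y hy => hg.1.1 y hy
    set μ := cut D g with hμ
    have hL : ∀ y, LZ (g - μ) y ∨ LZ μ y := by
      intro y
      by_cases hy : y ∈ D
      · exact Or.inl (LZ_sub_cut (oD.mem_nhds hy))
      right
      by_cases hy2 : y ∈ sat A D
      · obtain ⟨a, ha⟩ := hy2
        refine LZ_cut_of_notMem fun hcl => ?_
        have ho : IsOpen ((a • · : X → X) ⁻¹' D) := oD.preimage (continuous_const_smul a)
        obtain ⟨z, hz1, hz2⟩ := mem_closure_iff.1 hcl _ ho ha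
        have ha1 : a ≠ 1 := by rintro rfl; exact hy (by simpa using ha)
        exact hD a (hstab a ha1) z hz2 hz1
      · exact LZ_cut (hgS y hy2)
    have hdμ : d μ ∈ N univ (n+2) := by
      intro y _
      rcases hL y with h | h
      · have := (hg.2 y trivial).add h.d.neg
        rwa [d_sub, neg_sub, add_sub_cancel] at this
      · exact h.d
    have hda : ∀ a : A, d (pull (a • · : X → X) μ) ∈ N univ (n+2) := by
      intro a y _
      rw [d_pull]
      exact LZ_smul a (hdμ _ trivial)
    have hsum : (∑ a : A, pull (a • · : X → X) μ) = cut (sat A D) g := by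
      funext t
      rw [Finset.sum_apply]
      simp only [pull_apply]
      by_cases ht : t 0 ∈ sat A D
      · rw [cut_of_mem _ ht]
        obtain ⟨a, ha⟩ := ht
        rw [Finset.sum_eq_single a]
        · rw [hμ, cut_of_mem _ (by exact ha)]
          exact inv_apply hg.1.2 a t
        · intro b _ hba
          rw [hμ, cut_of_notMem]
          intro hb
          have hb' : b • t 0 ∈ D := hb
          refine hD (b * a⁻¹) (hstab _ fun h => hba (by simpa [mul_inv_eq_one] using h)) _ ha ?_
          rwa [mul_smul, inv_smul_smul]
        · simp
      · rw [cut_of_notMem _ ht]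
        refine Finset.sum_eq_zero fun a _ => ?_
        rw [hμ, cut_of_notMem]
        exact fun h => ht ⟨a, h⟩
    have e1 : I g = I (∑ a : A, pull (a • · : X → X) μ) := by
      symm
      refine hI.congr hg.2 ?_
      rw [hsum]
      intro y _
      by_cases hy : y ∈ sat A D
      · have := (LZ_sub_cut (f := g) ((isOpen_sat oD).mem_nhds hy)).neg
        rwa [neg_sub] at this
      · have h := hgS y hy
        rw [sub_eq_add_neg]
        exact (LZ_cut h).add h.neg
    rw [e1, hI.sum _ _ fun a _ => hda a]
    rw [Finset.sum_congr rfl fun a _ => hI.inv a μ hdμ, Finset.sum_const, Finset.card_univ,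
      Nat.card_eq_fintype_card, nsmul_eq_mul]
    exact dvd_mul_right _ _
  refine (key ⟨NA_anti ?_ _ hf.1, hf.2⟩).2
  rw [compl_compl]; exact hS

/-- Newman's theorem: no element of prime order fixes an open set. -/
lemma newman (hX : LocE n X) (hn : 0 < n) (hI : Integral A n I)
    (hA : ∀ a : A, a ≠ 1 → ∀ D : Set X, IsClopen D → D.Nonempty → ∃ x ∈ D, a • x ≠ x) 
    {p : ℕ} (hp : p.Prime) {g : A} (hg : orderOf g = p) :
    interior {x : X | g • x = x} = ∅ := by
  classical
  by_contra hne
  rw [← Ne, ← nonempty_iff_ne_empty] at hne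
  set F := {x : X | g • x = x} with hF
  have cF : IsClosed F := isClosed_eq (continuous_const_smul g) continuous_id
  have hg1 : g ≠ 1 := by rintro rfl; rw [orderOf_one] at hg; exact hp.one_lt.ne hg
  have hfr : (frontier (interior F)).Nonempty := by
    rw [nonempty_iff_ne_empty]
    intro h
    obtain ⟨x, hx, hx'⟩ := hA g hg1 _ (isClopen_iff_frontier_eq_empty.2 h) hne
    exact hx' (interior_subset hx : x ∈ F)
  obtain ⟨x, hx1, hx2⟩ := hfr
  rw [interior_interior] at hx2
  have hxc : x ∈ closure Fᶜ := by rwa [closure_compl]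
  obtain ⟨e, hxe⟩ := hX x
  obtain ⟨c, R, hR, hQ, -, hxb, hcF⟩ := exists_ball e.open_source hxe subset_rfl hxc
  set H := Subgroup.zpowers g with hH
  have hIH := hI.sub H
  haveI : ContinuousConstSMul H X := ⟨fun a => continuous_const_smul (a : A)⟩
  have hcard : Nat.card H = p := by rw [hH, Nat.card_zpowers, hg]
  have hHF : ∀ a : H, ∀ y ∈ F, a • y = y := by
    rintro ⟨a, k, rfl⟩ y hy
    have : g ∈ MulAction.stabilizer A y := hy
    exact (MulAction.stabilizer A y).zpow_mem this k
  have iF : Inv H F := fun a y hy => by rw [hHF a y hy]; exact hy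
  set O := Om e (Metric.ball c R) ∩ interior F with hO
  have oO : IsOpen O := (isOpen_Om Metric.isOpen_ball).inter isOpen_interior
  have hOne : O.Nonempty := by
    obtain ⟨z, hz⟩ := mem_closure_iff.1 hx1 _ (isOpen_Om (e := e) Metric.isOpen_ball) hxb
    exact ⟨z, hz⟩
  have hOF : O ⊆ F := inter_subset_right.trans interior_subset
  obtain ⟨f, hf, hf1⟩ := hI.one O oO hOne
  let f' : Co X ℤ (n+1) := fun t => if ∀ i, t i ∈ O then f t else 0
  have hff : f - f' ∈ N univ (n+1) := by
    intro y _
    by_cases hy : y ∈ O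
    · exact ⟨O, oO.mem_nhds hy, fun t ht => by simp [f', ht]⟩
    · obtain ⟨W, hW, h⟩ := hf.1 y hy
      exact ⟨W, hW, fun t ht => by simp [f', h t ht]⟩
  have hdf' : d f' ∈ N univ (n+2) := by
    have : d f' = d f - d (f - f') := by rw [d_sub]; abel
    rw [this]; exact sub_mem hf.2 ((N _).dc hff)
  have hf'O : f' ∈ N Oᶜ (n+1) := by
    have : f' = f - (f - f') := by abel
    rw [this]; exact sub_mem hf.1 (N_anti (subset_univ _) _ hff)
  have hf'i : f' ∈ inv H (n+1) := by
    intro a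
    funext t
    have e1 : ∀ i, a • t i ∈ O ↔ t i ∈ O := by
      intro i
      constructor
      · intro h
        have := hHF a⁻¹ _ (hOF h)
        rw [inv_smul_smul] at this
        rw [this]; exact h
      · intro h; rw [hHF a _ (hOF h)]; exact h
    simp only [f', pull_apply, Function.comp]
    by_cases ht : ∀ i, t i ∈ O
    · rw [if_pos ht, if_pos fun i => (e1 i).2 (ht i)]
      congr 1; funext i; exact hHF a _ (hOF (ht i))
    · rw [if_neg ht, if_neg fun h => ht fun i => (e1 i).1 (h i)]
  have hmem : f' ∈ NA H (F \ sat H (Om e (Metric.ball c R))) (n+1) := by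
    refine ⟨N_anti ?_ _ hf'O, hf'i⟩
    rintro y ⟨_, hy⟩ hyO
    exact hy (subset_sat _ hyO.1)
  have key := NE2_inv (A := H) hn hR hQ cF iF hcF (fun a y hy _ => hHF a y hy.2) f' hmem
    ⟨N_anti (subset_univ _) _ hdf', (inv H).dc hf'i⟩
  obtain ⟨α, hα, ν, hν, e1⟩ := AddSubgroup.mem_sup.1 key
  obtain ⟨β, hβ, rfl⟩ := cob_succ.1 hα
  have hdν : d ν ∈ N univ (n+2) := by
    have : d ν = d f' := by rw [← e1, d_add, d_d, zero_add]
    rw [this]; exact hdf'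
  have hS : Str H X 2 ⊆ F := by
    intro y hy
    by_contra hyF
    have hy2 : 2 ≤ Nat.card (MulAction.stabilizer H y) := hy
    haveI : Nontrivial (MulAction.stabilizer H y) := Finite.one_lt_card_iff_nontrivial.1 hy2
    obtain ⟨⟨a, ha⟩, hane⟩ := exists_ne (1 : MulAction.stabilizer H y)
    have ha1 : a ≠ 1 := fun h => hane (by ext1; exact h)
    have hgen : Subgroup.zpowers (a : A) = H := by
      have hle : Subgroup.zpowers (a : A) ≤ H := by
        rw [Subgroup.zpowers_le]; exact a.2
      refine Subgroup.eq_of_le_of_card_ge hle ?_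
      rw [hcard, Nat.card_zpowers]
      have h1 : orderOf (a : A) ∣ p := by
        have := Subgroup.card_dvd_of_le hle
        rwa [hcard, Nat.card_zpowers] at this
      rcases (Nat.dvd_prime hp).1 h1 with h2 | h2
      · exact absurd (orderOf_eq_one_iff.1 h2) (by simpa using ha1)
      · rw [h2]
    have hgm : g ∈ Subgroup.zpowers (a : A) := by
      rw [hgen]; exact Subgroup.mem_zpowers g
    have hle : Subgroup.zpowers (a : A) ≤ MulAction.stabilizer A y := by
      rw [Subgroup.zpowers_le]; exact ha
    exact hyF (hle hgm)
  have hdiv := freeLemma hX hIH hS (f := ν) ⟨hν, hdν⟩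
  have e2 : I ν = 1 := by
    have h1 : I f' = 1 := by
      rw [← hf1]
      refine hI.congr hf.2 ?_
      have := neg_mem hff
      rwa [neg_sub] at this
    have h2 := hI.add (d β) ν (by rw [d_d]; exact zero_mem _) hdν
    rw [e1, h1, hI.cob, zero_add] at h2
    exact h2.symm
  rw [hcard, e2] at hdiv
  have := Int.natAbs_dvd_natAbs.2 hdiv
  simp at this
  exact hp.one_lt.ne' this

end dec
end MS

set_option linter.unusedSectionVars false
set_option linter.unusedVariables false
namespace MS
open Set Topology

section grp
variable {T T' T'' M : Type*} [AddCommGroup M]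

lemma prism_zero (φ ψ : T → T') {m : ℕ} : prism φ ψ (0 : Co T' M (m+1)) = 0 := by
  have := prism_add φ ψ (0 : Co T' M (m+1)) 0
  simpa using this

lemma pull_prism (g : T'' → T) (φ ψ : T → T') : ∀ {m : ℕ} (f : Co T' M (m+1)),
    pull g (prism φ ψ f) = prism (φ ∘ g) (ψ ∘ g) f
  | 0, f => rfl
  | m+1, f => by
    refine co_ext fun x => ?_
    rw [sl_pull, sl_prism, sl_prism, pull_sub, pull_prism, pull_pull]
    rfl

lemma prism_comp (h : T' → T'') (φ ψ : T → T') : ∀ {m : ℕ} (f : Co T'' M (m+1)),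
    prism (h ∘ φ) (h ∘ ψ) f = prism φ ψ (pull h f)
  | 0, f => rfl
  | m+1, f => by
    refine co_ext fun x => ?_
    rw [sl_prism, sl_prism, sl_pull, sl_pull, prism_comp, pull_pull]
    rfl

variable {A : Type*} [CommGroup A]

lemma exists_pi {p : ℕ} (hp : p.Prime) (hA : ∀ a : A, a ^ p = 1) {c : A}
    (hc : c ≠ 1) : ∃ π : A →* A, π c = 1 ∧ ∀ x, x * (π x)⁻¹ ∈ Subgroup.zpowers c := by
  haveI : Fact p.Prime := ⟨hp⟩
  letI : Module (ZMod p) (Additive A) := AddCommGroup.zmodModule (n := p) fun x => hA x.toMul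
  have hcW : Additive.ofMul c ∉ (⊥ : Submodule (ZMod p) (Additive A)) := by
    rw [Submodule.mem_bot]; exact hc
  obtain ⟨f, hf, hW⟩ := Submodule.exists_le_ker_of_notMem hcW
  let g : Additive A →ₗ[ZMod p] Additive A :=
    LinearMap.id - ((f (Additive.ofMul c))⁻¹ • f).smulRight (Additive.ofMul c)
  refine ⟨AddMonoidHom.toMultiplicative g.toAddMonoidHom, ?_, ?_⟩
  · have : g (Additive.ofMul c) = 0 := by simp [g, hf]
    exact this
  · intro x
    have h1 : Additive.ofMul x - g (Additive.ofMul x)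
      = ((f (Additive.ofMul c))⁻¹ • f (Additive.ofMul x)) • Additive.ofMul c := by simp [g]
    obtain ⟨k, hk⟩ := ZMod.natCast_zmod_surjective ((f (Additive.ofMul c))⁻¹ • f (Additive.ofMul x))
    rw [← hk, Nat.cast_smul_eq_nsmul] at h1
    refine ⟨k, ?_⟩
    show c ^ (k:ℤ) = x * _
    rw [zpow_natCast, ← div_eq_mul_inv]
    exact h1.symm

/-- Stabiliser of a cochain. -/
def stabC {m : ℕ} (f : Co A M m) : Subgroup A where
  carrier := {b | pull (b * ·) f = f}
  one_mem' := by
    show pull _ f = f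
    funext t; simp [Function.comp_def]
  mul_mem' := fun {a b} ha hb => by
    show pull _ f = f
    have : pull (a * b * ·) f = pull (b * ·) (pull (a * ·) f) := by
      rw [pull_pull]; congr 1; funext x; simp [mul_assoc]
    rw [this, ha, hb]
  inv_mem' := fun {a} ha => by
    show pull _ f = f
    have ha' : pull (a * ·) f = f := ha
    conv_lhs => rw [← ha']
    rw [pull_pull]
    funext t; simp [Function.comp_def]

lemma mem_stabC {m : ℕ} {f : Co A M m} {b : A} : b ∈ stabC f ↔ pull (b * ·) f = f := Iff.rfl

lemma groupLemma [Finite A] {p : ℕ} (hp : p.Prime) (hA : ∀ a : A, a ^ p = 1) (B : Subgroup A) :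
    ∀ {i : ℕ} (f : Co A M (i+2)), d f = 0 → B ≤ stabC f →
      ∃ g : Co A M (i+1), B ≤ stabC g ∧ d g = p • f := by
  suffices H : ∀ k, ∀ B : Subgroup A, Nat.card B ≤ k → ∀ {i : ℕ} (f : Co A M (i+2)), d f = 0 →
      B ≤ stabC f → ∃ g : Co A M (i+1), B ≤ stabC g ∧ d g = p • f from
    fun {_} f => H _ B le_rfl f
  intro k
  induction k with
  | zero => intro B hB; exact absurd hB (by have : 0 < Nat.card B := Nat.card_pos; omega)
  | succ k ih =>
  intro B hB i f hdf hBf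
  by_cases hbot : B = ⊥
  · subst hbot
    refine ⟨p • sl f 1, bot_le, ?_⟩
    have := cone f 1
    rw [hdf] at this
    rw [d_nsmul]
    congr 1
    conv_rhs => rw [this]
    funext t; simp
  obtain ⟨⟨c, hcB⟩, hc⟩ := Subgroup.ne_bot_iff_exists_ne_one.1 hbot
  have hc1 : c ≠ 1 := fun h => hc (Subtype.ext h)
  obtain ⟨π, hπc, hπ⟩ := exists_pi hp hA hc1
  have hπz : ∀ z ∈ Subgroup.zpowers c, π z = 1 := by
    rintro _ ⟨k, rfl⟩; show π (c ^ k) = 1; rw [map_zpow, hπc, one_zpow]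
  have hππ : ∀ x, π (π x) = π x := by
    intro x
    have := hπz _ (hπ x)
    rw [map_mul, map_inv, mul_inv_eq_one] at this
    exact this.symm
  have hzB : Subgroup.zpowers c ≤ B := by rw [Subgroup.zpowers_le]; exact hcB
  set B' := B.map π with hB'
  have hB'B : B' ≤ B := by
    rintro _ ⟨b, hb, rfl⟩
    have : π b = (b * (π b)⁻¹)⁻¹ * b := by rw [mul_inv_rev, inv_inv]; simp
    rw [this]
    exact mul_mem (inv_mem (hzB (hπ b))) hb
  have hB'π : ∀ b ∈ B', π b = b := by rintro _ ⟨b, -, rfl⟩; exact hππ b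
  have hsup : ∀ K : Subgroup A, B' ≤ K → c ∈ K → B ≤ K := by
    intro K h1 h2 b hb
    have : b = (b * (π b)⁻¹) * π b := by simp
    rw [this]
    exact mul_mem ((Subgroup.zpowers_le.2 h2) (hπ b)) (h1 ⟨b, hb, rfl⟩)
  have hcard : Nat.card B' < Nat.card B := by
    by_contra h
    have := Subgroup.eq_of_le_of_card_ge hB'B (not_lt.1 h)
    have hc' := hB'π c (this ▸ hcB)
    exact hc1 (by rw [← hc', hπc])
  obtain ⟨g, hg1, hg2⟩ := ih B' (by omega) f hdf (hB'B.trans hBf)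
  set P := prism id π f with hP
  have hdP : d P = pull π f - f := by
    have := prism_homotopy id π f
    rw [hdf, prism_zero, add_zero] at this
    rw [hP, this]; rfl
  have hPB : ∀ b ∈ B', pull (b * ·) P = P := by
    intro b hb
    rw [hP, pull_prism]
    have e1 : (⇑π ∘ (b * ·)) = (b * ·) ∘ π := by
      funext x; simp [hB'π b hb]
    have e2 : (id ∘ (b * ·) : A → A) = (b * ·) ∘ id := rfl
    rw [e1, e2, prism_comp, mem_stabC.1 (hBf (hB'B hb))]
  let G : Co A M (i+1) := ∑ k ∈ Finset.range p, pull (c ^ k * ·) P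
  have hπk : ∀ k : ℕ, (⇑π ∘ (c ^ k * ·)) = π := by
    intro k; funext x; simp [hπc]
  have hdG : d G = p • pull π f - p • f := by
    simp only [G]
    rw [d_sum, ← smul_sub]
    rw [Finset.sum_congr rfl (g := fun _ => pull π f - f), Finset.sum_const, Finset.card_range]
    intro k _
    rw [d_pull, hdP, pull_sub, pull_pull, hπk, mem_stabC.1 (hBf (pow_mem hcB k))]
  have hGB : B ≤ stabC G := by
    refine hsup _ (fun b hb => ?_) ?_
    · rw [mem_stabC]
      simp only [G]
      rw [pull_sum]
      refine Finset.sum_congr rfl fun k _ => ?_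
      conv_rhs => rw [← hPB b hb]
      rw [pull_pull, pull_pull]
      congr 1; funext x; simp [mul_left_comm]
    · rw [mem_stabC]
      simp only [G]
      rw [pull_sum]
      have e1 : ∀ k, pull (c * ·) (pull (c ^ k * ·) P) = pull (c ^ (k+1) * ·) P := by
        intro k
        rw [pull_pull]; congr 1; funext x; simp [pow_succ, mul_assoc]
      simp only [e1]
      have e2 := Finset.sum_range_succ (fun k => pull (c ^ k * ·) P) p
      rw [Finset.sum_range_succ' (fun k => pull (c ^ k * ·) P) p] at e2
      have e3 : pull (c ^ p * ·) P = pull (c ^ 0 * ·) P := by rw [hA, pow_zero]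
      rw [e3] at e2
      exact add_right_cancel e2
  refine ⟨pull π g - G, ?_, ?_⟩
  · intro b hb
    rw [mem_stabC, pull_sub, mem_stabC.1 (hGB hb)]
    congr 1
    revert b
    refine hsup (stabC (pull π g)) (fun b hb => ?_) ?_
    · rw [mem_stabC]
      conv_rhs => rw [← mem_stabC.1 (hg1 hb)]
      rw [pull_pull, pull_pull]
      congr 1; funext x; simp [hB'π b hb]
    · rw [mem_stabC, pull_pull]
      congr 1; funext x; simp [hπc]
  · have hpn : pull π (p • f) = p • pull π f := rfl
    rw [d_sub, d_pull, hg2, hdG, hpn, sub_sub_cancel]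

end grp
end MS

set_option linter.unusedSectionVars false
set_option linter.unusedVariables false
namespace MS
open Set Topology

section chase
variable {A : Type*} [CommGroup A]

/-- Translation of tuples. -/
def tr {i : ℕ} (a : A) (t : Fin i → A) : Fin i → A := fun j => a * t j

lemma eqLift {Y : Type*} (act : A → Y → Y) (h1 : ∀ y, act 1 y = y)
    (hm : ∀ a b y, act (a * b) y = act a (act b y)) {i : ℕ} (R : (Fin (i+1) → A) → Y → Prop)
    (hR : ∀ a t y, R t y → R (tr a t) (act a y)) (hex : ∀ t, ∃ y, R t y) :
    ∃ ψ : (Fin (i+1) → A) → Y, (∀ t, R t (ψ t)) ∧ ∀ a t, ψ (tr a t) = act a (ψ t) := by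
  choose c hc using hex
  refine ⟨fun t => act (t 0) (c (tr (t 0)⁻¹ t)), fun t => ?_, fun a t => ?_⟩
  · have := hR (t 0) _ _ (hc (tr (t 0)⁻¹ t))
    have e : tr (t 0) (tr (t 0)⁻¹ t) = t := by funext j; simp [tr]
    rwa [e] at this
  · have e : tr (tr a t 0)⁻¹ (tr a t) = tr (t 0)⁻¹ t := by
      funext j; simp only [tr]; rw [mul_inv]
      rw [mul_mul_mul_comm, inv_mul_cancel, one_mul]
    simp only [e]
    show act (a * t 0) _ = _
    rw [hm]

variable {C : ℕ → Type*} [∀ m, AddCommGroup (C m)]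

/-- Abstract complex with action. -/
structure Cx (p : ℕ) (act : ∀ m, A → (C m →+ C m)) (D : ∀ m, C m →+ C (m+1)) : Prop where
  one : ∀ m y, act m 1 y = y
  mul : ∀ m a b y, act m (a * b) y = act m a (act m b y)
  comm : ∀ m a y, D m (act m a y) = act (m+1) a (D m y)
  inj : ∀ y, D 0 y = 0 → y = 0
  triv : ∀ m a y, D (m+1) y = 0 → ∃ z, act (m+1) a y - y = D m z
  DD : ∀ m y, D (m+1) (D m y) = 0
  kill : ∀ m i (φ : Co A (C m) (i+2)), (∀ a t, φ (tr a t) = act m a (φ t)) → d φ = 0 →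
    ∃ θ : Co A (C m) (i+1), (∀ a t, θ (tr a t) = act m a (θ t)) ∧ d θ = p • φ

lemma d_eqv {M : Type*} [AddCommGroup M] (act : A → (M →+ M)) {i : ℕ} {φ : Co A M i}
    (h : ∀ a t, φ (tr a t) = act a (φ t)) (a : A) (t) : d φ (tr a t) = act a (d φ t) := by
  have e1 : pull (a * ·) φ = fun t => act a (φ t) := by
    funext t; exact h a t
  have e2 := d_map (act a) φ
  rw [← e1, d_pull] at e2
  exact congrFun e2 t

variable {p : ℕ} {act : ∀ m, A → (C m →+ C m)} {D : ∀ m, C m →+ C (m+1)}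

/-- The step from `C m` down, given the claim for cocycles in degree `m`. -/
lemma chase_step (h : Cx p act D) {m N : ℕ}
    (ih : ∀ i (φ : Co A (C m) (i+2)), (∀ a t, φ (tr a t) = act m a (φ t)) → d φ = 0 →
      (∀ t, D m (φ t) = 0) → ∃ θ : Co A (C m) (i+1), (∀ a t, θ (tr a t) = act m a (θ t)) ∧
        (∀ t, D m (θ t) = 0) ∧ d θ = p ^ N • φ)
    {i : ℕ} (φ : Co A (C (m+1)) (i+2)) (hφ : ∀ a t, φ (tr a t) = act (m+1) a (φ t))
    (hd : d φ = 0) (hB : ∀ t, ∃ z, D m z = φ t) :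
    ∃ θ : Co A (C m) (i+1), (∀ a t, θ (tr a t) = act m a (θ t)) ∧
      d (fun t => D m (θ t)) = p ^ (N+1) • φ := by
  obtain ⟨ψ, h1, h2⟩ := eqLift (fun a => act m a) (h.one m) (h.mul m) (fun t z => D m z = φ t)
    (fun a t y hy => by rw [h.comm, hy, hφ]) hB
  have e1 : (fun t => D m (ψ t)) = φ := funext h1
  obtain ⟨η, hη1, hη2, hη3⟩ := ih (i+1) (d ψ) (d_eqv _ h2) (d_d _) (fun t => by
    have := congrFun (d_map (D m) ψ) t
    rw [e1, hd] at this
    exact this.symm)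
  obtain ⟨θ, hθ1, hθ2⟩ := h.kill m i (p ^ N • ψ - η) (fun a t => by
      simp only [Pi.sub_apply, Pi.smul_apply]
      rw [h2, hη1, map_sub, map_nsmul]) (by rw [d_sub, d_nsmul, hη3, sub_self])
  refine ⟨θ, hθ1, ?_⟩
  rw [d_map, hθ2]
  funext t
  simp only [Pi.sub_apply, Pi.smul_apply, map_nsmul, map_sub, hη2, sub_zero, h1]
  rw [pow_succ, mul_comm, mul_smul]

lemma claimZ [Finite A] (hp : p.Prime) (hA : ∀ a : A, a ^ p = 1) (h : Cx p act D) (m : ℕ) :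
    ∀ i (φ : Co A (C m) (i+2)), (∀ a t, φ (tr a t) = act m a (φ t)) → d φ = 0 →
      (∀ t, D m (φ t) = 0) → ∃ θ : Co A (C m) (i+1), (∀ a t, θ (tr a t) = act m a (θ t)) ∧
        (∀ t, D m (θ t) = 0) ∧ d θ = p ^ (2 * m) • φ := by
  induction m with
  | zero =>
    intro i φ _ _ h0
    refine ⟨0, fun a t => by simp, fun t => by simp, ?_⟩
    have : φ = 0 := funext fun t => h.inj _ (h0 t)
    rw [this]; simp
  | succ m ih =>
    intro i φ hφ hd h0
    let cl := QuotientAddGroup.mk' (D m).range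
    let M := (D (m+1)).ker.map cl
    let φ1 : Co A M (i+2) := fun t => ⟨cl (φ t), φ t, h0 t, rfl⟩
    have hdφ1 : d φ1 = 0 := by
      have e1 := d_map M.subtype φ1
      have e2 := d_map cl φ
      have e3 : (fun t => M.subtype (φ1 t)) = fun t => cl (φ t) := rfl
      rw [e3, e2, hd] at e1
      funext t
      have := congrFun e1 t
      apply Subtype.ext
      simp only [Pi.zero_apply, map_zero] at this
      exact this.symm
    have hact : ∀ a y, D (m+1) y = 0 → cl (act (m+1) a y) = cl y := by
      intro a y hy
      obtain ⟨z, hz⟩ := h.triv m a y hy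
      rw [← sub_eq_zero, ← map_sub, hz]
      exact (QuotientAddGroup.eq_zero_iff _).2 ⟨z, rfl⟩
    obtain ⟨g, hg1, hg2⟩ := groupLemma hp hA ⊤ φ1 hdφ1 (fun a _ => by
      rw [mem_stabC]; funext t
      apply Subtype.ext
      show cl (φ (tr a t)) = cl (φ t)
      rw [hφ, hact _ _ (h0 t)])
    obtain ⟨χ, hχ1, hχ2⟩ := eqLift (fun a => act (m+1) a) (h.one _) (h.mul _)
      (fun t z => D (m+1) z = 0 ∧ cl z = (g t).1) (fun a t y hy => by
        refine ⟨by rw [h.comm, hy.1, map_zero], ?_⟩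
        rw [hact _ _ hy.1, hy.2]
        have := congrFun (mem_stabC.1 (hg1 (Subgroup.mem_top a))) t
        exact congrArg Subtype.val this.symm) (fun t => by
        obtain ⟨z, hz, e⟩ := (g t).2
        exact ⟨z, hz, e⟩)
    have hclχ : (fun t => cl (d χ t)) = fun t => cl ((p • φ) t) := by
      rw [← d_map cl χ]
      have e1 : (fun t => cl (χ t)) = fun t => M.subtype (g t) := funext fun t => (hχ1 t).2
      rw [e1, d_map, hg2]
      funext t
      simp only [Pi.smul_apply, map_nsmul]
      rfl
    obtain ⟨θ, hθ1, hθ2⟩ := chase_step h ih (p • φ - d χ) (fun a t => by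
        simp only [Pi.sub_apply, Pi.smul_apply]
        rw [hφ, d_eqv (act (m+1)) hχ2, map_sub, map_nsmul]) (by rw [d_sub, d_nsmul, hd, d_d]; simp)
      (fun t => by
        have := congrFun hclχ t
        have h3 : cl ((p • φ - d χ) t) = 0 := by
          rw [Pi.sub_apply, map_sub, this, sub_self]
        obtain ⟨z, hz⟩ := (QuotientAddGroup.eq_zero_iff _).1 h3
        exact ⟨z, hz⟩)
    refine ⟨(fun t => D m (θ t)) + p ^ (2 * m + 1) • χ, fun a t => ?_, fun t => ?_, ?_⟩
    · simp only [Pi.add_apply, Pi.smul_apply]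
      rw [hθ1, hχ2, map_add, map_nsmul, h.comm]
    · simp only [Pi.add_apply, Pi.smul_apply]
      rw [map_add, map_nsmul, (hχ1 t).1, h.DD]; simp
    · rw [d_add, hθ2, d_nsmul, smul_sub, sub_add_cancel, smul_smul, ← pow_succ]
      rfl

lemma chase_final [Finite A] (hp : p.Prime) (hA : ∀ a : A, a ^ p = 1) (h : Cx p act D) {m : ℕ}
    (u : C (m+1)) (hu : D (m+1) u = 0) :
    ∃ y : C m, ∀ a, act (m+1) a (p ^ (2 * m + 1) • u - D m y) = p ^ (2 * m + 1) • u - D m y := by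
  let θu : Co A (C (m+1)) 1 := fun t => act (m+1) (t 0) u
  have hθu : ∀ a t, θu (tr a t) = act (m+1) a (θu t) := fun a t => h.mul _ _ _ _
  obtain ⟨θ, hθ1, hθ2⟩ := chase_step h (claimZ hp hA h m) (d θu) (d_eqv _ hθu) (d_d _) (fun t => by
    have hz := fun a => h.triv m a u hu
    choose z hz using hz
    refine ⟨z (t 1) - z (t 0), ?_⟩
    rw [map_sub, ← hz, ← hz]
    show _ = act (m+1) (Fin.tail t 0) u - act (m+1) _ u
    rw [sub_sub_sub_cancel_right]
    rfl)
  let ω : Co A (C (m+1)) 1 := p ^ (2 * m + 1) • θu - fun t => D m (θ t)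
  have hω : d ω = 0 := by
    simp only [ω]; rw [d_sub, d_nsmul, hθ2, sub_self]
  have hωe : ∀ a t, ω (tr a t) = act (m+1) a (ω t) := by
    intro a t
    simp only [ω, Pi.sub_apply, Pi.smul_apply]
    rw [hθu, hθ1, map_sub, map_nsmul, h.comm]
  have hconst : ∀ s t, ω s = ω t := by
    intro s t
    have h1 := cone ω 1
    rw [hω] at h1
    have h2 : ∀ s, ω s = sl ω 1 Fin.elim0 := by
      intro s
      have := congrFun h1 s
      rw [this]
      simp only [Pi.add_apply]
      show sl ω 1 (Fin.tail s) + 0 = _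
      rw [add_zero]
      congr 1; exact Subsingleton.elim _ _
    rw [h2 s, h2 t]
  refine ⟨θ fun _ => 1, fun a => ?_⟩
  have e1 : p ^ (2 * m + 1) • u - D m (θ fun _ => 1) = ω fun _ => 1 := by
    simp only [ω, Pi.sub_apply, Pi.smul_apply]
    simp only [θu]; rw [h.one]
  rw [e1, ← hωe, hconst]

end chase
end MS

set_option linter.unusedSectionVars false
set_option linter.unusedVariables false
namespace MS
open Set Topology

section conc
variable {X : Type*} [TopologicalSpace X]

/-- Cochains modulo locally vanishing ones. -/
abbrev Qc (X : Type*) [TopologicalSpace X] (m : ℕ) := Co X ℤ m ⧸ N (univ : Set X) m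

/-- Pull-back as a homomorphism. -/
def pullH {T T' : Type*} (φ : T → T') (m : ℕ) : Co T' ℤ m →+ Co T ℤ m where
  toFun := pull φ
  map_zero' := rfl
  map_add' := fun _ _ => rfl

def Qd (X : Type*) [TopologicalSpace X] (m : ℕ) : Qc X m →+ Qc X (m+1) :=
  QuotientAddGroup.map _ _ (dH X ℤ m) fun _ hf => (N univ).dc hf

lemma Qd_mk {m : ℕ} (f : Co X ℤ m) : Qd X m (QuotientAddGroup.mk f) = QuotientAddGroup.mk (d f) := rfl

lemma mk_eq_zero {m : ℕ} {f : Co X ℤ m} : (QuotientAddGroup.mk f : Qc X m) = 0 ↔ f ∈ N univ m :=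
  QuotientAddGroup.eq_zero_iff _

lemma mk_eq_mk {m : ℕ} {f g : Co X ℤ m} :
    (QuotientAddGroup.mk f : Qc X m) = QuotientAddGroup.mk g ↔ f - g ∈ N univ m := by
  rw [← mk_eq_zero, QuotientAddGroup.mk_sub, sub_eq_zero]

/-- A finite family of locally vanishing cochains vanishes on a common neighbourhood. -/
lemma LZ_common {ι : Type*} [Finite ι] {m : ℕ} (F : ι → Co X ℤ m) (x : X) (h : ∀ i, LZ (F i) x) :
    ∃ W ∈ 𝓝 x, ∀ t, (∀ j, t j ∈ W) → ∀ i, F i t = 0 := by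
  choose W hW hW' using h
  exact ⟨⋂ i, W i, Filter.iInter_mem.2 hW, fun t ht i => hW' i t fun j => mem_iInter.1 (ht j) i⟩

variable {A : Type*} [CommGroup A] [Finite A] [MulAction A X] [ContinuousConstSMul A X]

def Qact (m : ℕ) (a : A) : Qc X m →+ Qc X m :=
  QuotientAddGroup.map _ _ (pullH (a • · : X → X) m) fun f hf x _ => LZ_smul a (hf (a • x) trivial)

lemma Qact_mk {m : ℕ} (a : A) (f : Co X ℤ m) :
    Qact m a (QuotientAddGroup.mk f : Qc X m) = QuotientAddGroup.mk (pull (a • · : X → X) f) := rfl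

lemma pull_one {m : ℕ} (f : Co X ℤ m) : pull ((1 : A) • · : X → X) f = f := by
  funext t; simp [Function.comp_def]

lemma pull_mul {m : ℕ} (a b : A) (f : Co X ℤ m) : pull ((a * b) • · : X → X) f
    = pull (a • · : X → X) (pull (b • · : X → X) f) := by
  rw [pull_pull]; congr 1; funext x; simp [mul_comm a b, mul_smul]

open Classical in
lemma Qkill {p : ℕ} (hp : p.Prime) (hA : ∀ a : A, a ^ p = 1) (m i : ℕ)
    (φ : Co A (Qc X m) (i+2)) (hφ : ∀ a t, φ (tr a t) = Qact m a (φ t)) (hd : d φ = 0) :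
    ∃ θ : Co A (Qc X m) (i+1), (∀ a t, θ (tr a t) = Qact m a (θ t)) ∧ d θ = p • φ := by
  obtain ⟨F, hF1, hF2⟩ := eqLift (Y := Co X ℤ m) (fun a f => pull (a • · : X → X) f) pull_one pull_mul
    (fun t f => (QuotientAddGroup.mk f : Qc X m) = φ t)
    (fun a t f hf => by rw [hφ, ← hf]; rfl) (fun t => QuotientAddGroup.mk_surjective (φ t))
  let mkH := QuotientAddGroup.mk' (N (univ : Set X) m)
  have e1 : (fun t => mkH (F t)) = φ := funext hF1
  have hdF : ∀ t, d F t ∈ N univ m := by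
    intro t
    have := congrFun (d_map mkH F) t
    rw [e1, hd] at this
    exact mk_eq_zero.1 this.symm
  have hdF2 : ∀ (a : A) t, d F (tr a t) = pull (a • · : X → X) (d F t) :=
    d_eqv (fun a => pullH (a • · : X → X) m) hF2
  -- the invariant set of good tuples
  let T : Set (Fin m → X) := {s | ∀ t, d F t s = 0}
  have hT : ∀ (a : A) s, a • s ∈ T ↔ s ∈ T := by
    have h1 : ∀ (a : A) s, s ∈ T → a • s ∈ T := by
      intro a s hs t
      have := congrFun (hdF2 a t) s
      rw [hs] at this
      exact this.symm
    intro a s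
    refine ⟨fun h => ?_, h1 a s⟩
    have := h1 a⁻¹ _ h
    rwa [inv_smul_smul] at this
  let F' : Co A (Co X ℤ m) (i+2) := fun t s => if s ∈ T then F t s else 0
  have hF'1 : ∀ t, mkH (F' t) = φ t := by
    intro t
    rw [← hF1 t]
    refine mk_eq_mk.2 fun x _ => ?_
    obtain ⟨W, hW, h⟩ := LZ_common (fun t => d F t) x fun t => hdF t x trivial
    refine ⟨W, hW, fun s hs => ?_⟩
    have : s ∈ T := fun t => h s hs t
    simp [F', this]
  have hF'2 : ∀ (a : A) t s, F' (tr a t) s = F' t (a • s) := by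
    intro a t s
    simp only [F', hT]
    split_ifs
    · exact congrFun (hF2 a t) s
    · rfl
  -- evaluation at a tuple
  let ev : (Fin m → X) → (Co X ℤ m →+ ℤ) := fun s => Pi.evalAddMonoidHom (fun _ => ℤ) s
  let Fs : (Fin m → X) → Co A ℤ (i+2) := fun s t => F' t s
  have hFs : ∀ s, d (Fs s) = 0 := by
    intro s
    by_cases hs : s ∈ T
    · have h1 : Fs s = fun t => ev s (F t) := by
        funext t; simp [Fs, F', hs, ev]
      rw [h1, d_map]
      funext t; exact hs t
    · have h1 : Fs s = 0 := by funext t; simp [Fs, F', hs]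
      rw [h1, d_zero]
  have hFa : ∀ (a : A) s, pull (a * ·) (Fs s) = Fs (a • s) := by
    intro a s; funext t; exact hF'2 a t s
  have key : ∀ s : Fin m → X, ∃ g : Co A ℤ (i+1), MulAction.stabilizer A s ≤ stabC g ∧
      d g = p • Fs s := by
    intro s
    refine groupLemma hp hA _ (Fs s) (hFs s) fun a ha => ?_
    rw [mem_stabC, hFa, ha]
  choose g hg1 hg2 using key
  let rep : (Fin m → X) → (Fin m → X) := fun s =>
    (Quotient.out (Quotient.mk (MulAction.orbitRel A (Fin m → X)) s))
  have hrep : ∀ s, ∃ a : A, a • rep s = s := by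
    intro s
    have : (MulAction.orbitRel A (Fin m → X)).r (rep s) s := Quotient.mk_out (s := MulAction.orbitRel A (Fin m → X)) s
    obtain ⟨a, ha⟩ := (MulAction.orbitRel_apply.1 this)
    exact ⟨a⁻¹, by rw [← ha]; simp⟩
  have hrep2 : ∀ (b : A) s, rep (b • s) = rep s := by
    intro b s
    simp only [rep]
    congr 1
    exact Quotient.sound (s := MulAction.orbitRel A (Fin m → X)) ⟨b, rfl⟩
  choose α hα using hrep
  let G : (Fin m → X) → Co A ℤ (i+1) := fun s => pull (α s * ·) (g (rep s))
  have hG1 : ∀ (b : A) s, G (b • s) = pull (b * ·) (G s) := by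
    intro b s
    have h1 : (b * α s)⁻¹ * α (b • s) ∈ MulAction.stabilizer A (rep s) := by
      rw [MulAction.mem_stabilizer_iff, mul_smul]
      have := hα (b • s)
      rw [hrep2] at this
      rw [this, mul_inv_rev, mul_smul, inv_smul_smul]
      rw [inv_smul_eq_iff, hα s]
    have h2 := mem_stabC.1 (hg1 _ h1)
    simp only [G]
    rw [hrep2, pull_pull]
    conv_rhs => rw [← h2]
    rw [pull_pull]
    congr 1; funext x
    simp only [Function.comp]
    rw [eq_comm, mul_assoc, inv_mul_eq_iff_eq_mul]
    simp only [mul_comm, mul_left_comm, mul_assoc]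
  have hG2 : ∀ s, d (G s) = p • Fs s := by
    intro s
    simp only [G]
    rw [d_pull, hg2]
    have : pull (α s * ·) (p • Fs (rep s)) = p • pull (α s * ·) (Fs (rep s)) := rfl
    rw [this, hFa, hα]
  let Θ : Co A (Co X ℤ m) (i+1) := fun t s => G s t
  refine ⟨fun t => mkH (Θ t), fun a t => ?_, ?_⟩
  · show mkH _ = mkH _
    congr 1
    funext s
    exact (congrFun (hG1 a s) t).symm
  · rw [d_map]
    funext t
    have h3 : d Θ t = p • F' t := by
      funext s
      have h4 := congrFun (d_map (ev s) Θ) t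
      have h5 := congrFun (hG2 s) t
      rw [← show ev s (d Θ t) = d Θ t s from rfl, ← h4]
      exact h5
    simp only [Pi.smul_apply]
    rw [h3, map_nsmul, hF'1]

open Classical in
/-- Cochains invariant modulo `N univ` have invariant representatives. -/
lemma inv_rep {m : ℕ} {f : Co X ℤ m} (h : ∀ a : A, pull (a • · : X → X) f - f ∈ N univ m) :
    ∃ w ∈ inv A m, f - w ∈ N univ m := by
  let T : Set (Fin m → X) := {s | ∀ a : A, f (a • s) = f s}
  have hT1 : ∀ (a : A) s, s ∈ T → a • s ∈ T := by
    intro a s hs b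
    rw [← mul_smul, hs, hs]
  have hT : ∀ (a : A) s, a • s ∈ T ↔ s ∈ T := by
    intro a s
    refine ⟨fun h => ?_, hT1 a s⟩
    have := hT1 a⁻¹ _ h
    rwa [inv_smul_smul] at this
  refine ⟨fun s => if s ∈ T then f s else 0, fun a => ?_, fun x _ => ?_⟩
  · funext s
    show (if a • s ∈ T then f (a • s) else 0) = _
    by_cases h1 : s ∈ T
    · rw [if_pos ((hT a s).2 h1), if_pos h1]; exact h1 a
    · rw [if_neg (fun h => h1 ((hT a s).1 h)), if_neg h1]
  · obtain ⟨W, hW, h'⟩ := LZ_common (fun a : A => pull (a • · : X → X) f - f) x fun a => h a x trivial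
    refine ⟨W, hW, fun s hs => ?_⟩
    have : s ∈ T := fun a => by
      have := h' s hs a
      exact sub_eq_zero.1 this
    simp [this]

lemma lowerBound [Nonempty X] {p : ℕ} (hp : p.Prime) (hA : ∀ a : A, a ^ p = 1)
    (hT : ∀ (m : ℕ) (a : A), ∀ f ∈ Z (N (∅ : Set X)) (N univ) (m+1),
      pull (a • · : X → X) f - f ∈ B (N ∅) (N univ) (m+1)) {m : ℕ} {u : Co X ℤ (m+1)}
    (hu : d u ∈ N univ (m+2)) :
    ∃ g : Co X ℤ m, ∃ w ∈ inv A (m+1), p ^ (2 * m + 1) • u - d g - w ∈ N univ (m+1) := by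
  have hcx : Cx (A := A) p (Qact (X := X)) (Qd X) :=
    { one := fun m y => by
        obtain ⟨f, rfl⟩ := QuotientAddGroup.mk_surjective y
        rw [Qact_mk, pull_one]
      mul := fun m a b y => by
        obtain ⟨f, rfl⟩ := QuotientAddGroup.mk_surjective y
        rw [Qact_mk, Qact_mk, Qact_mk, pull_mul]
      comm := fun m a y => by
        obtain ⟨f, rfl⟩ := QuotientAddGroup.mk_surjective y
        rw [Qact_mk, Qd_mk, Qd_mk, Qact_mk, d_pull]
      inj := fun y hy => by
        obtain ⟨f, rfl⟩ := QuotientAddGroup.mk_surjective y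
        rw [Qd_mk, mk_eq_zero] at hy
        rw [mk_eq_zero]
        intro x _
        obtain ⟨W, hW, h⟩ := hy x trivial
        refine ⟨W, hW, fun t _ => ?_⟩
        have := h (fun _ => x) fun _ => mem_of_mem_nhds hW
        rw [← this]
        show f t = f _
        congr 1; exact Subsingleton.elim _ _
      triv := fun m a y hy => by
        obtain ⟨f, rfl⟩ := QuotientAddGroup.mk_surjective y
        rw [Qd_mk, mk_eq_zero] at hy
        obtain ⟨g, -, hg⟩ := mem_B_succ.1 (hT m a f ⟨mem_N_empty f, hy⟩)
        refine ⟨QuotientAddGroup.mk g, ?_⟩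
        rw [Qd_mk, Qact_mk, ← QuotientAddGroup.mk_sub, mk_eq_mk]
        exact hg
      DD := fun m y => by
        obtain ⟨f, rfl⟩ := QuotientAddGroup.mk_surjective y
        rw [Qd_mk, Qd_mk, d_d]; rfl
      kill := fun m i φ hφ hd => Qkill hp hA m i φ hφ hd }
  obtain ⟨y, hy⟩ := chase_final hp hA hcx (m := m) (QuotientAddGroup.mk u)
    (by rw [Qd_mk, mk_eq_zero]; exact hu)
  obtain ⟨g, rfl⟩ := QuotientAddGroup.mk_surjective y
  have e : p ^ (2 * m + 1) • (QuotientAddGroup.mk u : Qc X (m+1)) - Qd X m (QuotientAddGroup.mk g)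
    = QuotientAddGroup.mk (p ^ (2 * m + 1) • u - d g) := rfl
  rw [e] at hy
  obtain ⟨w, hw, hw'⟩ := inv_rep (A := A) (f := p ^ (2 * m + 1) • u - d g) fun a => by
    have := hy a
    rw [Qact_mk, mk_eq_mk] at this
    exact this
  exact ⟨g, w, hw, hw'⟩

end conc
end MS

set_option linter.unusedSectionVars false
set_option linter.unusedVariables false
namespace MS
open Set Topology

section fgabs
variable {G G' : Type*} [AddCommGroup G] [AddCommGroup G']

def Fg (Z B : AddSubgroup G) : Prop := ∃ F : AddSubgroup G, F.FG ∧ Z ≤ F ⊔ B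

lemma fg_of_le {F Q : AddSubgroup G} (h : F.FG) (hQ : Q ≤ F) : Q.FG := by
  have h1 : (AddSubgroup.toIntSubmodule F).FG := by
    rw [Submodule.fg_iff_addSubgroup_fg]; exact h
  have h2 : (AddSubgroup.toIntSubmodule Q).FG :=
    Submodule.FG.of_le h1 (AddSubgroup.toIntSubmodule.le_iff_le.2 hQ)
  rw [Submodule.fg_iff_addSubgroup_fg] at h2
  exact h2

lemma fg_map {F : AddSubgroup G} (h : F.FG) (φ : G →+ G') : (F.map φ).FG := by
  classical
  obtain ⟨s, rfl⟩ := h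
  exact ⟨s.image φ, by rw [AddMonoidHom.map_closure]; simp⟩

lemma fg_sup {F F' : AddSubgroup G} (h : F.FG) (h' : F'.FG) : (F ⊔ F').FG := by
  classical
  obtain ⟨s, rfl⟩ := h
  obtain ⟨t, rfl⟩ := h'
  exact ⟨s ∪ t, by rw [Finset.coe_union, AddSubgroup.closure_union]⟩

lemma fg_bot' : (⊥ : AddSubgroup G).FG := ⟨∅, by simp⟩

/-- Lift of generators. -/
lemma fg_lift {Z : AddSubgroup G} {φ : G →+ G'} (h : (Z.map φ).FG) :
    ∃ F ≤ Z, F.FG ∧ ∀ z ∈ Z, ∃ f ∈ F, φ (z - f) = 0 := by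
  classical
  obtain ⟨s, hs⟩ := h
  have h1 : ∀ y ∈ s, ∃ z ∈ Z, φ z = y := fun y hy => by
    have : y ∈ Z.map φ := by rw [← hs]; exact AddSubgroup.subset_closure hy
    exact this
  choose! g hg1 hg2 using h1
  refine ⟨AddSubgroup.closure (s.image g : Finset G), ?_, ⟨_, rfl⟩, fun z hz => ?_⟩
  · rw [AddSubgroup.closure_le]
    intro y hy
    obtain ⟨x, hx, rfl⟩ := Finset.mem_image.1 (Finset.mem_coe.1 hy)
    exact hg1 x hx
  · have h2 : φ z ∈ AddSubgroup.map φ (AddSubgroup.closure (s.image g : Finset G)) := by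
      rw [AddMonoidHom.map_closure]
      have : φ '' ((s.image g : Finset G) : Set G) = s := by
        ext y; simp only [Finset.coe_image, mem_image, Finset.mem_coe, exists_exists_and_eq_and]
        constructor
        · rintro ⟨x, hx, rfl⟩; rw [hg2 x hx]; exact hx
        · intro hy; exact ⟨y, hy, hg2 y hy⟩
      rw [this, hs]
      exact AddSubgroup.mem_map_of_mem _ hz
    obtain ⟨f, hf, hf'⟩ := h2
    exact ⟨f, hf, by rw [map_sub, hf', sub_self]⟩

lemma Fg.map_fg {Z B : AddSubgroup G} (h : Fg Z B) : (Z.map (QuotientAddGroup.mk' B)).FG := by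
  obtain ⟨F, hF, hZ⟩ := h
  refine fg_of_le (fg_map hF (QuotientAddGroup.mk' B)) ?_
  rintro _ ⟨z, hz, rfl⟩
  obtain ⟨f, hf, b, hb, rfl⟩ := AddSubgroup.mem_sup.1 (hZ hz)
  refine ⟨f, hf, ?_⟩
  rw [map_add]
  have : QuotientAddGroup.mk' B b = 0 := (QuotientAddGroup.eq_zero_iff _).2 hb
  rw [this, add_zero]

/-- Simultaneous reduction modulo two subgroups. -/
lemma Fg.two {Z B1 B2 : AddSubgroup G} (h1 : Fg Z B1) (h2 : Fg Z B2) :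
    ∃ F : AddSubgroup G, F.FG ∧ ∀ z ∈ Z, ∃ f ∈ F, f ∈ Z ∧ z - f ∈ B1 ∧ z - f ∈ B2 := by
  obtain ⟨F1, a1, a2, a3⟩ := fg_lift (h1.map_fg)
  let φ := (QuotientAddGroup.mk' B1).prod (QuotientAddGroup.mk' B2)
  have : (Z.map φ).FG := by
    have e1 := fg_map h1.map_fg (AddMonoidHom.inl (G ⧸ B1) (G ⧸ B2))
    have e2 := fg_map h2.map_fg (AddMonoidHom.inr (G ⧸ B1) (G ⧸ B2))
    refine fg_of_le (fg_sup e1 e2) ?_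
    rintro _ ⟨z, hz, rfl⟩
    refine AddSubgroup.mem_sup.2 ⟨_, ⟨_, ⟨z, hz, rfl⟩, rfl⟩, _, ⟨_, ⟨z, hz, rfl⟩, rfl⟩, ?_⟩
    simp [φ]
  obtain ⟨F, b1, b2, b3⟩ := fg_lift this
  refine ⟨F, b2, fun z hz => ?_⟩
  obtain ⟨f, hf, h⟩ := b3 z hz
  have h' := Prod.ext_iff.1 h
  exact ⟨f, hf, b1 hf, (QuotientAddGroup.eq_zero_iff _).1 h'.1, (QuotientAddGroup.eq_zero_iff _).1 h'.2⟩

end fgabs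

section fg
variable {X : Type*} [TopologicalSpace X] [T2Space X] [CompactSpace X]
variable {n : ℕ}

lemma fg_co_zero (F : AddSubgroup (Co X ℤ 0)) : F.FG := by
  have : (⊤ : AddSubgroup (Co X ℤ 0)).FG := by
    have : (AddSubgroup.toIntSubmodule (⊤ : AddSubgroup (Co X ℤ 0))).FG := by
      have : Module.Finite ℤ ((Fin 0 → X) → ℤ) := inferInstance
      exact this.fg_top
    rw [Submodule.fg_iff_addSubgroup_fg] at this
    exact this
  exact fg_of_le this le_top

noncomputable def cutd (P : Set X) (m : ℕ) : Co X ℤ m →+ Co X ℤ (m+1) where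
  toFun := fun f => cut P (d f)
  map_zero' := by funext t; simp [cut, d_zero]
  map_add' := fun f g => by rw [d_add, cut_add]

lemma N_split {K1 K1' K2 K2' : Set X} (c1' : IsClosed K1') (i1 : K1 ⊆ interior K1') (i2 : K2 ⊆ K2')
    {m : ℕ} {f : Co X ℤ (m+1)} (hf : f ∈ N (K1' ∩ K2') (m+1)) :
    cut K1'ᶜ f ∈ N K1 (m+1) ∧ f - cut K1'ᶜ f ∈ N K2 (m+1) := by
  refine ⟨fun x hx => LZ_cut_of_notMem ?_, fun x hx => ?_⟩
  · rw [closure_compl]; exact fun h => h (i1 hx)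
  · by_cases h : x ∈ K1'
    · have := hf x ⟨h, i2 hx⟩
      rw [sub_eq_add_neg]
      exact this.add (LZ_cut this).neg
    · exact LZ_sub_cut (c1'.isOpen_compl.mem_nhds h)

lemma fg_step {m : ℕ} {L K1 K2 K1' K2' : Set X} (c1 : IsClosed K1) (c2 : IsClosed K2)
    (c1' : IsClosed K1') (j1 : K1 ⊆ interior K1') (i2 : K2 ⊆ K2')
    (h1 : Fg (Z (N ∅) (N L) (m+1)) (B (N ∅) (N K1') (m+1)))
    (h2 : Fg (Z (N ∅) (N L) (m+1)) (B (N ∅) (N K2') (m+1)))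
    (h : m ≠ 0 → Fg (Z (N ∅) (N (K1' ∩ K2')) m) (B (N ∅) (N (K1 ∩ K2)) m)) :
    Fg (Z (N ∅) (N L) (m+1)) (B (N ∅) (N (K1 ∪ K2)) (m+1)) := by
  have i1 := j1.trans interior_subset
  obtain ⟨F, hF, hF'⟩ := h1.two h2
  have key : ∃ F' : AddSubgroup (Co X ℤ m), F'.FG ∧ ∀ c ∈ Z (N ∅) (N (K1' ∩ K2')) m,
      ∃ c' ∈ F', ∃ k μ1 μ2, c' ∈ Z (N ∅) (N (K1' ∩ K2')) m ∧ μ1 ∈ N K1 m ∧ μ2 ∈ N K2 m ∧ k ∈ cob (N ∅) m ∧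
        c = c' + k + μ1 - μ2 := by
    by_cases hm : m = 0
    · subst hm
      exact ⟨⊤, fg_co_zero _, fun c hc => ⟨c, trivial, 0, 0, 0, hc, zero_mem _, zero_mem _,
        zero_mem _, by simp⟩⟩
    obtain ⟨F', a, b⟩ := (h hm).two (h hm)
    refine ⟨F', a, fun c hc => ?_⟩
    obtain ⟨c', hc', h1, h2, -⟩ := b c hc
    obtain ⟨k, hk, μ, hμ, e⟩ := AddSubgroup.mem_sup.1 h2
    obtain ⟨μ1, q1, μ2, q2, e'⟩ := AddSubgroup.mem_sup.1 (N_inter_le c1 c2 (Or.inl hm) hμ)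
    refine ⟨c', hc', k, μ1, -μ2, h1, q1, neg_mem q2, hk, ?_⟩
    rw [sub_neg_eq_add, add_assoc, e', add_assoc, e]; abel
  obtain ⟨F', hF1, hF2⟩ := key
  let P := K1'ᶜ
  refine ⟨F ⊔ F'.map (cutd P m), fg_sup hF (fg_map hF1 _), fun z hz => ?_⟩
  obtain ⟨f, hf, hfZ, b1, b2⟩ := hF' z hz
  obtain ⟨g1, -, e1⟩ := mem_B_succ.1 b1
  obtain ⟨g2, -, e2⟩ := mem_B_succ.1 b2
  have hg : g1 - g2 ∈ Z (N ∅) (N (K1' ∩ K2')) m := by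
    refine ⟨mem_N_empty _, ?_⟩
    have : d (g1 - g2) = ((z - f) - d g2) - ((z - f) - d g1) := by rw [d_sub]; abel
    rw [this]
    exact sub_mem (N_anti inter_subset_right _ e2) (N_anti inter_subset_left _ e1)
  obtain ⟨c, hc, k, μ1, μ2, hcZ, q1, q2, hk, e⟩ := hF2 _ hg
  obtain ⟨p1, p2⟩ := N_split c1' j1 i2 hcZ.2
  have hdk : d k = 0 := d_cob hk
  have e' : d g1 - d g2 = d c + d μ1 - d μ2 := by
    rw [← d_sub, e, d_sub, d_add, d_add, hdk, add_zero]
  have hfin : (z - f) + cut P (d c) - d (g1 - μ1) ∈ N (K1 ∪ K2) (m+1) := by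
    rw [mem_N_union]
    constructor
    · have : (z - f) + cut P (d c) - d (g1 - μ1) = ((z - f) - d g1) + cut P (d c) + d μ1 := by
        rw [d_sub]; abel
      rw [this]
      exact add_mem (add_mem (N_anti i1 _ e1) p1) ((N K1).dc q1)
    · have : (z - f) + cut P (d c) - d (g1 - μ1) =
          ((z - f) - d g2) - (d c - cut P (d c)) + d μ2 := by
        have : d g1 = d g2 + (d c + d μ1 - d μ2) := by rw [← e']; abel
        rw [d_sub, this]; abel
      rw [this]
      exact add_mem (sub_mem (N_anti i2 _ e2) p2) ((N K2).dc q2)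
  have h3 : (z - f) + cut P (d c) ∈ B (N ∅) (N (K1 ∪ K2)) (m+1) :=
    mem_B_succ.2 ⟨_, mem_N_empty _, hfin⟩
  refine AddSubgroup.mem_sup.2 ⟨f - cut P (d c), ?_, _, h3, by abel⟩
  exact sub_mem (AddSubgroup.mem_sup_left hf) (AddSubgroup.mem_sup_right ⟨c, hc, rfl⟩)

lemma fg_all (hX : LocE n X) (m : ℕ) : ∀ K L : Set X, IsClosed K → IsClosed L → K ⊆ interior L →
    Fg (Z (N ∅) (N L) m) (B (N ∅) (N K) m) := by
  induction m with
  | zero => intro K L _ _ _; exact ⟨⊤, fg_co_zero _, fun _ _ => AddSubgroup.mem_sup_left trivial⟩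
  | succ m ih =>
    intro K L hK hL hKL
    have key : ∃ K', IsClosed K' ∧ closure K ⊆ interior K' ∧
        Fg (Z (N ∅) (N L) (m+1)) (B (N ∅) (N K') (m+1)) := by
      refine hK.isCompact.induction_on (p := fun s => ∃ K', IsClosed K' ∧ closure s ⊆ interior K' ∧
        Fg (Z (N ∅) (N L) (m+1)) (B (N ∅) (N K') (m+1))) ?_ ?_ ?_ ?_
      · exact ⟨∅, isClosed_empty, by simp, ⊥, fg_bot',
          fun f _ => AddSubgroup.mem_sup_right (AddSubgroup.mem_sup_right (mem_N_empty f))⟩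
      · rintro s t hst ⟨K', a, b, c⟩
        exact ⟨K', a, (closure_mono hst).trans b, c⟩
      · rintro s t ⟨K1', a1, b1, h1⟩ ⟨K2', a2, b2, h2⟩
        obtain ⟨u1, o1, su1, cu1⟩ := normal_exists_closure_subset isClosed_closure isOpen_interior b1
        obtain ⟨u2, o2, su2, cu2⟩ := normal_exists_closure_subset isClosed_closure isOpen_interior b2
        refine ⟨closure u1 ∪ closure u2, isClosed_closure.union isClosed_closure, ?_,
          fg_step isClosed_closure isClosed_closure a1 cu1
            (cu2.trans interior_subset) h1 h2 fun _ => ih _ _ (isClosed_closure.inter isClosed_closure)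
              (a1.inter a2) ?_⟩
        · rw [closure_union]
          refine union_subset ?_ ?_
          · exact su1.trans (interior_maximal (subset_closure.trans subset_union_left) o1)
          · exact su2.trans (interior_maximal (subset_closure.trans subset_union_right) o2)
        · rw [interior_inter]; exact inter_subset_inter cu1 cu2
      · intro x hx
        obtain ⟨e, hxe⟩ := hX x
        obtain ⟨c, R, hR, hc1, hc2, hc3, -⟩ := exists_ball (B := univ) (e.open_source.inter isOpen_interior)
          ⟨hxe, hKL hx⟩ inter_subset_left (by simp)
        have oW : IsOpen (Om e (Metric.ball c R)) := isOpen_Om Metric.isOpen_ball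
        obtain ⟨W, hW, hxW, hW'⟩ := exists_closed_subnhd oW hc3
        refine ⟨W, mem_nhdsWithin_of_mem_nhds (hW.mem_nhds hxW), Om e (Metric.closedBall c R),
          isClosed_Om (isCompact_closedBall c R) hc1, ?_, ⊥, fg_bot', ?_⟩
        · exact hW'.trans (interior_maximal (Om_mono Metric.ball_subset_closedBall) oW)
        · intro f hf
          refine AddSubgroup.mem_sup_right ?_
          refine V_convex (isCompact_closedBall c R) (convex_closedBall c R)
            ⟨c, Metric.mem_closedBall_self hR.le⟩ hc1 (m+1) f (mem_N_empty _) ?_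
          exact N_anti (hc2.trans (inter_subset_right.trans interior_subset)) _ hf.2
    obtain ⟨K', a, b, F, hF, h⟩ := key
    refine ⟨F, hF, h.trans (sup_le_sup_left (sup_le_sup_left ?_ _) _)⟩
    exact N_anti (subset_closure.trans (b.trans interior_subset)) _

end fg
end MS

set_option linter.unusedSectionVars false
set_option linter.unusedVariables false
namespace MS
open Set Topology

section algebra
variable {M : Type*} [AddCommGroup M]

lemma one_add_pow_expand {R : Type*} [Ring R] (x : R) (p : ℕ) :
    ∃ r : R, (1 + x) ^ p = 1 + p * x + x * x * r := by
  induction p with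
  | zero => exact ⟨0, by simp⟩
  | succ p ih =>
    obtain ⟨r, hr⟩ := ih
    refine ⟨r + p + r * x, ?_⟩
    rw [pow_succ, hr]
    push_cast
    have : (p : R) * x * x = x * x * p := by
      rw [mul_assoc, (Nat.cast_commute p (x * x)).eq]
    noncomm_ring
    rw [← mul_assoc (p : R), this]
    noncomm_ring

/-- A finite order automorphism congruent to one modulo a suitable integer is trivial. -/
lemma rigid [Module.Finite ℤ M] : ∃ q : ℕ, 0 < q ∧ ∀ (p : ℕ), p.Prime → ∀ a : AddMonoid.End M, a ^ p = 1 →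
    (∀ x, ∃ y, a x - x = q • y) → a = 1 := by
  have hfin : Finite (Submodule.torsion ℤ M) :=
    Module.finite_of_fg_torsion _ (Submodule.torsion_isTorsion)
  let T := Nat.card (Submodule.torsion ℤ M)
  have hT0 : 0 < T := Nat.card_pos
  have hT : ∀ x ∈ Submodule.torsion ℤ M, T • x = 0 := by
    intro x hx
    have : T • (⟨x, hx⟩ : Submodule.torsion ℤ M) = 0 := card_nsmul_eq_zero'
    exact congrArg Subtype.val this
  refine ⟨6 * T, by omega, fun p hp a ha h => ?_⟩
  obtain ⟨l, hl6, hl2, hlp⟩ : ∃ l : ℕ, l ∣ 6 ∧ 2 ≤ l ∧ Nat.Coprime p l := by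
    by_cases h2 : p = 2
    · exact ⟨3, by norm_num, by norm_num, by rw [h2]; norm_num⟩
    · exact ⟨2, by norm_num, by norm_num, (Nat.coprime_primes hp Nat.prime_two).2 h2⟩
  obtain ⟨δ, hδ⟩ : ∃ δ : AddMonoid.End M, a = 1 + δ := ⟨a - 1, by abel⟩
  have hδ1 : ∀ x, δ x = a x - x := by
    intro x
    have : δ = a - 1 := by rw [hδ]; abel
    rw [this]; rfl
  obtain ⟨r, hr⟩ := one_add_pow_expand δ p
  rw [← hδ, ha] at hr
  have hr' : ∀ x, p • δ x = - δ (δ (r x)) := by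
    intro x
    have : (p : AddMonoid.End M) * δ + δ * δ * r = 0 := by
      have := hr.symm; rw [add_assoc] at this; simpa using this
    have := DFunLike.congr_fun this x
    rw [eq_neg_iff_add_eq_zero]
    exact this
  have hk : ∀ k : ℕ, ∀ x, ∃ y, δ x = (l ^ (k+1)) • y := by
    intro k
    induction k with
    | zero =>
      intro x
      obtain ⟨y, hy⟩ := h x
      obtain ⟨c, hc⟩ := hl6
      refine ⟨(c * T) • y, ?_⟩
      rw [hδ1, hy, zero_add, pow_one, smul_smul, ← mul_assoc, ← hc]
    | succ k ih =>
      intro x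
      obtain ⟨y, hy⟩ := ih x
      obtain ⟨z, hz⟩ := ih (r x)
      obtain ⟨w, hw⟩ := ih z
      have e1 : p • δ x = (l ^ (k+1+1)) • (-(l ^ k • w)) := by
        rw [hr', hz, map_nsmul, hw, smul_smul, smul_neg, smul_smul, ← pow_add, ← pow_add]
        congr 3; omega
      have e2 : l • δ x = l ^ (k+1+1) • y := by
        rw [hy, smul_smul, ← pow_succ']
      have hb := Nat.gcd_eq_gcd_ab p l
      rw [hlp] at hb
      refine ⟨Nat.gcdA p l • (-(l ^ k • w)) + Nat.gcdB p l • y, ?_⟩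
      have : δ x = ((1 : ℕ) : ℤ) • δ x := by simp
      rw [this, hb, add_smul, mul_comm, mul_comm (l : ℤ), mul_smul, mul_smul, natCast_zsmul, natCast_zsmul,
        e1, e2, smul_add, smul_comm (Nat.gcdA p l), smul_comm (Nat.gcdB p l)]
  have htor : ∀ x, δ x ∈ Submodule.torsion ℤ M := by
    intro x
    have : δ x ∈ (⨅ i : ℕ, (Ideal.span {(l : ℤ)}) ^ i • ⊤ : Submodule ℤ M) := by
      rw [Submodule.mem_iInf]
      intro i
      obtain ⟨y, hy⟩ := hk i x
      rw [hy, ← natCast_zsmul]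
      refine Submodule.smul_mem_smul ?_ trivial
      rw [Ideal.span_singleton_pow, Ideal.mem_span_singleton]
      push_cast
      exact pow_dvd_pow _ (Nat.le_succ i)
    rw [Ideal.mem_iInf_smul_pow_eq_bot_iff] at this
    obtain ⟨⟨r, hr⟩, h⟩ := this
    obtain ⟨c, rfl⟩ := Ideal.mem_span_singleton.1 hr
    rw [Submodule.mem_torsion_iff]
    have hne : (1 : ℤ) - l * c ≠ 0 := by
      intro h0
      have : (l : ℤ) ∣ 1 := ⟨c, by linarith⟩
      have := Int.le_of_dvd one_pos this
      omega
    refine ⟨⟨1 - l * c, mem_nonZeroDivisors_of_ne_zero hne⟩, ?_⟩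
    show ((1 : ℤ) - l * c) • δ x = 0
    rw [sub_smul, one_smul, sub_eq_zero]; exact h.symm
  have : δ = 0 := by
    ext x
    obtain ⟨y, hy⟩ := h x
    rw [← hδ1] at hy
    have hyt : y ∈ Submodule.torsion ℤ M := by
      have h1 : T • δ x = 0 := hT _ (htor x)
      rw [hy, smul_smul] at h1
      rw [Submodule.mem_torsion_iff]
      refine ⟨⟨((T * (6 * T) : ℕ) : ℤ), mem_nonZeroDivisors_of_ne_zero (by positivity)⟩, ?_⟩
      show ((T * (6 * T) : ℕ) : ℤ) • y = 0
      rw [natCast_zsmul]; exact h1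
    rw [hy, mul_smul, hT y hyt]; simp
  rw [hδ, this, add_zero]

/-- An elementary abelian group acting on a finitely generated group has a subgroup of bounded
index acting trivially. -/
lemma bounded_index (M : Type*) [AddCommGroup M] [Module.Finite ℤ M] : ∃ c : ℕ,
    ∀ (A : Type) [CommGroup A] [Finite A] (p : ℕ), p.Prime → (∀ a : A, a ^ p = 1) →
      ∀ φ : A →* AddMonoid.End M, ∃ K : Subgroup A, K.index ≤ c ∧ ∀ a ∈ K, φ a = 1 := by
  obtain ⟨q, hq, h⟩ := rigid (M := M)
  let S : AddSubgroup M := (nsmulAddMonoidHom (α := M) q).range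
  have hfin : Finite (M ⧸ S) := by
    have h1 : Module.Finite ℤ (M ⧸ S) :=
      Module.Finite.of_surjective (QuotientAddGroup.mk' S).toIntLinearMap (QuotientAddGroup.mk'_surjective S)
    refine Module.finite_of_fg_torsion _ fun {x} => ?_
    obtain ⟨x, rfl⟩ := QuotientAddGroup.mk_surjective x
    refine ⟨⟨(q : ℤ), mem_nonZeroDivisors_of_ne_zero (by positivity)⟩, ?_⟩
    show (q : ℤ) • (QuotientAddGroup.mk x : M ⧸ S) = 0
    rw [natCast_zsmul, ← QuotientAddGroup.mk_nsmul, QuotientAddGroup.eq_zero_iff]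
    exact ⟨x, rfl⟩
  have hfin' : Finite (M ⧸ S → M ⧸ S) := inferInstance
  refine ⟨Nat.card (M ⧸ S → M ⧸ S), fun A _ _ p hp hA φ => ?_⟩
  have hS : ∀ f : AddMonoid.End M, S ≤ S.comap f := by
    rintro f _ ⟨x, rfl⟩
    exact ⟨f x, (map_nsmul f q x).symm⟩
  let ψ : A →* Function.End (M ⧸ S) :=
    { toFun := fun a => (QuotientAddGroup.map S S (φ a) (hS _) : M ⧸ S → M ⧸ S)
      map_one' := by
        rw [map_one]; funext x
        obtain ⟨x, rfl⟩ := QuotientAddGroup.mk_surjective x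
        rfl
      map_mul' := fun a b => by
        rw [map_mul]; funext x
        obtain ⟨x, rfl⟩ := QuotientAddGroup.mk_surjective x
        rfl }
  have hfin'' : Finite (Function.End (M ⧸ S)) := hfin'
  refine ⟨ψ.toHomUnits.ker, ?_, fun a ha => ?_⟩
  · rw [Subgroup.index_ker]
    exact Nat.card_le_card_of_injective (fun x => ((x : (Function.End (M ⧸ S))ˣ) : Function.End (M ⧸ S)))
      ((Units.val_injective (α := Function.End (M ⧸ S))).comp Subtype.val_injective)
  · refine h p hp _ (by rw [← map_pow, hA, map_one]) fun x => ?_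
    have h0 : ψ a = 1 := congrArg Units.val (MonoidHom.mem_ker.1 ha)
    have h1 := congrFun h0 (QuotientAddGroup.mk x)
    have h2 : (QuotientAddGroup.mk (φ a x - x) : M ⧸ S) = 0 := by
      rw [QuotientAddGroup.mk_sub, sub_eq_zero]; exact h1
    obtain ⟨y, hy⟩ := (QuotientAddGroup.eq_zero_iff _).1 h2
    exact ⟨y, hy.symm⟩

lemma bounded_index' {G : Type*} [AddCommGroup G] {Z B : AddSubgroup G} (h : Fg Z B) : ∃ c : ℕ,
    ∀ (A : Type) [CommGroup A] [Finite A] (p : ℕ), p.Prime → (∀ a : A, a ^ p = 1) →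
      ∀ φ : A →* AddMonoid.End G, (∀ a, ∀ f ∈ Z, φ a f ∈ Z) → (∀ a, ∀ f ∈ B, φ a f ∈ B) →
      ∃ K : Subgroup A, K.index ≤ c ∧ ∀ a ∈ K, ∀ f ∈ Z, φ a f - f ∈ B := by
  have h1 := h.map_fg
  let M := AddSubgroup.toIntSubmodule (Z.map (QuotientAddGroup.mk' B))
  have h2 : M.FG := by rw [Submodule.fg_iff_addSubgroup_fg]; exact h1
  haveI : Module.Finite ℤ M := Module.Finite.iff_fg.2 h2
  obtain ⟨c, hc⟩ := bounded_index M
  refine ⟨c, fun A _ _ p hp hA φ hZ hB => ?_⟩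
  let β : A → (G ⧸ B →+ G ⧸ B) := fun a => QuotientAddGroup.map B B (φ a) (hB a)
  have hβ : ∀ a, ∀ x ∈ M, β a x ∈ M := by
    rintro a _ ⟨z, hz, rfl⟩
    exact ⟨φ a z, hZ a z hz, rfl⟩
  let ψ : A →* AddMonoid.End M :=
    { toFun := fun a =>
        ({ toFun := fun x => ⟨β a x.1, hβ a x.1 x.2⟩
           map_zero' := Subtype.ext (map_zero (β a))
           map_add' := fun x y => Subtype.ext (map_add (β a) x.1 y.1) } : M →+ M)
      map_one' := by
        refine DFunLike.ext _ _ ?_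
        rintro ⟨_, x, hx, rfl⟩
        refine Subtype.ext ?_
        show QuotientAddGroup.mk (φ 1 x) = _
        rw [map_one]; rfl
      map_mul' := fun a b => by
        refine DFunLike.ext _ _ ?_
        rintro ⟨_, x, hx, rfl⟩
        refine Subtype.ext ?_
        show QuotientAddGroup.mk (φ (a * b) x) = _
        rw [map_mul]; rfl }
  obtain ⟨K, hK, h⟩ := hc A p hp hA ψ
  refine ⟨K, hK, fun a ha f hf => ?_⟩
  have h2 := DFunLike.congr_fun (h a ha) ⟨_, f, hf, rfl⟩
  have h3 : (QuotientAddGroup.mk (φ a f) : G ⧸ B) = QuotientAddGroup.mk f := congrArg Subtype.val h2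
  rw [← QuotientAddGroup.eq_zero_iff, QuotientAddGroup.mk_sub, h3, sub_self]

end algebra

section triv
variable {X : Type*} [TopologicalSpace X]

/-- The trivial action of the trivial group. -/
@[reducible] def trivAct (X : Type*) : MulAction PUnit.{1} X where
  smul := fun _ x => x
  one_smul := fun _ => rfl
  mul_smul := fun _ _ _ => rfl

lemma trivCont : @ContinuousConstSMul PUnit.{1} X _ (trivAct X).toSMul :=
  letI := trivAct X
  ⟨fun _ => continuous_id⟩

lemma triv_inv (S : Set X) : letI := trivAct X; Inv PUnit.{1} S := by
  letI := trivAct X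
  intro a x hx; exact hx

lemma triv_NA (S : Set X) : letI := trivAct X; NA PUnit.{1} S = N S := by
  letI := trivAct X
  have : ∀ m, (NA PUnit.{1} S) m = N S m := fun m => le_antisymm (fun f hf => hf.1)
    (fun f hf => ⟨hf, fun a => rfl⟩)
  have h2 : (NA PUnit.{1} S).c = (N S).c := funext this
  cases h : NA PUnit.{1} S
  cases h' : N S
  simp only [h, h'] at h2
  subst h2
  rfl

lemma triv_pure [T2Space X] [CompactSpace X] (S T : Set X) : letI := trivAct X; Pure PUnit.{1} S T := by
  letI := trivAct X
  intro x _ y _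
  rw [Nat.card_unique, Nat.card_unique]

lemma plainD [T2Space X] [CompactSpace X] {n : ℕ} (hX : LocE n X) {m : ℕ} (hm : n + 2 ≤ m) :
    V (N (∅ : Set X)) (N univ) m := by
  letI := trivAct X
  haveI := trivCont (X := X)
  have := pureD (A := PUnit.{1}) hX (S1 := univ) (S2 := ∅) (triv_pure _ _) isClosed_univ isClosed_empty
    (triv_inv _) (triv_inv _) (empty_subset _) hm
  rwa [triv_NA, triv_NA] at this

end triv

section T
variable {X : Type*} [TopologicalSpace X]

lemma trivialActs [T2Space X] [CompactSpace X] {n : ℕ} (hX : LocE n X) : ∃ c : ℕ, ∀ (A : Type) [CommGroup A]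
    [Finite A] [MulAction A X] [ContinuousConstSMul A X] (p : ℕ), p.Prime → (∀ a : A, a ^ p = 1) →
    ∃ K : Subgroup A, K.index ≤ c ∧ ∀ (m : ℕ), ∀ a ∈ K, ∀ f ∈ Z (N (∅ : Set X)) (N univ) (m+1),
      pull (a • · : X → X) f - f ∈ B (N ∅) (N univ) (m+1) := by
  have h1 : ∀ m : ℕ, ∃ c : ℕ, ∀ (A : Type) [CommGroup A]
    [Finite A] [MulAction A X] [ContinuousConstSMul A X] (p : ℕ), p.Prime → (∀ a : A, a ^ p = 1) →
    ∃ K : Subgroup A, K.index ≤ c ∧ ∀ a ∈ K, ∀ f ∈ Z (N (∅ : Set X)) (N univ) (m+1),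
      pull (a • · : X → X) f - f ∈ B (N ∅) (N univ) (m+1) := by
    intro m
    obtain ⟨c, hc⟩ := bounded_index' (fg_all hX (m+1) univ univ isClosed_univ isClosed_univ (by simp))
    refine ⟨c, fun A _ _ _ _ p hp hA => ?_⟩
    have hN : ∀ (a : A) k, ∀ f ∈ N (univ : Set X) k, pull (a • · : X → X) f ∈ N univ k :=
      fun a k f hf x _ => LZ_smul a (hf (a • x) trivial)
    let φ : A →* AddMonoid.End (Co X ℤ (m+1)) :=
      { toFun := fun a => pullH (a • · : X → X) (m+1)
        map_one' := DFunLike.ext _ _ fun x => pull_one (A := A) x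
        map_mul' := fun a b => DFunLike.ext _ _ fun x => pull_mul a b x }
    refine hc A p hp hA φ (fun a f hf => ⟨mem_N_empty _, ?_⟩) fun a f hf => ?_
    · show d (pull _ _) ∈ N univ (m+1+1)
      rw [d_pull]; exact hN a _ _ hf.2
    · obtain ⟨g, -, hg⟩ := mem_B_succ.1 hf
      refine mem_B_succ.2 ⟨pull (a • · : X → X) g, mem_N_empty _, ?_⟩
      show pull _ f - _ ∈ N univ (m+1)
      rw [d_pull, ← pull_sub]
      exact hN a _ _ hg
  choose c hc using h1
  refine ⟨∏ i : Fin (n+1), c i, fun A _ _ _ _ p hp hA => ?_⟩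
  choose K hK1 hK2 using fun m => hc m A p hp hA
  refine ⟨⨅ i : Fin (n+1), K i, (Subgroup.index_iInf_le _).trans (Finset.prod_le_prod' fun i _ => hK1 i),
    fun m a ha f hf => ?_⟩
  by_cases hm : m < n + 1
  · exact hK2 m a ((Subgroup.mem_iInf.1 ha) ⟨m, hm⟩) f hf
  · have hN : pull (a • · : X → X) f - f ∈ Z (N (∅ : Set X)) (N univ) (m+1) := by
      refine ⟨mem_N_empty _, ?_⟩
      rw [d_sub, d_pull]
      exact sub_mem (fun x _ => LZ_smul a (hf.2 (a • x) trivial)) hf.2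
    exact plainD hX (by omega) _ hN.1 hN.2

theorem thmT (X : Type*) [TopologicalSpace X] [T2Space X] [CompactSpace X] [Nonempty X] {n : ℕ}
    (hX : LocE n X) (hn : 0 < n) : ∃ C : ℕ, ∀ (A : Type) [CommGroup A]
    [Finite A] [MulAction A X] [ContinuousConstSMul A X] (p : ℕ), p.Prime → (∀ a : A, a ^ p = 1) →
    ∀ I : Co X ℤ (n+1) → ℤ, Integral A n I →
    (∀ a : A, a ≠ 1 → ∀ D : Set X, IsClopen D → D.Nonempty → ∃ x ∈ D, a • x ≠ x) →
    Nat.card A ≤ p ^ C := by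
  obtain ⟨c, hc⟩ := trivialActs hX
  refine ⟨c + (2 * n + 1), fun A _ _ _ _ p hp hA I hI hcl => ?_⟩
  obtain ⟨K, hK, hK'⟩ := hc A p hp hA
  haveI : ContinuousConstSMul K X := ⟨fun a => continuous_const_smul (a : A)⟩
  have hIK : Integral K n I := ⟨hI.add, hI.cob, hI.zero, hI.one, fun a f hf => hI.inv a f hf⟩
  have hitr : interior (Str K X 2) = ∅ := by
    classical
    haveI := Fintype.ofFinite K
    have h1 : Str K X 2 ⊆ ⋃ g ∈ Finset.univ.filter (fun g : K => g ≠ 1), {x : X | g • x = x} := by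
      intro x hx
      have hx : 1 < Nat.card (MulAction.stabilizer K x) := hx
      haveI := Finite.one_lt_card_iff_nontrivial.1 hx
      obtain ⟨g, hg⟩ := exists_ne (1 : MulAction.stabilizer K x)
      refine mem_biUnion (x := (g : K)) ?_ g.2
      simpa using hg
    have h2 : ∀ s : Finset K, (∀ g ∈ s, g ≠ 1) → interior (⋃ g ∈ s, {x : X | g • x = x}) = ∅ := by
      intro s
      induction s using Finset.induction_on with
      | empty => simp
      | insert g s _ ih =>
        intro hs
        rw [Finset.set_biUnion_insert, interior_union_isClosed_of_interior_empty
          (show IsClosed {x : X | g • x = x} from isClosed_eq (continuous_const_smul g) continuous_id)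
          (ih fun g hg => hs g (Finset.mem_insert_of_mem hg))]
        refine newman (A := K) hX hn hIK (fun a ha D hD hD' => hcl a (fun h => ha (Subtype.ext h)) D hD hD') hp ?_
        haveI := Fact.mk hp
        exact orderOf_eq_prime (Subtype.ext (hA g)) (hs g (Finset.mem_insert_self _ _))
    replace h2 := h2 (Finset.univ.filter (fun g : K => g ≠ 1)) (by simp)
    rw [← subset_empty_iff, ← h2]
    exact interior_mono h1
  obtain ⟨u, hu, hIu⟩ := hI.one univ isOpen_univ univ_nonempty
  obtain ⟨g, w, hw, hgw⟩ := lowerBound (A := K) hp (fun a => Subtype.ext (hA a)) (fun m a f hf => hK' m a a.2 f hf)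
    (m := n) hu.2
  have hpu : d (p ^ (2*n+1) • u) ∈ N univ (n+2) := by rw [d_nsmul]; exact nsmul_mem hu.2 _
  have hdw : d w ∈ N univ (n+2) := by
    have := (N univ).dc hgw
    rw [d_sub, d_sub, d_d, sub_zero] at this
    have h2 := sub_mem hpu this
    rwa [sub_sub_cancel] at h2
  have hIw : I w = p ^ (2*n+1) := by
    have e1 : I (p ^ (2*n+1) • u) = p ^ (2*n+1) := by
      rw [hI.nsmul hu.2, hIu]; simp
    have e2 : I (p ^ (2*n+1) • u) = I (w + d g) := by
      refine hI.congr ?_ ?_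
      · rw [d_add, d_d, add_zero]; exact hdw
      · convert hgw using 1; abel
    rw [hI.add _ _ hdw (by rw [d_d]; exact zero_mem _), hI.cob, add_zero] at e2
    rw [← e2, e1]
  have hst := strata (A := K) hX hn hitr
  obtain ⟨β, hβ, ν, hν, e⟩ := AddSubgroup.mem_sup.1 (hst w ⟨mem_N_empty _, hw⟩ ⟨N_anti (subset_univ _) _ hdw,
    (inv K).dc hw⟩)
  obtain ⟨γ, -, rfl⟩ := cob_succ.1 hβ
  have hdν : d ν ∈ N univ (n+2) := by
    have : d w = d ν := by rw [← e, d_add, d_d, zero_add]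
    rwa [← this]
  have hIν : I ν = p ^ (2*n+1) := by
    rw [← hIw, ← e, hI.add _ _ (by rw [d_d]; exact zero_mem _) hdν, hI.cob, zero_add]
  have hdvd := freeLemma (A := K) hX hIK (Subset.refl _) (show ν ∈ Z _ _ _ from ⟨hν, hdν⟩)
  rw [hIν] at hdvd
  have hcard : Nat.card K ≤ p ^ (2*n+1) := by
    refine Nat.le_of_dvd (pow_pos hp.pos _) ?_
    exact_mod_cast hdvd
  rw [← K.card_mul_index, pow_add, mul_comm]
  refine Nat.mul_le_mul (hK.trans ?_) hcard
  exact (Nat.lt_two_pow_self).le.trans (Nat.pow_le_pow_left hp.two_le c)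

end T
end MS

set_option linter.unusedSectionVars false
set_option linter.unusedVariables false
namespace MS
open Set Topology

section isoz
variable {X : Type*}

/-- `H(P/N)` is infinite cyclic. -/
def IsoZ (P N : Sub X) (k : ℕ) : Prop := ∃ f0 ∈ Z P N k, (∀ f ∈ Z P N k, ∃ c : ℤ, f - c • f0 ∈ B P N k) ∧
  ∀ c : ℤ, c • f0 ∈ B P N k → c = 0

lemma sub_ext {P Q : Sub X} (h : ∀ m, P m = Q m) : P = Q := by
  have : P.c = Q.c := funext h
  cases P; cases Q
  simp only at this
  subst this; rfl

lemma isoZ_step {P N1 N2 : Sub X} (l1 : N1 ≤ P) (l2 : N2 ≤ P) {k : ℕ} (v1 : V P N1 (k+1)) (v2 : V P N2 (k+1))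
    (w1 : V P N1 k) (w2 : V P N2 k)
    (h : IsoZ P (N1 ⊔ N2) k) : IsoZ P (N1 ⊓ N2) (k+1) := by
  obtain ⟨f0, hf0, hs, hi⟩ := h
  obtain ⟨ν1, hν1, ν2, hν2, e0⟩ := mem_sup.1 hf0.2
  have hdd : d ν1 = - d ν2 := by
    have := d_d f0
    rw [← e0, d_add] at this
    exact eq_neg_of_add_eq_zero_left this
  refine ⟨ν1, ⟨l1 _ hν1, N1.dc hν1, ?_⟩, fun f hf => ?_, fun c hc => ?_⟩
  · show d ν1 ∈ N2 (k+1+1)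
    rw [hdd]; exact neg_mem (N2.dc hν2)
  · obtain ⟨g1, hg1, m1⟩ := mem_B_succ.1 (show f ∈ B P N1 (k+1) from v1 f hf.1 hf.2.1)
    obtain ⟨g2, hg2, m2⟩ := mem_B_succ.1 (show f ∈ B P N2 (k+1) from v2 f hf.1 hf.2.2)
    have hz : g1 - g2 ∈ Z P (N1 ⊔ N2) k := by
      refine ⟨sub_mem hg1 hg2, mem_sup.2 ⟨_, neg_mem m1, _, m2, ?_⟩⟩
      rw [d_sub]; abel
    obtain ⟨c, hc⟩ := hs _ hz
    obtain ⟨b, hb, n, hn, e⟩ := AddSubgroup.mem_sup.1 hc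
    obtain ⟨n1, hn1, n2, hn2, rfl⟩ := mem_sup.1 hn
    have e' : d g1 = d g2 + c • (ν1 + ν2) + d n1 + d n2 := by
      have := congrArg d e
      rw [d_add, d_cob hb, d_add, d_sub, d_sub, d_zsmul, ← e0, zero_add] at this
      rw [add_assoc, this]; abel
    refine ⟨-c, mem_B_succ.2 ⟨g1 - n1, sub_mem hg1 (l1 _ hn1), ?_, ?_⟩⟩
    · show f - (-c) • ν1 - d (g1 - n1) ∈ N1 (k+1)
      have : f - (-c) • ν1 - d (g1 - n1) = (f - d g1) + c • ν1 + d n1 := by rw [d_sub, neg_smul]; abel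
      rw [this]
      exact add_mem (add_mem m1 (zsmul_mem hν1 c)) (N1.dc hn1)
    · show f - (-c) • ν1 - d (g1 - n1) ∈ N2 (k+1)
      have : f - (-c) • ν1 - d (g1 - n1) = (f - d g2) - c • ν2 - d n2 := by
        rw [d_sub, e', neg_smul, smul_add]; abel
      rw [this]
      exact sub_mem (sub_mem m2 (zsmul_mem hν2 c)) (N2.dc hn2)
  · obtain ⟨g, hg, hm⟩ := mem_B_succ.1 hc
    have h1 : d g ∈ N1 (k+1) := by
      have := sub_mem (zsmul_mem hν1 c) hm.1
      rwa [sub_sub_cancel] at this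
    have h2 : d (c • f0 - g) ∈ N2 (k+1) := by
      have := add_mem (zsmul_mem hν2 c) hm.2
      rw [d_sub, d_zsmul, ← e0, smul_add]
      convert this using 1; abel
    have a1 := w1 g hg h1
    have a2 := w2 _ (sub_mem (zsmul_mem hf0.1 c) hg) h2
    refine hi c ?_
    have : c • f0 = g + (c • f0 - g) := by abel
    rw [this]
    exact add_mem ((sup_le_sup_left (show N1 k ≤ (N1 ⊔ N2) k from fun x hx => AddSubgroup.mem_sup_left hx)
        (cob P k) : cob P k ⊔ N1 k ≤ _) a1)
      ((sup_le_sup_left (show N2 k ≤ (N1 ⊔ N2) k from fun x hx => AddSubgroup.mem_sup_right hx)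
        (cob P k) : cob P k ⊔ N2 k ≤ _) a2)

lemma isoZ_exc {P P' N : Sub X} (h1 : P' ≤ P) (h2 : P ≤ P' ⊔ N) {k : ℕ} (h : IsoZ P N (k+1)) :
    IsoZ P' (P' ⊓ N) (k+1) := by
  obtain ⟨f0, hf0, hs, hi⟩ := h
  obtain ⟨a, ha, b, hb, e0⟩ := mem_sup.1 (h2 _ hf0.1)
  have hda : d a ∈ N (k+2) := by
    have := sub_mem hf0.2 (N.dc hb)
    rwa [← e0, d_add, add_sub_cancel_right] at this
  refine ⟨a, ⟨ha, P'.dc ha, hda⟩, fun f hf => ?_, fun c hc => ?_⟩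
  · obtain ⟨c, hc⟩ := hs f ⟨h1 _ hf.1, hf.2.2⟩
    obtain ⟨g, hg, hm⟩ := mem_B_succ.1 hc
    obtain ⟨g', hg', g'', hg'', rfl⟩ := mem_sup.1 (h2 _ hg)
    refine ⟨c, mem_B_succ.2 ⟨g', hg', ?_, ?_⟩⟩
    · show _ ∈ P' (k+1)
      exact sub_mem (sub_mem hf.1 (zsmul_mem ha c)) (P'.dc hg')
    show _ ∈ N (k+1)
    have : f - c • a - d g' = (f - c • f0 - d (g' + g'')) + c • b + d g'' := by
      rw [← e0, d_add, smul_add]; abel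
    rw [this]
    exact add_mem (add_mem hm (zsmul_mem hb c)) (N.dc hg'')
  · obtain ⟨g, hg, hm⟩ := mem_B_succ.1 hc
    refine hi c (mem_B_succ.2 ⟨g, h1 _ hg, ?_⟩)
    have : c • f0 - d g = (c • a - d g) + c • b := by rw [← e0, smul_add]; abel
    rw [this]
    exact add_mem hm.2 (zsmul_mem hb c)

end isoz

section loc
variable {X : Type*} [TopologicalSpace X] [T2Space X] [CompactSpace X]
variable {n : ℕ} {e : OpenPartialHomeomorph X (Eu n)}

/-- Coordinate discs in the ball. -/
def Ek (c : Eu n) (R : ℝ) (k : ℕ) : Set (Eu n) :=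
  {v | v ∈ Metric.closedBall c R ∧ ∀ i : Fin n, k ≤ i.1 → (v - c) i = 0}

/-- Half discs. -/
def Eh (c : Eu n) (R : ℝ) (k : Fin n) (s : ℝ) : Set (Eu n) :=
  {v | v ∈ Ek c R (k+1) ∧ 0 ≤ s * (v - c) k}

lemma isClosed_Ek (c : Eu n) (R : ℝ) (k : ℕ) : IsClosed (Ek c R k) := by
  have : Ek c R k = Metric.closedBall c R ∩ ⋂ i : Fin n, {v | k ≤ i.1 → (v - c) i = 0} := by
    ext v; simp [Ek]
  rw [this]
  refine Metric.isClosed_closedBall.inter (isClosed_iInter fun i => ?_)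
  by_cases h : k ≤ i.1
  · simp only [h, true_imp_iff]; exact isClosed_eq (by fun_prop) (by fun_prop)
  · simp [h]

lemma isClosed_Eh (c : Eu n) (R : ℝ) (k : Fin n) (s : ℝ) : IsClosed (Eh c R k s) :=
  (isClosed_Ek c R (k+1)).inter (show IsClosed {v : Eu n | 0 ≤ s * (v - c) k} from isClosed_le (by fun_prop) (by fun_prop))

lemma Ek_compact (c : Eu n) (R : ℝ) (k : ℕ) : IsCompact (Ek c R k) :=
  (isCompact_closedBall c R).of_isClosed_subset (isClosed_Ek c R k) fun _ h => h.1

lemma Eh_compact (c : Eu n) (R : ℝ) (k : Fin n) (s : ℝ) : IsCompact (Eh c R k s) :=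
  (isCompact_closedBall c R).of_isClosed_subset (isClosed_Eh c R k s) fun _ h => h.1.1

lemma Ek_convex (c : Eu n) (R : ℝ) (k : ℕ) : Convex ℝ (Ek c R k) := by
  intro v hv w hw a b ha hb hab
  refine ⟨convex_closedBall c R hv.1 hw.1 ha hb hab, fun i hi => ?_⟩
  have h1 := hv.2 i hi
  have h2 := hw.2 i hi
  simp only [PiLp.sub_apply, PiLp.add_apply, PiLp.smul_apply, smul_eq_mul] at *
  have : c i = a * c i + b * c i := by rw [← add_mul, hab, one_mul]
  rw [this]
  linear_combination a * h1 + b * h2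

lemma Eh_convex (c : Eu n) (R : ℝ) (k : Fin n) (s : ℝ) : Convex ℝ (Eh c R k s) := by
  intro v hv w hw a b ha hb hab
  refine ⟨Ek_convex c R _ hv.1 hw.1 ha hb hab, ?_⟩
  have h1 := hv.2
  have h2 := hw.2
  simp only [PiLp.sub_apply, PiLp.add_apply, PiLp.smul_apply, smul_eq_mul] at *
  have : c k = a * c k + b * c k := by rw [← add_mul, hab, one_mul]
  have e : s * (a * v k + b * w k - c k) = a * (s * (v k - c k)) + b * (s * (w k - c k)) := by
    linear_combination -s * this
  rw [e]
  positivity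

lemma normsq_split (v : Eu n) (k : Fin n) : ‖v‖ ^ 2 = v k ^ 2 + ∑ i ∈ Finset.univ.erase k, v i ^ 2 := by
  rw [EuclideanSpace.real_norm_sq_eq, Finset.add_sum_erase _ (fun i => v i ^ 2) (Finset.mem_univ k)]

/-- Half discs retract to the sphere. -/
lemma V_half {c : Eu n} {R : ℝ} (hR : 0 < R) (hQ : Metric.closedBall c R ⊆ e.target) (k : Fin n)
    {s : ℝ} (hs : s = 1 ∨ s = -1) (m : ℕ) :
    V (N (Om e (Metric.sphere c R))) (N (Om e (Metric.sphere c R) ∪ Om e (Eh c R k s))) m := by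
  have hS : Metric.sphere c R ⊆ e.target := Metric.sphere_subset_closedBall.trans hQ
  have hSc : IsClosed (Om e (Metric.sphere c R)) := isClosed_Om (isCompact_sphere c R) hS
  have hEt : Eh c R k s ⊆ e.target := fun v hv => hQ hv.1.1
  have hFc : IsClosed (Om e (Eh c R k s)) := isClosed_Om (Eh_compact c R k s) hEt
  haveI : Nonempty (Fin n) := ⟨k⟩
  refine bisect_fib hSc hFc (((List.finRange n).filter (· ≠ k)).map fun i x => e x i) ?_ (fun _ _ => True)
    (by simp) (by simp) (Or.inl ?_) ?_ m trivial
  · intro p hp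
    obtain ⟨i, -, rfl⟩ := List.mem_map.1 hp
    exact cont_coord (fun x hx => hx.1) i
  · obtain ⟨y, hy⟩ := (NormedSpace.sphere_nonempty (x := c) (r := R)).2 hR.le
    exact ⟨_, symm_mem_Om hS hy⟩
  · intro x hx m _
    let Sg : Set (Eu n) := Eh c R k s ∩ {v | ∀ i, i ≠ k → v i = e x i}
    have heq : {y ∈ Om e (Eh c R k s) |
        ∀ p ∈ ((List.finRange n).filter (· ≠ k)).map fun i x => e x i, p y = p x} = Om e Sg := by
      ext y
      simp [Sg, mem_Om, and_assoc]
      try tauto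
    rw [heq]
    have hcl : IsClosed {v : Eu n | ∀ i, i ≠ k → v i = e x i} := by
      simp only [ofPred_forall]
      exact isClosed_iInter fun i => isClosed_iInter fun _ => isClosed_eq (by fun_prop) (by fun_prop)
    have hcv : Convex ℝ {v : Eu n | ∀ i, i ≠ k → v i = e x i} := by
      intro v hv w hw a b ha hb hab i hi
      simp only [PiLp.add_apply, PiLp.smul_apply, smul_eq_mul, hv i hi, hw i hi]
      rw [← add_mul, hab, one_mul]
    have hx2 := hx.2
    set q := ∑ i ∈ Finset.univ.erase k, (e x - c) i ^ 2 with hq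
    have hqR : q ≤ R ^ 2 := by
      have h1 := normsq_split (e x - c) k
      have h2 : ‖e x - c‖ ≤ R := by rw [← dist_eq_norm]; exact hx2.1.1
      have h3 : ‖e x - c‖ ^ 2 ≤ R ^ 2 := pow_le_pow_left₀ (norm_nonneg _) h2 2
      nlinarith [sq_nonneg ((e x - c) k)]
    have hs2 : s * s = 1 := by rcases hs with rfl | rfl <;> norm_num
    let z : Eu n := WithLp.toLp 2 (Function.update (e x).ofLp k (c k + s * Real.sqrt (R ^ 2 - q)))
    have hzk : z k = c k + s * Real.sqrt (R ^ 2 - q) := by simp [z]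
    have hzi : ∀ i, i ≠ k → z i = e x i := fun i hi => by simp [z, hi]
    have hnorm : ∀ v : Eu n, (∀ i, i ≠ k → v i = e x i) → ‖v - c‖ ^ 2 = (v k - c k) ^ 2 + q := by
      intro v hv
      rw [normsq_split _ k, hq]
      congr 1
      refine Finset.sum_congr rfl fun i hi => ?_
      simp [hv i (Finset.ne_of_mem_erase hi)]
    have hzn : ‖z - c‖ = R := by
      have h1 := hnorm z hzi
      rw [hzk, add_sub_cancel_left, mul_pow, sq s, hs2, one_mul, Real.sq_sqrt (by linarith),
        sub_add_cancel] at h1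
      exact (pow_left_inj₀ (norm_nonneg _) hR.le two_ne_zero).1 h1
    have hzS : z ∈ Sg := by
      refine ⟨⟨⟨by rw [Metric.mem_closedBall, dist_eq_norm, hzn], fun i hi => ?_⟩, ?_⟩, hzi⟩
      · have hik : i ≠ k := fun h => by subst h; omega
        have := hx2.1.2 i hi
        simp only [PiLp.sub_apply] at this ⊢
        rw [hzi i hik]; exact this
      · simp only [PiLp.sub_apply]
        rw [hzk, add_sub_cancel_left, ← mul_assoc, hs2, one_mul]
        exact Real.sqrt_nonneg _
    refine relAcyc_chart hSc ((Eh_compact c R k s).inter_right hcl) ((Eh_convex c R k s).inter hcv)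
      (fun v hv => hEt hv.1) (y := e.symm z) ?_ m
    ext y
    simp only [mem_inter_iff, mem_Om, mem_sphere_iff_norm, mem_singleton_iff]
    have hzt := hEt hzS.1
    constructor
    · rintro ⟨⟨h1, h2⟩, -, h3, h4⟩
      have : e y = z := by
        ext i
        by_cases hi : i = k
        · subst hi
          have h5 := hnorm _ h4
          rw [h2] at h5
          have h6 : (e y i - c i) ^ 2 = R ^ 2 - q := by linarith
          have h7 : 0 ≤ s * (e y i - c i) := h3.2
          have h8 : s * (e y i - c i) = Real.sqrt (R ^ 2 - q) := by
            rw [← h6, ← Real.sqrt_sq h7, mul_pow, sq s, hs2, one_mul]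
          rw [hzk, ← h8, ← mul_assoc, hs2]; ring
        · rw [h4 i hi, hzi i hi]
      rw [← this, e.left_inv h1]
    · rintro rfl
      rw [e.right_inv hzt]
      exact ⟨⟨e.map_target hzt, hzn⟩, e.map_target hzt, hzS⟩

lemma Ek_zero {c : Eu n} {R : ℝ} (hR : 0 < R) : Ek c R 0 = {c} := by
  ext v
  simp only [Ek, mem_ofPred_eq, mem_singleton_iff]
  constructor
  · rintro ⟨-, h⟩
    ext i
    have := h i (Nat.zero_le _)
    simp only [PiLp.sub_apply] at this
    linarith
  · rintro rfl
    exact ⟨Metric.mem_closedBall_self hR.le, fun i _ => by simp⟩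

lemma Ek_top (c : Eu n) (R : ℝ) : Ek c R n = Metric.closedBall c R := by
  ext v
  simp only [Ek, mem_ofPred_eq]
  exact ⟨fun h => h.1, fun h => ⟨h, fun i hi => absurd i.2 (by omega)⟩⟩

lemma Eh_union (c : Eu n) (R : ℝ) (k : Fin n) : Eh c R k 1 ∪ Eh c R k (-1) = Ek c R (k+1) := by
  ext v
  simp only [Eh, mem_union, mem_ofPred_eq]
  constructor
  · rintro (h | h) <;> exact h.1
  · intro h
    rcases le_total 0 ((v - c) k) with h' | h'
    · exact Or.inl ⟨h, by linarith⟩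
    · exact Or.inr ⟨h, by linarith⟩

lemma Eh_inter (c : Eu n) (R : ℝ) (k : Fin n) : Eh c R k 1 ∩ Eh c R k (-1) = Ek c R k := by
  ext v
  simp only [Eh, mem_inter_iff, mem_ofPred_eq]
  constructor
  · rintro ⟨⟨h1, h2⟩, -, h3⟩
    refine ⟨h1.1, fun i hi => ?_⟩
    rcases Nat.eq_or_lt_of_le hi with h | h
    · have : k = i := Fin.ext h
      subst this; linarith
    · exact h1.2 i h
  · intro h
    have h0 := h.2 k le_rfl
    have : v ∈ Ek c R (k+1) := ⟨h.1, fun i hi => h.2 i (by omega)⟩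
    exact ⟨⟨this, by rw [h0]; simp⟩, this, by rw [h0]; simp⟩

lemma Om_union (e : OpenPartialHomeomorph X (Eu n)) (K L : Set (Eu n)) : Om e (K ∪ L) = Om e K ∪ Om e L := by
  ext y; simp only [mem_Om, mem_union]; tauto

lemma Om_inter (e : OpenPartialHomeomorph X (Eu n)) (K L : Set (Eu n)) : Om e (K ∩ L) = Om e K ∩ Om e L := by
  ext y; simp only [mem_Om, mem_inter_iff]; tauto

lemma d_one_apply {T : Type*} (f : Co T ℤ 1) (t : Fin 2 → T) :
    d f t = f (fun _ => t 1) - f (fun _ => t 0) := by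
  have h := congrFun (sl_d f (t 0)) (fun _ => t 1)
  have e1 : (Fin.cons (t 0) (fun _ => t 1) : Fin 2 → T) = t := by
    funext i; fin_cases i <;> rfl
  have e2 : sl (d f) (t 0) (fun _ => t 1) = d f t := by
    show d f (Fin.cons (t 0) (fun _ => t 1)) = _
    rw [e1]
  rw [← e2, h]
  show f _ - d (sl f (t 0)) _ = _
  congr 1
  show f _ = _
  congr 1
  funext i; fin_cases i; rfl

lemma isoZ_Ek {c : Eu n} {R : ℝ} (hR : 0 < R) (hn : 0 < n) (hQ : Metric.closedBall c R ⊆ e.target) (k : ℕ)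
    (hk : k ≤ n) :
    IsoZ (N (Om e (Metric.sphere c R))) (N (Om e (Metric.sphere c R) ∪ Om e (Ek c R k))) (k+1) := by
  have hS : Metric.sphere c R ⊆ e.target := Metric.sphere_subset_closedBall.trans hQ
  have hSc : IsClosed (Om e (Metric.sphere c R)) := isClosed_Om (isCompact_sphere c R) hS
  haveI : Nonempty (Fin n) := ⟨⟨0, hn⟩⟩
  have hne : (Om e (Metric.sphere c R)).Nonempty := by
    obtain ⟨y, hy⟩ := (NormedSpace.sphere_nonempty (x := c) (r := R)).2 hR.le
    exact ⟨_, symm_mem_Om hS hy⟩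
  induction k with
  | zero =>
    have hct : c ∈ e.target := hQ (Metric.mem_closedBall_self hR.le)
    have hx0 : e.symm c ∉ Om e (Metric.sphere c R) := by
      rintro ⟨-, h⟩
      rw [mem_preimage, e.right_inv hct, Metric.mem_sphere, dist_self] at h
      exact hR.ne h
    have hxE : e.symm c ∈ Om e (Ek c R 0) := by
      rw [Ek_zero hR]; exact symm_mem_Om (by simpa using hct) rfl
    have hEx : ∀ x ∈ Om e (Ek c R 0), x = e.symm c := by
      rintro x ⟨h1, h2⟩
      rw [mem_preimage, Ek_zero hR, mem_singleton_iff] at h2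
      rw [← h2, e.left_inv h1]
    obtain ⟨W, hWo, hxW, hW⟩ := exists_closed_nhd hSc hx0
    have hWS : cut W (fun _ => 1 : Co X ℤ 1) ∈ N (Om e (Metric.sphere c R)) 1 := by
      intro x hx
      refine LZ_cut_of_notMem fun h => ?_
      have : x ∈ closure W ∩ Om e (Metric.sphere c R) := ⟨h, hx⟩
      rw [hW] at this; exact this
    have hconst : ∀ f : Co X ℤ 1, LZ (d f) (e.symm c) → ∃ V ∈ 𝓝 (e.symm c), ∀ t : Fin 1 → X, t 0 ∈ V →
        f t = f (fun _ => e.symm c) := by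
      rintro f ⟨V, hV, h⟩
      refine ⟨V, hV, fun t ht => ?_⟩
      have h1 := h ![e.symm c, t 0] (fun i => by
        fin_cases i
        · exact mem_of_mem_nhds hV
        · exact ht)
      have h2 : d f ![e.symm c, t 0] = f t - f (fun _ => e.symm c) := by
        rw [d_one_apply]
        have : (fun _ => ![e.symm c, t 0] 1) = t := by funext i; fin_cases i; rfl
        rw [this]; rfl
      rw [h2] at h1
      linarith
    refine ⟨cut W (fun _ => 1), ⟨hWS, ?_⟩, fun f hf => ⟨f (fun _ => e.symm c), ?_⟩, fun z hz => ?_⟩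
    · refine mem_N_union.2 ⟨(N _).dc hWS, fun x hx => ?_⟩
      rw [hEx x hx]
      refine ⟨W, hWo.mem_nhds hxW, fun t ht => ?_⟩
      rw [d_local (g := fun _ => 1) (V := W) (fun t ht => cut_of_mem (fun _ => (1:ℤ)) (ht 0)) t ht]
      rw [d_one_apply, sub_self]
    · refine AddSubgroup.mem_sup_right (mem_N_union.2 ⟨sub_mem hf.1 (zsmul_mem hWS _), fun x hx => ?_⟩)
      rw [hEx x hx]
      obtain ⟨V, hV, h⟩ := hconst f ((mem_N_union.1 hf.2).2 _ hxE)
      refine ⟨V ∩ W, Filter.inter_mem hV (hWo.mem_nhds hxW), fun t ht => ?_⟩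
      simp [h t (ht 0).1, cut_of_mem _ (ht 0).2]
    · obtain ⟨g, hg, h⟩ := mem_B_succ.1 hz
      have hg0 : g = 0 := by
        obtain ⟨x, hx⟩ := hne
        obtain ⟨V, -, h⟩ := hg x hx
        funext t; exact h t (fun i => i.elim0)
      rw [hg0, d_zero, sub_zero] at h
      obtain ⟨V, hV, h⟩ := (mem_N_union.1 h).2 _ hxE
      have := h (fun _ => e.symm c) (fun _ => mem_of_mem_nhds hV)
      simpa [cut_of_mem (P := W) (fun _ => (1:ℤ)) (t := fun _ : Fin (0+1) => e.symm c) hxW] using this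
  | succ k ih =>
    have hkn : k < n := hk
    have hEt : ∀ s, Eh c R ⟨k, hkn⟩ s ⊆ e.target := fun s v hv => hQ hv.1.1
    have hEc : ∀ s, IsClosed (Om e (Eh c R ⟨k, hkn⟩ s)) := fun s => isClosed_Om (Eh_compact c R _ s) (hEt s)
    have key := isoZ_step (P := N (Om e (Metric.sphere c R)))
      (N1 := N (Om e (Metric.sphere c R) ∪ Om e (Eh c R ⟨k, hkn⟩ 1)))
      (N2 := N (Om e (Metric.sphere c R) ∪ Om e (Eh c R ⟨k, hkn⟩ (-1))))
      (N_anti subset_union_left) (N_anti subset_union_left) (k := k+1)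
      (V_half hR hQ _ (Or.inl rfl) _) (V_half hR hQ _ (Or.inr rfl) _)
      (V_half hR hQ _ (Or.inl rfl) _) (V_half hR hQ _ (Or.inr rfl) _) (by
        convert ih (by omega) using 1
        refine sub_ext fun m => le_antisymm (fun f hf => ?_) ?_
        · obtain ⟨a, ha, b, hb, rfl⟩ := mem_sup.1 hf
          have := Eh_inter c R ⟨k, hkn⟩
          simp only at this
          rw [← this, Om_inter]
          exact add_mem (N_anti (union_subset_union_right _ inter_subset_left) _ ha)
            (N_anti (union_subset_union_right _ inter_subset_right) _ hb)
        · have := Eh_inter c R ⟨k, hkn⟩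
          simp only at this
          rw [← this, Om_inter, union_inter_distrib_left]
          exact N_inter_le (hSc.union (hEc _)) (hSc.union (hEc _)) (Or.inr (Or.inl
            (hne.mono fun x hx => ⟨Or.inl hx, Or.inl hx⟩))))
    convert key using 1
    have := Eh_union c R ⟨k, hkn⟩
    simp only at this
    rw [← N_union, ← this, Om_union, union_union_distrib_left]

end loc

section zc
variable {X : Type*} [TopologicalSpace X] {n : ℕ}

/-- compactly supported cocycles / coboundaries of an open set -/
abbrev Zc (n : ℕ) (U : Set X) : AddSubgroup (Co X ℤ (n+1)) := Z (N Uᶜ) (N univ) (n+1)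
abbrev Bc (n : ℕ) (U : Set X) : AddSubgroup (Co X ℤ (n+1)) := B (N Uᶜ) (N univ) (n+1)

lemma Zc_mono {U W : Set X} (h : U ⊆ W) : Zc n U ≤ Zc n W := Z_mono (N_anti (compl_subset_compl.2 h)) _
lemma Bc_mono {U W : Set X} (h : U ⊆ W) : Bc n U ≤ Bc n W := B_mono (N_anti (compl_subset_compl.2 h)) _
lemma Bc_le_Zc (U : Set X) : Bc n U ≤ Zc n U := B_le_Z (N_anti (subset_univ _)) _

end zc

section loc
variable {X : Type*} [TopologicalSpace X] [T2Space X] [CompactSpace X]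
variable {n : ℕ} {e : OpenPartialHomeomorph X (Eu n)}

lemma N_ball_le {c : Eu n} {R : ℝ} (hR : 0 < R) (hn : 0 < n) (hQ : Metric.closedBall c R ⊆ e.target) :
    N (Om e (Metric.sphere c R)) ≤ N (Om e (Metric.ball c R))ᶜ ⊔ N (Om e (Metric.closedBall c R)) := by
  intro m
  have hS : Metric.sphere c R ⊆ e.target := Metric.sphere_subset_closedBall.trans hQ
  haveI : Nonempty (Fin n) := ⟨⟨0, hn⟩⟩
  have hne : (Om e (Metric.sphere c R)).Nonempty := by
    obtain ⟨y, hy⟩ := (NormedSpace.sphere_nonempty (x := c) (r := R)).2 hR.le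
    exact ⟨_, symm_mem_Om hS hy⟩
  have : Om e (Metric.sphere c R) = (Om e (Metric.ball c R))ᶜ ∩ Om e (Metric.closedBall c R) := by
    ext y
    simp only [mem_Om, mem_inter_iff, mem_compl_iff, Metric.mem_sphere, Metric.mem_ball, Metric.mem_closedBall,
      not_and, not_lt]
    constructor
    · rintro ⟨h1, h2⟩; exact ⟨fun _ => h2.ge, h1, h2.le⟩
    · rintro ⟨h1, h2, h3⟩; exact ⟨h2, le_antisymm h3 (h1 h2)⟩
  rw [this]
  exact N_inter_le (isOpen_Om Metric.isOpen_ball).isClosed_compl (isClosed_Om (isCompact_closedBall c R) hQ)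
    (Or.inr (Or.inl (this ▸ hne)))

lemma N_ball_inf (c : Eu n) (R : ℝ) :
    N (Om e (Metric.ball c R))ᶜ ⊓ N (Om e (Metric.closedBall c R)) = N univ := by
  rw [← N_union]
  congr 1
  refine eq_univ_of_forall fun x => ?_
  by_cases h : x ∈ Om e (Metric.ball c R)
  · exact Or.inr (Om_mono Metric.ball_subset_closedBall h)
  · exact Or.inl h

lemma sphere_sub (c : Eu n) (R : ℝ) : Om e (Metric.sphere c R) ⊆ (Om e (Metric.ball c R))ᶜ := by
  rintro x ⟨h1, h2⟩ ⟨_, h3⟩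
  rw [mem_preimage, Metric.mem_sphere] at h2
  rw [mem_preimage, Metric.mem_ball, h2] at h3
  exact lt_irrefl _ h3

/-- Balls have infinite cyclic top cohomology with compact supports. -/
lemma isoZ_ball {c : Eu n} {R : ℝ} (hR : 0 < R) (hn : 0 < n) (hQ : Metric.closedBall c R ⊆ e.target) :
    ∃ f0 ∈ Zc n (Om e (Metric.ball c R)), (∀ f ∈ Zc n (Om e (Metric.ball c R)), ∃ z : ℤ,
      f - z • f0 ∈ Bc n (Om e (Metric.ball c R))) ∧ ∀ z : ℤ, z • f0 ∈ Bc n (Om e (Metric.ball c R)) → z = 0 := by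
  have h := isoZ_Ek (e := e) hR hn hQ n le_rfl
  rw [Ek_top, ← Om_union, union_eq_self_of_subset_left Metric.sphere_subset_closedBall] at h
  have := isoZ_exc (P' := N (Om e (Metric.ball c R))ᶜ) (N_anti (sphere_sub c R)) (N_ball_le hR hn hQ) h
  rwa [N_ball_inf] at this

/-- Cocycles can be pushed into a smaller concentric ball. -/
lemma pushC {c : Eu n} {r R : ℝ} (hr : 0 < r) (hrR : r < R) (hn : 0 < n)
    (hQ : Metric.closedBall c R ⊆ e.target) {f : Co X ℤ (n+1)} (hf : f ∈ Zc n (Om e (Metric.ball c R))) :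
    ∃ f' ∈ Zc n (Om e (Metric.ball c r)), f - f' ∈ Bc n (Om e (Metric.ball c R)) := by
  have hv := push (e := e) hr hrR hQ hn (n+1) f (N_anti (sphere_sub c R) _ hf.1)
    (N_anti (subset_univ _) _ hf.2)
  obtain ⟨g, hg, hm⟩ := mem_B_succ.1 hv
  obtain ⟨g', hg', g'', hg'', rfl⟩ := mem_sup.1 (N_ball_le (hr.trans hrR) hn hQ _ hg)
  refine ⟨f - d g', ⟨?_, ?_⟩, ?_⟩
  · intro x hx
    by_cases hxR : x ∈ Om e (Metric.ball c R)
    · have h1 : LZ (f - d (g' + g'')) x := by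
        refine (mem_N_union.1 hm).2 x ⟨hxR.1, Metric.ball_subset_closedBall hxR.2, fun h => hx ⟨hxR.1, h⟩⟩
      have h2 : LZ g'' x := hg'' x (Om_mono Metric.ball_subset_closedBall hxR)
      have := h1.add h2.d
      rw [d_add] at this
      convert this using 1; abel
    · have := (hf.1 x hxR).add (hg' x hxR).d.neg
      rwa [← sub_eq_add_neg] at this
  · rw [d_sub, d_d, sub_zero]; exact hf.2
  · rw [sub_sub_cancel]
    exact AddSubgroup.mem_sup_left (cob_succ.2 ⟨g', hg', rfl⟩)

end loc
end MS

set_option linter.unusedSectionVars false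
set_option linter.unusedVariables false
namespace MS
open Set Topology

section li
variable {X : Type*} [TopologicalSpace X] {n : ℕ}

/-- Local functionals on compactly supported cohomology. -/
structure LF (n : ℕ) (U : Set X) (Λ : Co X ℤ (n+1) → ℤ) : Prop where
  add : ∀ f ∈ Zc n U, ∀ g ∈ Zc n U, Λ (f + g) = Λ f + Λ g
  zero : ∀ f ∈ Bc n U, Λ f = 0

/-- Local integrals. -/
structure LI (n : ℕ) (U : Set X) (Λ : Co X ℤ (n+1) → ℤ) : Prop extends LF n U Λ where
  one : ∀ y ∈ U, ∀ V, IsOpen V → y ∈ V → ∃ f ∈ Zc n (V ∩ U), Λ f = 1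

/-- Equality of germs. -/
def Rel (n : ℕ) (x : X) (Λ Λ' : Co X ℤ (n+1) → ℤ) : Prop :=
  ∃ V, IsOpen V ∧ x ∈ V ∧ ∀ f ∈ Zc n V, Λ f = Λ' f

variable {U U' : Set X} {Λ Λ' Λ'' : Co X ℤ (n+1) → ℤ} {x : X}

lemma Rel.refl (x : X) (Λ : Co X ℤ (n+1) → ℤ) : Rel n x Λ Λ := ⟨univ, isOpen_univ, trivial, fun _ _ => rfl⟩
lemma Rel.symm (h : Rel n x Λ Λ') : Rel n x Λ' Λ := by
  obtain ⟨V, h1, h2, h3⟩ := h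
  exact ⟨V, h1, h2, fun f hf => (h3 f hf).symm⟩
lemma Rel.trans (h : Rel n x Λ Λ') (h' : Rel n x Λ' Λ'') : Rel n x Λ Λ'' := by
  obtain ⟨V, h1, h2, h3⟩ := h
  obtain ⟨V', h1', h2', h3'⟩ := h'
  exact ⟨V ∩ V', h1.inter h1', ⟨h2, h2'⟩, fun f hf =>
    (h3 f (Zc_mono inter_subset_left hf)).trans (h3' f (Zc_mono inter_subset_right hf))⟩
lemma Rel.neg (h : Rel n x Λ Λ') : Rel n x (-Λ) (-Λ') := by
  obtain ⟨V, h1, h2, h3⟩ := h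
  exact ⟨V, h1, h2, fun f hf => by simp [h3 f hf]⟩
lemma Rel.eventually (h : Rel n x Λ Λ') : ∀ᶠ y in 𝓝 x, Rel n y Λ Λ' := by
  obtain ⟨V, h1, h2, h3⟩ := h
  filter_upwards [h1.mem_nhds h2] with y hy
  exact ⟨V, h1, hy, h3⟩

lemma LF.mono (h : LF n U Λ) (hU : U' ⊆ U) : LF n U' Λ :=
  ⟨fun f hf g hg => h.add f (Zc_mono hU hf) g (Zc_mono hU hg), fun f hf => h.zero f (Bc_mono hU hf)⟩

lemma LI.mono (h : LI n U Λ) (hU : U' ⊆ U) (o : IsOpen U') : LI n U' Λ :=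
  ⟨h.toLF.mono hU, fun y hy V oV hV => by
    obtain ⟨f, hf, h1⟩ := h.one y (hU hy) (V ∩ U') (oV.inter o) ⟨hV, hy⟩
    exact ⟨f, Zc_mono inter_subset_left hf, h1⟩⟩

lemma LF.map_zero (h : LF n U Λ) : Λ 0 = 0 := h.zero 0 (zero_mem _)

lemma LF.map_neg (h : LF n U Λ) {f : Co X ℤ (n+1)} (hf : f ∈ Zc n U) : Λ (-f) = - Λ f := by
  have := h.add f hf (-f) (neg_mem hf)
  rw [add_neg_cancel, h.map_zero] at this
  linarith

lemma LF.map_sub (h : LF n U Λ) {f g : Co X ℤ (n+1)} (hf : f ∈ Zc n U) (hg : g ∈ Zc n U) :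
    Λ (f - g) = Λ f - Λ g := by
  rw [sub_eq_add_neg, h.add f hf _ (neg_mem hg), h.map_neg hg, sub_eq_add_neg]

lemma LF.map_zsmul (h : LF n U Λ) {f : Co X ℤ (n+1)} (hf : f ∈ Zc n U) (z : ℤ) : Λ (z • f) = z * Λ f := by
  induction z with
  | zero => simp [h.map_zero]
  | succ k ih => rw [add_smul, one_smul, h.add _ (zsmul_mem hf _) _ hf, ih]; ring
  | pred k ih => rw [sub_smul, one_smul, h.map_sub (zsmul_mem hf _) hf, ih]; ring

lemma LF.congr (h : LF n U Λ) {f g : Co X ℤ (n+1)} (hf : f ∈ Zc n U) (hfg : f - g ∈ Bc n U) : Λ f = Λ g := by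
  have hg : g ∈ Zc n U := by
    have := sub_mem hf (Bc_le_Zc U hfg)
    rwa [sub_sub_cancel] at this
  have := h.map_sub hf hg
  rw [h.zero _ hfg] at this
  linarith

lemma LI.neg (h : LI n U Λ) : LI n U (-Λ) :=
  ⟨⟨fun f hf g hg => by simp only [Pi.neg_apply]; rw [h.add f hf g hg]; ring,
    fun f hf => by simp only [Pi.neg_apply]; rw [h.zero f hf, neg_zero]⟩, fun y hy V oV hV => by
      obtain ⟨f, hf, h1⟩ := h.one y hy V oV hV
      refine ⟨-f, neg_mem hf, ?_⟩
      rw [Pi.neg_apply, h.toLF.map_neg (Zc_mono inter_subset_right hf), h1, neg_neg]⟩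

lemma LI.not_neg (h : LI n U Λ) (hx : x ∈ U) (h1 : Rel n x Λ Λ') (h2 : Rel n x Λ (-Λ')) : False := by
  obtain ⟨V, oV, hxV, hV⟩ := h1.symm.trans h2
  obtain ⟨V', oV', hxV', hV'⟩ := h1
  obtain ⟨f, hf, h3⟩ := h.one x hx (V ∩ V') (oV.inter oV') ⟨hxV, hxV'⟩
  have a := hV f (Zc_mono (inter_subset_left.trans inter_subset_left) hf)
  have b := hV' f (Zc_mono (inter_subset_left.trans inter_subset_right) hf)
  rw [Pi.neg_apply, ← b, h3] at a
  omega

lemma Zc_pull (a : X ≃ₜ X) {f : Co X ℤ (n+1)} (hf : f ∈ Zc n U) : pull a f ∈ Zc n (a ⁻¹' U) := by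
  have key : ∀ {m : ℕ} (g : Co X ℤ m) (y : X), LZ g (a y) → LZ (pull a g) y := by
    rintro m g y ⟨W, hW, h⟩
    exact ⟨a ⁻¹' W, a.continuous.continuousAt hW, fun t ht => h _ ht⟩
  refine ⟨fun y hy => key _ _ (hf.1 _ hy), fun y _ => ?_⟩
  rw [d_pull]
  exact key _ _ (hf.2 _ trivial)

lemma Bc_pull (a : X ≃ₜ X) {f : Co X ℤ (n+1)} (hf : f ∈ Bc n U) : pull a f ∈ Bc n (a ⁻¹' U) := by
  have key : ∀ {m : ℕ} (g : Co X ℤ m) (y : X), LZ g (a y) → LZ (pull a g) y := by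
    rintro m g y ⟨W, hW, h⟩
    exact ⟨a ⁻¹' W, a.continuous.continuousAt hW, fun t ht => h _ ht⟩
  obtain ⟨g, hg, h⟩ := mem_B_succ.1 hf
  refine mem_B_succ.2 ⟨pull a g, fun y hy => key _ _ (hg _ hy), fun y _ => ?_⟩
  rw [d_pull, ← pull_sub]
  exact key _ _ (h _ trivial)

/-- Push forward of functionals. -/
def psh (a : X ≃ₜ X) (Λ : Co X ℤ (n+1) → ℤ) : Co X ℤ (n+1) → ℤ := fun f => Λ (pull a f)

lemma LF.psh (h : LF n (U) Λ) (a : X ≃ₜ X) : LF n (a.symm ⁻¹' U) (psh a Λ) := by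
  have e : a ⁻¹' (a.symm ⁻¹' U) = U := by ext y; simp
  refine ⟨fun f hf g hg => ?_, fun f hf => ?_⟩
  · have h1 := Zc_pull a hf
    have h2 := Zc_pull a hg
    rw [e] at h1 h2
    show Λ (pull a (f + g)) = _
    rw [pull_add]; exact h.add _ h1 _ h2
  · have h1 := Bc_pull a hf
    rw [e] at h1
    exact h.zero _ h1

lemma LI.psh (h : LI n U Λ) (a : X ≃ₜ X) : LI n (a.symm ⁻¹' U) (psh a Λ) := by
  refine ⟨h.toLF.psh a, fun y hy V oV hV => ?_⟩
  obtain ⟨f, hf, h1⟩ := h.one (a.symm y) hy (a ⁻¹' V) (oV.preimage a.continuous) (by simpa using hV)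
  refine ⟨pull a.symm f, ?_, ?_⟩
  · have := Zc_pull a.symm hf
    convert this using 2
    ext z; simp
  · show Λ (pull a (pull a.symm f)) = 1
    rw [pull_pull]
    convert h1 using 2
    have : (a.symm ∘ a : X → X) = id := by funext z; simp
    rw [this]; rfl

lemma Rel.psh (h : Rel n x Λ Λ') (a : X ≃ₜ X) : Rel n (a x) (MS.psh a Λ) (MS.psh a Λ') := by
  obtain ⟨V, h1, h2, h3⟩ := h
  refine ⟨a.symm ⁻¹' V, h1.preimage a.symm.continuous, by simpa using h2, fun f hf => h3 _ ?_⟩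
  have := Zc_pull a hf
  convert this using 2
  ext z; simp

end li

section glue
variable {X : Type*} [TopologicalSpace X] [T2Space X] [CompactSpace X] {n : ℕ}
variable {U U' : Set X} {Λ Λ' Λ'' : Co X ℤ (n+1) → ℤ} {x : X}

lemma dec2' (hX : LocE n X) {U1 U2 : Set X} (o1 : IsOpen U1) (o2 : IsOpen U2) {f : Co X ℤ (n+1)}
    (hf : f ∈ Zc n (U1 ∪ U2)) : ∃ f1 ∈ Zc n U1, ∃ f2 ∈ Zc n U2, f1 + f2 = f := by
  letI := trivAct X
  haveI := trivCont (X := X)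
  have := dec2 (A := PUnit.{1}) hX o1 o2 (triv_inv _) (triv_inv _) (triv_pure _ _) (f := f)
  rw [triv_NA, triv_NA, triv_NA] at this
  exact this hf

/-- Germwise equal functionals are equal. -/
lemma G1 (hX : LocE n X) (oU : IsOpen U) (h : LF n U Λ) (h' : LF n U Λ') (hr : ∀ z ∈ U, Rel n z Λ Λ')
    {f : Co X ℤ (n+1)} (hf : f ∈ Zc n U) : Λ f = Λ' f := by
  letI := trivAct X
  haveI := trivCont (X := X)
  let G : AddSubgroup (Co X ℤ (n+1)) :=
    { carrier := {f | f ∈ Zc n U ∧ Λ f = Λ' f}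
      zero_mem' := ⟨zero_mem _, by rw [h.map_zero, h'.map_zero]⟩
      add_mem' := fun {f g} hf hg => ⟨add_mem hf.1 hg.1, by
        rw [h.add _ hf.1 _ hg.1, h'.add _ hf.1 _ hg.1, hf.2, hg.2]⟩
      neg_mem' := fun {f} hf => ⟨neg_mem hf.1, by rw [h.map_neg hf.1, h'.map_neg hf.1, hf.2]⟩ }
  have key := dec (A := PUnit.{1}) hX (W := U) (triv_pure _ _) G (by
      rw [triv_NA]
      intro f hf
      have hB : f ∈ Bc n U := AddSubgroup.mem_sup_right hf
      exact ⟨Bc_le_Zc U hB, by rw [h.zero f hB, h'.zero f hB]⟩) (fun z hz => by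
      obtain ⟨V, oV, hV, hVe⟩ := hr z hz
      refine ⟨V ∩ U, oV.inter oU, triv_inv _, ⟨hV, hz⟩, inter_subset_right, ?_⟩
      rw [triv_NA]
      intro f hf
      exact ⟨Zc_mono inter_subset_right hf, hVe f (Zc_mono inter_subset_left hf)⟩)
  rw [triv_NA] at key
  exact (key hf).2

lemma glue2 (hX : LocE n X) (hn : 0 < n) (oU : IsOpen U) (oU' : IsOpen U') (h : LF n U Λ) (h' : LF n U' Λ')
    (hr : ∀ z ∈ U ∩ U', Rel n z Λ Λ') : ∃ I, LF n (U ∪ U') I ∧ (∀ f ∈ Zc n U, I f = Λ f) ∧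
      ∀ f ∈ Zc n U', I f = Λ' f := by
  classical
  have hD := fun f : Co X ℤ (n+1) => dec2' (f := f) hX oU oU'
  choose! F1 hF1 F2 hF2 hF using hD
  have key : ∀ f1 ∈ Zc n U, ∀ f2 ∈ Zc n U', Λ (F1 (f1 + f2)) + Λ' (F2 (f1 + f2)) = Λ f1 + Λ' f2 := by
    intro f1 h1 f2 h2
    have hm : f1 + f2 ∈ Zc n (U ∪ U') := add_mem (Zc_mono subset_union_left h1) (Zc_mono subset_union_right h2)
    have a1 := hF1 _ hm
    have a2 := hF2 _ hm
    have a := hF _ hm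
    have hi : f1 - F1 (f1 + f2) ∈ Zc n (U ∩ U') := by
      have e1 : f1 - F1 (f1 + f2) = F2 (f1 + f2) - f2 := by
        rw [sub_eq_sub_iff_add_eq_add, add_comm (F2 _), a]
      have b1 := sub_mem h1 a1
      have b2 := sub_mem a2 h2
      rw [← e1] at b2
      refine ⟨?_, b1.2⟩
      rw [compl_inter]
      exact mem_N_union.2 ⟨b1.1, b2.1⟩
    have e := G1 hX (oU.inter oU') (h.mono inter_subset_left) (h'.mono inter_subset_right) hr hi
    rw [h.map_sub h1 a1] at e
    have e1 : f1 - F1 (f1 + f2) = F2 (f1 + f2) - f2 := by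
      rw [sub_eq_sub_iff_add_eq_add, add_comm (F2 _), a]
    rw [e1, h'.map_sub a2 h2] at e
    linarith
  refine ⟨fun f => Λ (F1 f) + Λ' (F2 f), ⟨fun f hf g hg => ?_, fun f hf => ?_⟩, fun f hf => ?_, fun f hf => ?_⟩
  · have e : f + g = (F1 f + F1 g) + (F2 f + F2 g) := by
      conv_lhs => rw [← hF f hf, ← hF g hg]
      abel
    have := key _ (add_mem (hF1 f hf) (hF1 g hg)) _ (add_mem (hF2 f hf) (hF2 g hg))
    rw [← e, h.add _ (hF1 f hf) _ (hF1 g hg), h'.add _ (hF2 f hf) _ (hF2 g hg)] at this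
    linarith
  · obtain ⟨g, hg, hm⟩ := mem_B_succ.1 hf
    rw [compl_union] at hg
    obtain ⟨g1, hg1, g2, hg2, rfl⟩ := AddSubgroup.mem_sup.1
      (N_inter_le oU.isClosed_compl oU'.isClosed_compl (Or.inl hn.ne') hg)
    have b1 : f - d g2 ∈ Bc n U := mem_B_succ.2 ⟨g1, hg1, by
      convert hm using 1; rw [d_add]; abel⟩
    have b2 : d g2 ∈ Bc n U' := mem_B_succ.2 ⟨g2, hg2, by rw [sub_self]; exact zero_mem _⟩
    have := key _ (Bc_le_Zc _ b1) _ (Bc_le_Zc _ b2)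
    rw [sub_add_cancel, h.zero _ b1, h'.zero _ b2] at this
    simpa using this
  · have := key f hf 0 (zero_mem _)
    rw [add_zero, h'.map_zero, add_zero] at this
    exact this
  · have := key 0 (zero_mem _) f hf
    rw [zero_add, h.map_zero, zero_add] at this
    exact this

/-- Gluing coherent local functionals. -/
lemma glue (hX : LocE n X) (hn : 0 < n) (D : X → Set X) (M : X → Co X ℤ (n+1) → ℤ) (oD : ∀ q, IsOpen (D q))
    (hqD : ∀ q, q ∈ D q) (hM : ∀ q, LF n (D q) (M q)) (hr : ∀ q, ∀ z ∈ D q, Rel n z (M q) (M z)) :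
    ∃ I, LF n univ I ∧ ∀ z, Rel n z I (M z) := by
  have : ∃ U, IsOpen U ∧ univ ⊆ U ∧ ∃ I, LF n U I ∧ ∀ z ∈ U, Rel n z I (M z) := by
    refine isCompact_univ.induction_on (p := fun s => ∃ U, IsOpen U ∧ s ⊆ U ∧ ∃ I, LF n U I ∧
      ∀ z ∈ U, Rel n z I (M z)) ?_ ?_ ?_ ?_
    · exact ⟨∅, isOpen_empty, subset_rfl, fun _ => 0, ⟨fun _ _ _ _ => rfl, fun _ _ => rfl⟩, fun z hz => hz.elim⟩
    · rintro s t hst ⟨U, h1, h2, h3⟩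
      exact ⟨U, h1, hst.trans h2, h3⟩
    · rintro s t ⟨U, o, hs, I, hI, hR⟩ ⟨U', o', hs', I', hI', hR'⟩
      obtain ⟨J, hJ, h1, h2⟩ := glue2 hX hn o o' hI hI' fun z hz => (hR z hz.1).trans (hR' z hz.2).symm
      refine ⟨U ∪ U', o.union o', union_subset_union hs hs', J, hJ, ?_⟩
      rintro z (hz | hz)
      · exact (show Rel n z J I from ⟨U, o, hz, h1⟩).trans (hR z hz)
      · exact (show Rel n z J I' from ⟨U', o', hz, h2⟩).trans (hR' z hz)
    · intro q _
      exact ⟨D q, mem_nhdsWithin_of_mem_nhds ((oD q).mem_nhds (hqD q)), D q, oD q, subset_rfl, M q, hM q, hr q⟩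
  obtain ⟨U, o, hU, I, hI, hR⟩ := this
  rw [univ_subset_iff] at hU
  subst hU
  exact ⟨I, hI, fun z => hR z trivial⟩

lemma exists_ball' (hX : LocE n X) (oU : IsOpen U) (hx : x ∈ U) : ∃ (e : OpenPartialHomeomorph X (Eu n)),
    x ∈ e.source ∧ ∃ R, 0 < R ∧ Metric.closedBall (e x) R ⊆ e.target ∧ Om e (Metric.closedBall (e x) R) ⊆ U := by
  obtain ⟨e, he⟩ := hX x
  have h1 : e.target ∩ e.symm ⁻¹' U ∈ 𝓝 (e x) :=
    (e.symm.isOpen_inter_preimage oU).mem_nhds ⟨e.map_source he, by simpa [e.left_inv he] using hx⟩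
  obtain ⟨R, hR, h⟩ := Metric.nhds_basis_closedBall.mem_iff.1 h1
  refine ⟨e, he, R, hR, fun v hv => (h hv).1, fun y hy => ?_⟩
  have := (h hy.2).2
  rwa [mem_preimage, e.left_inv hy.1] at this

lemma LI.uniq (hX : LocE n X) (hn : 0 < n) (oU : IsOpen U) (oU' : IsOpen U') (h : LI n U Λ) (h' : LI n U' Λ')
    (hx : x ∈ U) (hx' : x ∈ U') : Rel n x Λ Λ' ∨ Rel n x Λ (-Λ') := by
  obtain ⟨e, he, R, hR, hRt, hRU⟩ := exists_ball' hX (oU.inter oU') ⟨hx, hx'⟩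
  obtain ⟨f0, hf0, hs, -⟩ := isoZ_ball (e := e) hR hn hRt
  have oW : IsOpen (Om e (Metric.ball (e x) R)) := isOpen_Om Metric.isOpen_ball
  have hxW : x ∈ Om e (Metric.ball (e x) R) := ⟨he, Metric.mem_ball_self hR⟩
  have hWU : Om e (Metric.ball (e x) R) ⊆ U ∩ U' := (Om_mono Metric.ball_subset_closedBall).trans hRU
  generalize Om e (Metric.ball (e x) R) = W at *
  have l : LI n W Λ := h.mono (hWU.trans inter_subset_left) oW
  have l' : LI n W Λ' := h'.mono (hWU.trans inter_subset_right) oW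
  have val : ∀ {L}, LI n W L → ∀ f ∈ Zc n W, ∀ z : ℤ, f - z • f0 ∈ Bc n W → L f = z * L f0 := by
    intro L hL f hf z hz
    rw [hL.toLF.congr hf hz, hL.toLF.map_zsmul hf0]
  have unit : ∀ {L}, LI n W L → L f0 = 1 ∨ L f0 = -1 := by
    intro L hL
    obtain ⟨f, hf, h1⟩ := hL.one x hxW W oW hxW
    rw [inter_self] at hf
    obtain ⟨z, hz⟩ := hs f hf
    rw [val hL f hf z hz] at h1
    exact Int.isUnit_iff.1 (IsUnit.of_mul_eq_one z (by rw [mul_comm]; exact h1))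
  have : Λ f0 = Λ' f0 ∨ Λ f0 = - Λ' f0 := by
    rcases unit l with a | a <;> rcases unit l' with b | b <;> simp [a, b]
  rcases this with a | a
  · refine Or.inl ⟨W, oW, hxW, fun f hf => ?_⟩
    obtain ⟨z, hz⟩ := hs f hf
    rw [val l f hf z hz, val l' f hf z hz, a]
  · refine Or.inr ⟨W, oW, hxW, fun f hf => ?_⟩
    obtain ⟨z, hz⟩ := hs f hf
    rw [Pi.neg_apply, val l f hf z hz, val l' f hf z hz, a]; ring

lemma LI.exists (hX : LocE n X) (hn : 0 < n) (x : X) : ∃ U, IsOpen U ∧ x ∈ U ∧ ∃ Λ, LI n U Λ := by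
  obtain ⟨e, he, R, hR, hRt, -⟩ := exists_ball' hX isOpen_univ (mem_univ x)
  obtain ⟨f0, hf0, hs, hi⟩ := isoZ_ball (e := e) hR hn hRt
  choose! Λ hΛ using hs
  have val : ∀ f ∈ Zc n (Om e (Metric.ball (e x) R)), ∀ z : ℤ, f - z • f0 ∈ Bc n (Om e (Metric.ball (e x) R)) →
      Λ f = z := by
    intro f hf z hz
    have := sub_mem hz (hΛ f hf)
    rw [sub_sub_sub_cancel_left, ← sub_smul] at this
    linarith [hi _ this]
  have lf : LF n (Om e (Metric.ball (e x) R)) Λ := by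
    refine ⟨fun f hf g hg => val _ (add_mem hf hg) _ ?_, fun f hf => val _ (Bc_le_Zc _ hf) _ ?_⟩
    · have := add_mem (hΛ f hf) (hΛ g hg)
      convert this using 1
      rw [add_smul]; abel
    · rw [zero_smul, sub_zero]; exact hf
  have sub : Metric.ball (e x) (R/4) ⊆ Metric.ball (e x) R := Metric.ball_subset_ball (by linarith)
  refine ⟨Om e (Metric.ball (e x) (R/4)), isOpen_Om Metric.isOpen_ball, ⟨he, Metric.mem_ball_self (by linarith)⟩, Λ,
    lf.mono (Om_mono sub), fun y hy V oV hV => ?_⟩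
  have hd : dist (e y) (e x) < R / 4 := hy.2
  have hys := hy.1
  have h1 : e.target ∩ e.symm ⁻¹' (V ∩ Om e (Metric.ball (e x) (R/4))) ∈ 𝓝 (e y) :=
    (e.symm.isOpen_inter_preimage (oV.inter (isOpen_Om Metric.isOpen_ball))).mem_nhds
      ⟨e.map_source hys, by rw [mem_preimage, e.left_inv hys]; exact ⟨hV, hy⟩⟩
  obtain ⟨r, hr, h⟩ := Metric.nhds_basis_ball.mem_iff.1 h1
  have hball : Metric.closedBall (e y) (R/2) ⊆ Metric.ball (e x) R := by
    refine Metric.closedBall_subset_ball' ?_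
    linarith
  obtain ⟨f1, hf1, b1⟩ := pushC (e := e) (r := R/4) (by linarith) (by linarith) hn hRt hf0
  have hf1' : f1 ∈ Zc n (Om e (Metric.ball (e y) (R/2))) :=
    Zc_mono (Om_mono (Metric.ball_subset_ball' (by rw [dist_comm]; linarith))) hf1
  obtain ⟨f2, hf2, b2⟩ := pushC (e := e) (c := e y) (r := min r (R/3)) (R := R/2) (lt_min hr (by linarith))
    ((min_le_right _ _).trans_lt (by linarith)) hn (hball.trans (Metric.ball_subset_closedBall.trans hRt)) hf1'
  have b2' := Bc_mono (Om_mono (e := e) (Metric.ball_subset_closedBall.trans hball)) b2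
  refine ⟨f2, Zc_mono (fun w hw => ?_) hf2, ?_⟩
  · have := (h (Metric.ball_subset_ball (min_le_left _ _) hw.2)).2
    rwa [mem_preimage, e.left_inv hw.1] at this
  · have c1 := lf.congr hf0 b1
    have c2 := lf.congr (Zc_mono (Om_mono sub) hf1) b2'
    rw [← c2, ← c1]
    exact val _ hf0 1 (by rw [one_smul, sub_self]; exact zero_mem _)

end glue
end MS

set_option linter.unusedSectionVars false
set_option linter.unusedVariables false
namespace MS
open Set Topology

section oc
variable {X : Type*} [TopologicalSpace X] {n : ℕ}

/-- Germs of local integrals. -/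
def IsG (n : ℕ) (x : X) (Λ : Co X ℤ (n+1) → ℤ) : Prop := ∃ U, IsOpen U ∧ x ∈ U ∧ LI n U Λ

/-- The class of a germ. -/
def cls (n : ℕ) (x : X) (Λ : Co X ℤ (n+1) → ℤ) : Set (Co X ℤ (n+1) → ℤ) := {Λ' | Rel n x Λ Λ'}

def OC (n : ℕ) (X : Type*) [TopologicalSpace X] : Type _ :=
  {q : X × Set (Co X ℤ (n+1) → ℤ) // ∃ Λ, IsG n q.1 Λ ∧ q.2 = cls n q.1 Λ}

/-- Points of the orientation cover. -/
def om (x : X) (Λ : Co X ℤ (n+1) → ℤ) (h : IsG n x Λ) : OC n X := ⟨(x, cls n x Λ), Λ, h, rfl⟩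

/-- The projection. -/
def pr (q : OC n X) : X := q.1.1

variable {U U' : Set X} {Λ Λ' : Co X ℤ (n+1) → ℤ} {x y : X}

lemma om_surj (q : OC n X) : ∃ Λ, ∃ h : IsG n (pr q) Λ, q = om (pr q) Λ h := by
  obtain ⟨⟨x, S⟩, Λ, h, e⟩ := q
  simp only at e
  subst e
  exact ⟨Λ, h, rfl⟩

@[simp] lemma pr_om (h : IsG n x Λ) : pr (om x Λ h) = x := rfl

lemma om_eq {h : IsG n x Λ} {h' : IsG n x Λ'} : om x Λ h = om x Λ' h' ↔ Rel n x Λ Λ' := by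
  constructor
  · intro e
    have : cls n x Λ = cls n x Λ' := congrArg (fun q : OC n X => q.1.2) e
    have h2 : Λ' ∈ cls n x Λ' := Rel.refl x Λ'
    rw [← this] at h2
    exact h2
  · intro e
    refine Subtype.ext (Prod.ext rfl ?_)
    ext M
    exact ⟨fun hM => e.symm.trans hM, fun hM => e.trans hM⟩

lemma om_eq' {h : IsG n x Λ} {h' : IsG n y Λ'} : om x Λ h = om y Λ' h' ↔ x = y ∧ Rel n x Λ Λ' := by
  constructor
  · intro e
    have : x = y := congrArg pr e
    subst this
    exact ⟨rfl, om_eq.1 e⟩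
  · rintro ⟨rfl, e⟩
    exact om_eq.2 e

lemma IsG.eventually (h : IsG n x Λ) : ∀ᶠ y in 𝓝 x, IsG n y Λ := by
  obtain ⟨U, o, hx, hU⟩ := h
  filter_upwards [o.mem_nhds hx] with y hy
  exact ⟨U, o, hy, hU⟩

instance : TopologicalSpace (OC n X) where
  IsOpen W := ∀ x Λ (h : IsG n x Λ), om x Λ h ∈ W → ∀ᶠ y in 𝓝 x, ∀ h', om y Λ h' ∈ W
  isOpen_univ := fun _ _ _ _ => Filter.Eventually.of_forall fun _ _ => trivial
  isOpen_inter := fun s t hs ht x Λ h hm => by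
    filter_upwards [hs x Λ h hm.1, ht x Λ h hm.2] with y h1 h2 h'
    exact ⟨h1 h', h2 h'⟩
  isOpen_sUnion := fun S hS x Λ h ⟨s, hs, hm⟩ => by
    filter_upwards [hS s hs x Λ h hm] with y h1 h'
    exact ⟨s, hs, h1 h'⟩

lemma oc_isOpen {W : Set (OC n X)} : IsOpen W ↔ ∀ x Λ (h : IsG n x Λ), om x Λ h ∈ W →
    ∀ᶠ y in 𝓝 x, ∀ h', om y Λ h' ∈ W := Iff.rfl

lemma cont_pr : Continuous (pr : OC n X → X) := by
  refine continuous_def.2 fun V hV x Λ h hm => ?_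
  filter_upwards [hV.mem_nhds hm] with y hy h'
  exact hy

lemma open_pr {W : Set (OC n X)} (hW : IsOpen W) : IsOpen (pr '' W) := by
  rw [isOpen_iff_mem_nhds]
  rintro _ ⟨q, hq, rfl⟩
  obtain ⟨Λ, h, e⟩ := om_surj q
  rw [e] at hq
  filter_upwards [hW _ _ h hq, h.eventually] with y h1 h2
  exact ⟨_, h1 h2, rfl⟩

/-- Sheets. -/
def sheet (U : Set X) (Λ : Co X ℤ (n+1) → ℤ) : Set (OC n X) := {q | ∃ y ∈ U, ∃ h : IsG n y Λ, q = om y Λ h}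

lemma sheet_mono (h : U ⊆ U') : sheet U Λ ⊆ sheet U' Λ := by
  rintro q ⟨y, hy, h1, h2⟩
  exact ⟨y, h hy, h1, h2⟩

lemma isOpen_sheet (o : IsOpen U) : IsOpen (sheet U Λ) := by
  rintro x Λ' h ⟨y, hy, h1, h2⟩
  obtain ⟨rfl, hr⟩ := om_eq'.1 h2
  filter_upwards [o.mem_nhds hy, h1.eventually, hr.eventually] with z hz h3 h4 h'
  exact ⟨z, hz, h3, om_eq.2 h4⟩

lemma sheet_inj {q q' : OC n X} (h : q ∈ sheet U Λ) (h' : q' ∈ sheet U Λ) (e : pr q = pr q') : q = q' := by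
  obtain ⟨y, hy, h1, rfl⟩ := h
  obtain ⟨y', hy', h1', rfl⟩ := h'
  have : y = y' := e
  subst this; rfl

open Classical in
/-- Local sections. -/
noncomputable def sec (q0 : OC n X) (Λ : Co X ℤ (n+1) → ℤ) (y : X) : OC n X :=
  if h : IsG n y Λ then om y Λ h else q0

lemma sec_eq (q0 : OC n X) (h : IsG n y Λ) : sec q0 Λ y = om y Λ h := dif_pos h

lemma pr_sec (q0 : OC n X) (h : IsG n y Λ) : pr (sec q0 Λ y) = y := by rw [sec_eq q0 h]; rfl

lemma sec_pr (q0 : OC n X) {q : OC n X} (h : q ∈ sheet U Λ) : sec q0 Λ (pr q) = q := by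
  obtain ⟨y, hy, h1, rfl⟩ := h
  exact sec_eq q0 h1

lemma sec_mem (q0 : OC n X) (h : IsG n y Λ) (hy : y ∈ U) : sec q0 Λ y ∈ sheet U Λ :=
  ⟨y, hy, h, sec_eq q0 h⟩

lemma sec_cont (q0 : OC n X) (h : IsG n y Λ) : ContinuousAt (sec q0 Λ) y := by
  intro W hW
  rw [sec_eq q0 h] at hW
  obtain ⟨W', hW', o, hm⟩ := mem_nhds_iff.1 hW
  refine Filter.mem_map.2 ?_
  filter_upwards [o _ _ h hm, h.eventually] with z h1 h2
  rw [mem_preimage, sec_eq q0 h2]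
  exact hW' (h1 h2)

/-- Charts of the orientation cover. -/
noncomputable def ocChart (q0 : OC n X) (o : IsOpen U) (hU : LI n U Λ) : OpenPartialHomeomorph (OC n X) X where
  toFun := pr
  invFun := sec q0 Λ
  source := sheet U Λ
  target := U
  map_source' := by rintro _ ⟨y, hy, h, rfl⟩; exact hy
  map_target' := fun y hy => sec_mem q0 ⟨U, o, hy, hU⟩ hy
  left_inv' := fun q hq => sec_pr q0 hq
  right_inv' := fun y hy => pr_sec q0 ⟨U, o, hy, hU⟩
  open_source := isOpen_sheet o
  open_target := o
  continuousOn_toFun := cont_pr.continuousOn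
  continuousOn_invFun := fun y hy => (sec_cont q0 ⟨U, o, hy, hU⟩).continuousWithinAt

lemma oc_locE (hX : LocE n X) : LocE n (OC n X) := by
  intro q
  obtain ⟨Λ, ⟨U, o, hx, hU⟩, e⟩ := om_surj q
  obtain ⟨c, hc⟩ := hX (pr q)
  refine ⟨(ocChart q o hU).trans c, ?_⟩
  rw [OpenPartialHomeomorph.trans_source]
  exact ⟨⟨_, hx, ⟨U, o, hx, hU⟩, e⟩, hc⟩

lemma IsG.psh (h : IsG n x Λ) (a : X ≃ₜ X) : IsG n (a x) (psh a Λ) := by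
  obtain ⟨U, o, hx, hU⟩ := h
  exact ⟨_, o.preimage a.symm.continuous, by simpa using hx, hU.psh a⟩

/-- The lifted homeomorphisms. -/
noncomputable def oact (a : X ≃ₜ X) (q : OC n X) : OC n X :=
  om (a (pr q)) (psh a (om_surj q).choose) ((om_surj q).choose_spec.choose.psh a)

lemma oact_om (a : X ≃ₜ X) (h : IsG n x Λ) : oact a (om x Λ h) = om (a x) (psh a Λ) (h.psh a) := by
  refine om_eq'.2 ⟨rfl, ?_⟩
  have := (om_surj (om x Λ h)).choose_spec.choose_spec
  exact (om_eq.1 this).symm.psh a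

lemma pr_oact (a : X ≃ₜ X) (q : OC n X) : pr (oact a q) = a (pr q) := rfl

lemma cont_oact (a : X ≃ₜ X) : Continuous (oact a : OC n X → OC n X) := by
  refine continuous_def.2 fun V hV x Λ h hm => ?_
  rw [mem_preimage, oact_om] at hm
  filter_upwards [a.continuous.continuousAt (hV _ _ _ hm)] with y hy h'
  rw [mem_preimage, oact_om]
  exact hy _

/-- The lifted action. -/
@[reducible] noncomputable def ocAct (n : ℕ) (A X : Type*) [TopologicalSpace X] [Group A] [MulAction A X]
    [ContinuousConstSMul A X] : MulAction A (OC n X) where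
  smul a q := oact (Homeomorph.smul a) q
  one_smul q := by
    obtain ⟨Λ, h, e⟩ := om_surj q
    rw [e]
    show oact (Homeomorph.smul (1 : A)) _ = _
    rw [oact_om]
    refine om_eq'.2 ⟨one_smul A _, ?_⟩
    have : psh (Homeomorph.smul (1 : A)) Λ = Λ := by
      funext f
      show Λ (pull _ f) = Λ f
      congr 1
      funext t
      show f _ = f t
      congr 1
      funext i
      exact one_smul A (t i)
    rw [this]; exact Rel.refl _ _
  mul_smul a b q := by
    obtain ⟨Λ, h, e⟩ := om_surj q
    rw [e]
    show oact (Homeomorph.smul (a * b)) _ = oact (Homeomorph.smul a) (oact (Homeomorph.smul b) _)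
    rw [oact_om, oact_om, oact_om]
    refine om_eq'.2 ⟨mul_smul a b _, ?_⟩
    have : psh (Homeomorph.smul (a * b)) Λ = psh (Homeomorph.smul a) (psh (Homeomorph.smul b) Λ) := by
      funext f
      show Λ (pull _ f) = Λ (pull _ (pull _ f))
      rw [pull_pull]
      congr 2
      funext z
      exact mul_smul a b z
    rw [this]; exact Rel.refl _ _

end oc

section oc2
variable {X : Type*} [TopologicalSpace X] [T2Space X] [CompactSpace X] {n : ℕ}
variable {U U' : Set X} {Λ Λ' : Co X ℤ (n+1) → ℤ} {x y : X}

lemma IsG.neg (h : IsG n x Λ) : IsG n x (-Λ) := by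
  obtain ⟨U, o, hx, hU⟩ := h
  exact ⟨U, o, hx, hU.neg⟩

lemma oc_cases (hX : LocE n X) (hn : 0 < n) (h : IsG n x Λ) (q : OC n X) (hq : pr q = x) :
    q = om x Λ h ∨ q = om x (-Λ) h.neg := by
  subst hq
  obtain ⟨Λ', h', e⟩ := om_surj q
  obtain ⟨U, o, hx, hU⟩ := id h
  obtain ⟨U', o', hx', hU'⟩ := id h'
  rcases hU'.uniq hX hn o' o hU hx' hx with h1 | h1
  · exact Or.inl (e.trans (om_eq.2 h1))
  · exact Or.inr (e.trans (om_eq.2 h1))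

lemma oc_t2 (hX : LocE n X) (hn : 0 < n) : T2Space (OC n X) := by
  refine ⟨fun q q' hne => ?_⟩
  by_cases hp : pr q = pr q'
  · obtain ⟨Λ, h, e⟩ := om_surj q
    obtain ⟨U, o, hx, hU⟩ := id h
    have e' : q' = om _ (-Λ) h.neg := by
      rcases oc_cases hX hn h q' hp.symm with h1 | h1
      · exact absurd (e.trans h1.symm) hne
      · exact h1
    refine ⟨sheet U Λ, sheet U (-Λ), isOpen_sheet o, isOpen_sheet o, ⟨_, hx, h, e⟩, ⟨_, hx, h.neg, e'⟩, ?_⟩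
    rw [Set.disjoint_left]
    rintro z ⟨y, hy, h1, h2⟩ ⟨y', hy', h1', h2'⟩
    rw [h2] at h2'
    obtain ⟨rfl, hr⟩ := om_eq'.1 h2'
    exact hU.not_neg hy (Rel.refl _ _) hr
  · obtain ⟨V, V', o, o', h1, h2, h3⟩ := t2_separation hp
    exact ⟨_, _, o.preimage cont_pr, o'.preimage cont_pr, h1, h2, h3.preimage _⟩

lemma oc_compact (hX : LocE n X) (hn : 0 < n) : CompactSpace (OC n X) := by
  have : ∃ K : Set (OC n X), IsCompact K ∧ pr ⁻¹' (univ : Set X) ⊆ K := by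
    refine isCompact_univ.induction_on (p := fun s => ∃ K : Set (OC n X), IsCompact K ∧ pr ⁻¹' s ⊆ K) ?_ ?_ ?_ ?_
    · exact ⟨∅, isCompact_empty, subset_rfl⟩
    · rintro s t hst ⟨K, h1, h2⟩
      exact ⟨K, h1, (preimage_mono hst).trans h2⟩
    · rintro s t ⟨K, h1, h2⟩ ⟨K', h1', h2'⟩
      exact ⟨K ∪ K', h1.union h1', union_subset_union h2 h2'⟩
    · intro x _
      obtain ⟨U, o, hx, Λ, hU⟩ := LI.exists hX hn x
      obtain ⟨K, hK, hKU, hKc⟩ := exists_mem_nhds_isClosed_subset (o.mem_nhds hx)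
      refine ⟨K, mem_nhdsWithin_of_mem_nhds hK, ?_⟩
      have hG : ∀ y ∈ K, IsG n y Λ := fun y hy => ⟨U, o, hKc hy, hU⟩
      let q0 : OC n X := om x Λ ⟨U, o, hx, hU⟩
      refine ⟨sec q0 Λ '' K ∪ sec q0 (-Λ) '' K, (hKU.isCompact.image_of_continuousOn fun y hy =>
        (sec_cont q0 (hG y hy)).continuousWithinAt).union (hKU.isCompact.image_of_continuousOn fun y hy =>
        (sec_cont q0 (hG y hy).neg).continuousWithinAt), fun q hq => ?_⟩
      rcases oc_cases hX hn (hG _ hq) q rfl with h | h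
      · exact Or.inl ⟨_, hq, by rw [sec_eq q0 (hG _ hq)]; exact h.symm⟩
      · exact Or.inr ⟨_, hq, by rw [sec_eq q0 (hG _ hq).neg]; exact h.symm⟩
  obtain ⟨K, h1, h2⟩ := this
  refine ⟨?_⟩
  have : K = univ := univ_subset_iff.1 h2
  rwa [this] at h1

end oc2
end MS

set_option linter.unusedSectionVars false
set_option linter.unusedVariables false
namespace MS
open Set Topology

section otr
variable {X : Type*} [TopologicalSpace X] {n : ℕ}
variable {U U' : Set X} {Λ Λ' : Co X ℤ (n+1) → ℤ} {x y : X}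

lemma LZ_pull {Y : Type*} [TopologicalSpace Y] {m : ℕ} {φ : X → Y} {f : Co Y ℤ m} (hφ : ContinuousAt φ x)
    (h : LZ f (φ x)) : LZ (pull φ f) x := by
  obtain ⟨W, hW, h⟩ := h
  exact ⟨φ ⁻¹' W, hφ hW, fun t ht => h _ ht⟩

lemma LZ.sub {m : ℕ} {f g : Co X ℤ m} (hf : LZ f x) (hg : LZ g x) : LZ (f - g) x := by
  rw [sub_eq_add_neg]; exact hf.add hg.neg

lemma LZ_of_sub {m : ℕ} {f g : Co X ℤ m} (hf : LZ f x) (hg : LZ (f - g) x) : LZ g x := by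
  have := hf.sub hg
  rwa [sub_sub_cancel] at this

/-- Transfer along a local section. -/
noncomputable def otr (q0 : OC n X) (U' : Set X) (Λ : Co X ℤ (n+1) → ℤ) {m : ℕ} (f : Co (OC n X) ℤ (m+1)) :
    Co X ℤ (m+1) := cut U' (pull (sec q0 Λ) f)

lemma otr_add (q0 : OC n X) (U' : Set X) (Λ : Co X ℤ (n+1) → ℤ) {m : ℕ} (f g : Co (OC n X) ℤ (m+1)) :
    otr q0 U' Λ (f + g) = otr q0 U' Λ f + otr q0 U' Λ g := by
  rw [otr, pull_add, cut_add]; rfl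

lemma LZ_otr_in (q0 : OC n X) (oU' : IsOpen U') (hy : y ∈ U') {m : ℕ} (f : Co (OC n X) ℤ (m+1)) :
    LZ (pull (sec q0 Λ) f - otr q0 U' Λ f) y := LZ_sub_cut (oU'.mem_nhds hy)


lemma otr_N (q0 : OC n X) (oU : IsOpen U) (oU' : IsOpen U') (hU : LI n U Λ) (hcl : closure U' ⊆ U)
    {V : Set (OC n X)} {m : ℕ} {f : Co (OC n X) ℤ (m+1)} (hf : f ∈ N Vᶜ (m+1)) :
    otr q0 U' Λ f ∈ N (pr '' V)ᶜ (m+1) := by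
  intro y hy
  by_cases hyU : y ∈ U
  · have hG : IsG n y Λ := ⟨U, oU, hyU, hU⟩
    refine LZ_cut (LZ_pull (sec_cont q0 hG) (hf _ fun h => hy ⟨_, h, pr_sec q0 hG⟩))
  · exact LZ_cut_of_notMem fun h => hyU (hcl h)

lemma pr_sheet : pr '' (sheet U' Λ) ⊆ U' := by
  rintro _ ⟨_, ⟨y, hy, h, rfl⟩, rfl⟩; exact hy

lemma otr_Zc (q0 : OC n X) (oU : IsOpen U) (oU' : IsOpen U') (hU : LI n U Λ) (hcl : closure U' ⊆ U)
    {V : Set (OC n X)} (hV : V ⊆ sheet U' Λ) {f : Co (OC n X) ℤ (n+1)} (hf : f ∈ Zc n V) :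
    otr q0 U' Λ f ∈ Zc n (pr '' V) := by
  have h1 := otr_N q0 oU oU' hU hcl hf.1
  refine ⟨h1, fun y _ => ?_⟩
  by_cases hy : y ∈ U'
  · have h2 := (LZ_otr_in (Λ := Λ) q0 oU' hy f).d
    rw [d_sub] at h2
    refine LZ_of_sub ?_ h2
    rw [d_pull]
    exact LZ_pull (sec_cont q0 ⟨U, oU, hcl (subset_closure hy), hU⟩) (hf.2 _ trivial)
  · exact (h1 y fun h => hy (pr_sheet (image_mono hV h))).d

lemma otr_Bc (q0 : OC n X) (oU : IsOpen U) (oU' : IsOpen U') (hU : LI n U Λ) (hcl : closure U' ⊆ U)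
    (hn : 0 < n) {f : Co (OC n X) ℤ (n+1)} (hf : f ∈ Bc n (sheet U' Λ)) :
    otr q0 U' Λ f ∈ Bc n U' := by
  obtain ⟨g, hg, h⟩ := mem_B_succ.1 hf
  obtain ⟨k, rfl⟩ : ∃ k, n = k + 1 := ⟨n - 1, by omega⟩
  have hg1 := N_anti (compl_subset_compl.2 (pr_sheet (U' := U') (Λ := Λ))) _ (otr_N q0 oU oU' hU hcl hg)
  have hf1 := N_anti (compl_subset_compl.2 (pr_sheet (U' := U') (Λ := Λ))) _
    (otr_N q0 oU oU' hU hcl (Bc_le_Zc _ hf).1)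
  refine mem_B_succ.2 ⟨otr q0 U' Λ g, hg1, fun y _ => ?_⟩
  by_cases hy : y ∈ U'
  · have h2 := (LZ_otr_in (Λ := Λ) q0 oU' hy g).d
    have h1 := LZ_otr_in (Λ := Λ) q0 oU' hy f
    have h3 := h1.sub h2
    rw [d_sub] at h3
    refine LZ_of_sub (f := pull (sec q0 Λ) (f - d g)) ?_ ?_
    · exact LZ_pull (sec_cont q0 ⟨U, oU, hcl (subset_closure hy), hU⟩) (h _ trivial)
    · rw [pull_sub, ← d_pull]
      convert h3 using 1; abel
  · exact (hf1 y hy).sub (hg1 y hy).d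

lemma otr_LF (q0 : OC n X) (oU : IsOpen U) (oU' : IsOpen U') (hU : LI n U Λ) (hcl : closure U' ⊆ U)
    (hn : 0 < n) : LF n (sheet U' Λ) (fun f => Λ (otr q0 U' Λ f)) := by
  have hs : U' ⊆ U := subset_closure.trans hcl
  refine ⟨fun f hf g hg => ?_, fun f hf => ?_⟩
  · have h1 := Zc_mono (pr_sheet.trans hs) (otr_Zc q0 oU oU' hU hcl subset_rfl hf)
    have h2 := Zc_mono (pr_sheet.trans hs) (otr_Zc q0 oU oU' hU hcl subset_rfl hg)
    simp only [otr_add]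
    exact hU.add _ h1 _ h2
  · exact hU.zero _ (Bc_mono hs (otr_Bc q0 oU oU' hU hcl hn hf))

/-- Existence of the corresponding cochain. -/
lemma otr_cor (q0 : OC n X) (oU : IsOpen U) (oU' : IsOpen U') (hU : LI n U Λ) (hcl : closure U' ⊆ U)
    {V : Set (OC n X)} (hV : V ⊆ sheet U' Λ) {f : Co (OC n X) ℤ (n+1)} (hf : f ∈ Zc n V) :
    ∃ g ∈ Zc n (pr '' V), ∀ z ∈ V, LZ (f - pull pr g) z := by
  refine ⟨_, otr_Zc q0 oU oU' hU hcl hV hf, fun z hz => ?_⟩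
  refine ⟨sheet U' Λ, (isOpen_sheet oU').mem_nhds (hV hz), fun t ht => ?_⟩
  have h1 : ∀ i, pr (t i) ∈ U' := fun i => pr_sheet ⟨_, ht i, rfl⟩
  have h2 : sec q0 Λ ∘ (pr ∘ t) = t := by funext i; exact sec_pr q0 (ht i)
  show f t - cut U' (pull (sec q0 Λ) f) (pr ∘ t) = 0
  rw [cut_of_mem _ (show (pr ∘ t) 0 ∈ U' from h1 0)]
  show f t - f (sec q0 Λ ∘ (pr ∘ t)) = 0
  rw [h2, sub_self]

/-- Evaluation by any corresponding cochain. -/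
lemma otr_eval (q0 : OC n X) (oU : IsOpen U) (oU' : IsOpen U') (hU : LI n U Λ) (hcl : closure U' ⊆ U)
    {V : Set (OC n X)} (hV : V ⊆ sheet U' Λ) {f : Co (OC n X) ℤ (n+1)} (hf : f ∈ Zc n V)
    {g : Co X ℤ (n+1)} (hg : g ∈ Zc n (pr '' V)) (h : ∀ z ∈ V, LZ (f - pull pr g) z) :
    Λ (otr q0 U' Λ f) = Λ g := by
  have hs : U' ⊆ U := subset_closure.trans hcl
  have h1 := otr_Zc q0 oU oU' hU hcl hV hf
  refine hU.toLF.congr (Zc_mono ((image_mono hV).trans (pr_sheet.trans hs)) h1)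
    (AddSubgroup.mem_sup_right fun y _ => ?_)
  by_cases hy : y ∈ pr '' V
  · obtain ⟨z, hz, rfl⟩ := hy
    have hyU : pr z ∈ U' := pr_sheet ⟨z, hV hz, rfl⟩
    have hG : IsG n (pr z) Λ := ⟨U, oU, hs hyU, hU⟩
    have a := LZ_otr_in (Λ := Λ) q0 oU' hyU f
    have b : LZ (pull (sec q0 Λ) (f - pull pr g)) (pr z) :=
      LZ_pull (sec_cont q0 hG) (by rw [sec_pr q0 (hV hz)]; exact h z hz)
    have c : LZ (pull (sec q0 Λ) (pull pr g) - g) (pr z) := by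
      refine ⟨U, oU.mem_nhds (hs hyU), fun t ht => ?_⟩
      show g (pr ∘ (sec q0 Λ ∘ t)) - g t = 0
      have : pr ∘ (sec q0 Λ ∘ t) = t := by
        funext i; exact pr_sec q0 ⟨U, oU, ht i, hU⟩
      rw [this, sub_self]
    rw [pull_sub] at b
    have := (b.sub a).add c
    convert this using 1; abel
  · exact (h1.1 y hy).sub (hg.1 y hy)

end otr

section int
variable {X : Type*} [TopologicalSpace X] [T2Space X] [CompactSpace X] {n : ℕ}
variable {U U' : Set X} {Λ Λ' : Co X ℤ (n+1) → ℤ} {x y : X}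

/-- Lifting cochains to a sheet. -/
lemma otr_lift (hX : LocE n X) (hn : 0 < n) (oU : IsOpen U) (oU' : IsOpen U') (hU : LI n U Λ) (hcl : closure U' ⊆ U)
    {V : Set (OC n X)} (oV : IsOpen V)
    (hV : V ⊆ sheet U' Λ) {g : Co X ℤ (n+1)} (hg : g ∈ Zc n (pr '' V)) :
    ∃ f ∈ Zc n V, ∀ z ∈ V, LZ (f - pull pr g) z := by
  haveI := oc_t2 hX hn
  have hin : ∀ z ∈ V, LZ (pull pr g - cut V (pull pr g)) z := fun z hz => LZ_sub_cut (oV.mem_nhds hz)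
  have hclV : closure V ⊆ sheet U Λ := by
    rcases V.eq_empty_or_nonempty with rfl | ⟨q0, -⟩
    · simp
    have hG : ∀ y ∈ closure U', IsG n y Λ := fun y hy => ⟨U, oU, hcl hy, hU⟩
    have hK : IsCompact (sec q0 Λ '' closure U') := isClosed_closure.isCompact.image_of_continuousOn fun y hy =>
      (sec_cont q0 (hG y hy)).continuousWithinAt
    refine (closure_minimal (fun z hz => ?_) hK.isClosed).trans ?_
    · exact ⟨pr z, subset_closure (pr_sheet ⟨z, hV hz, rfl⟩), sec_pr q0 (hV hz)⟩
    · rintro _ ⟨y, hy, rfl⟩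
      exact sec_mem q0 (hG y hy) (hcl hy)
  have hout : ∀ z ∉ V, LZ (cut V (pull pr g)) z := by
    intro z hz
    by_cases h : z ∈ closure V
    · refine LZ_cut (LZ_pull cont_pr.continuousAt (hg.1 _ ?_))
      rintro ⟨w, hw, e⟩
      exact hz (sheet_inj (hclV (subset_closure hw)) (hclV h) e ▸ hw)
    · exact LZ_cut_of_notMem h
  refine ⟨cut V (pull pr g), ⟨hout, fun z _ => ?_⟩, fun z hz => ?_⟩
  · by_cases hz : z ∈ V
    · have := (hin z hz).d
      rw [d_sub, d_pull] at this
      exact LZ_of_sub (LZ_pull cont_pr.continuousAt (hg.2 _ trivial)) this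
    · exact (hout z hz).d
  · have := (hin z hz).neg
    rwa [neg_sub] at this

lemma rel_act {w : OC n X} {U V : Set X} (a : X ≃ₜ X) (h : w ∈ sheet U Λ) (h' : oact a w ∈ sheet V Λ') :
    Rel n (pr (oact a w)) (psh a Λ) Λ' := by
  obtain ⟨y, hy, h, rfl⟩ := h
  obtain ⟨y', hy', h', e⟩ := h'
  rw [oact_om] at e ⊢
  exact (om_eq'.1 e).2

/-- The integral on the orientation cover. -/
lemma oc_integral (hX : LocE n X) (hn : 0 < n) (A : Type*) [Group A] [MulAction A X] [ContinuousConstSMul A X] :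
    letI := ocAct n A X
    ∃ I : Co (OC n X) ℤ (n+1) → ℤ, Integral A n I := by
  letI := ocAct n A X
  haveI := oc_t2 hX hn
  haveI := oc_compact hX hn
  have hY := oc_locE hX
  have hch : ∀ q : OC n X, ∃ (Λ : Co X ℤ (n+1) → ℤ) (U U' : Set X), IsOpen U ∧ IsOpen U' ∧ LI n U Λ ∧
      closure U' ⊆ U ∧ q ∈ sheet U' Λ := by
    intro q
    obtain ⟨Λ, ⟨U, o, hx, hU⟩, e⟩ := om_surj q
    obtain ⟨K, hK, hKc, hKU⟩ := exists_mem_nhds_isClosed_subset (o.mem_nhds hx)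
    exact ⟨Λ, U, interior K, o, isOpen_interior, hU, (closure_minimal interior_subset hKc).trans hKU,
      ⟨_, mem_interior_iff_mem_nhds.2 hK, ⟨U, o, hx, hU⟩, e⟩⟩
  choose L U U' oU oU' hU hcl hq using hch
  let M : OC n X → Co (OC n X) ℤ (n+1) → ℤ := fun q f => L q (otr q (U' q) (L q) f)
  have hrel : ∀ q q' z, z ∈ sheet (U' q) (L q) → z ∈ sheet (U' q') (L q') → Rel n (pr z) (L q) (L q') := by
    rintro q q' z ⟨y, hy, h, rfl⟩ ⟨y', hy', h', e⟩
    exact (om_eq'.1 e).2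
  obtain ⟨I, hI, hIM⟩ := glue hY hn (fun q => sheet (U' q) (L q)) M (fun q => isOpen_sheet (oU' q)) hq
    (fun q => otr_LF q (oU q) (oU' q) (hU q) (hcl q) hn) (by
      intro q z hz
      obtain ⟨V0, oV0, hzV0, hV0⟩ := hrel q z z hz (hq z)
      refine ⟨sheet (U' q) (L q) ∩ sheet (U' z) (L z) ∩ pr ⁻¹' V0,
        ((isOpen_sheet (oU' q)).inter (isOpen_sheet (oU' z))).inter (oV0.preimage cont_pr), ⟨⟨hz, hq z⟩, hzV0⟩,
        fun f hf => ?_⟩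
      obtain ⟨g, hg, hfg⟩ := otr_cor q (oU q) (oU' q) (hU q) (hcl q)
        (inter_subset_left.trans inter_subset_left) hf
      have e1 := otr_eval q (oU q) (oU' q) (hU q) (hcl q) (inter_subset_left.trans inter_subset_left) hf hg hfg
      have e2 := otr_eval z (oU z) (oU' z) (hU z) (hcl z) (inter_subset_left.trans inter_subset_right) hf hg hfg
      show L q _ = L z _
      rw [e1, e2]
      refine hV0 g (Zc_mono ?_ hg)
      rintro _ ⟨w, hw, rfl⟩
      exact hw.2)
  have hZ : ∀ f : Co (OC n X) ℤ (n+1), d f ∈ N univ (n+2) → f ∈ Zc n (univ : Set (OC n X)) := by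
    intro f hf
    refine ⟨?_, hf⟩
    rw [compl_univ]; exact mem_N_empty f
  refine ⟨I, fun f g hf hg => hI.add f (hZ f hf) g (hZ g hg), fun g => hI.zero _ ?_, fun f hf => hI.zero _ ?_, ?_, ?_⟩
  · refine AddSubgroup.mem_sup_left (cob_succ.2 ⟨g, ?_, rfl⟩)
    rw [compl_univ]; exact mem_N_empty g
  · exact AddSubgroup.mem_sup_right hf
  · rintro O oO ⟨q, hqO⟩
    obtain ⟨V1, oV1, hqV1, hV1⟩ := hIM q
    have oV : IsOpen (O ∩ V1 ∩ sheet (U' q) (L q)) := (oO.inter oV1).inter (isOpen_sheet (oU' q))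
    have hqV : q ∈ O ∩ V1 ∩ sheet (U' q) (L q) := ⟨⟨hqO, hqV1⟩, hq q⟩
    obtain ⟨g, hg, hg1⟩ := (hU q).one (pr q) (hcl q (subset_closure (pr_sheet ⟨q, hq q, rfl⟩))) _ (open_pr oV)
      ⟨q, hqV, rfl⟩
    replace hg := Zc_mono inter_subset_left hg
    obtain ⟨f, hf, hfg⟩ := otr_lift hX hn (oU q) (oU' q) (hU q) (hcl q) oV inter_subset_right hg
    refine ⟨f, Zc_mono (inter_subset_left.trans inter_subset_left) hf, ?_⟩
    rw [hV1 f (Zc_mono (inter_subset_left.trans inter_subset_right) hf), ← hg1]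
    exact otr_eval q (oU q) (oU' q) (hU q) (hcl q) inter_subset_right hf hg hfg
  · intro a f hf
    haveI : ContinuousConstSMul A (OC n X) := ⟨fun b => cont_oact _⟩
    let b : OC n X ≃ₜ OC n X := Homeomorph.smul a
    refine G1 hY isOpen_univ (Λ := psh b I) ?_ hI (fun z _ => ?_) (hZ f hf)
    · have := hI.psh b
      rwa [preimage_univ] at this
    obtain ⟨w, rfl⟩ := b.surjective z
    obtain ⟨Vz, oVz, hzVz, hVz⟩ := hIM (b w)
    obtain ⟨Vw, oVw, hwVw, hVw⟩ := hIM w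
    have hR : Rel n (pr (b w)) (psh (Homeomorph.smul a) (L w)) (L (b w)) := rel_act _ (hq w) (hq (b w))
    obtain ⟨V0, oV0, hzV0, hV0⟩ := hR
    let V : Set (OC n X) := Vz ∩ sheet (U' (b w)) (L (b w)) ∩ pr ⁻¹' V0 ∩ b.symm ⁻¹' (Vw ∩ sheet (U' w) (L w))
    have oV : IsOpen V := ((oVz.inter (isOpen_sheet (oU' _))).inter (oV0.preimage cont_pr)).inter
      ((oVw.inter (isOpen_sheet (oU' _))).preimage b.symm.continuous)
    refine ⟨V, oV, ⟨⟨⟨hzVz, hq _⟩, hzV0⟩, by simpa using ⟨hwVw, hq w⟩⟩, fun f hf => ?_⟩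
    have hVs : V ⊆ sheet (U' (b w)) (L (b w)) := fun v hv => hv.1.1.2
    have hVb : b ⁻¹' V ⊆ Vw ∩ sheet (U' w) (L w) := fun v hv => by simpa using hv.2
    obtain ⟨g, hg, hfg⟩ := otr_cor (b w) (oU _) (oU' _) (hU _) (hcl _) hVs hf
    have hf' := Zc_pull b hf
    have hg' := Zc_pull (Homeomorph.smul a : X ≃ₜ X) hg
    have himg : (Homeomorph.smul a : X ≃ₜ X) ⁻¹' (pr '' V) ⊆ pr '' (b ⁻¹' V) := by
      rintro y ⟨v, hv, e⟩
      refine ⟨b.symm v, by simpa using hv, ?_⟩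
      apply (Homeomorph.smul a : X ≃ₜ X).injective
      rw [← e]
      have : pr (b (b.symm v)) = (Homeomorph.smul a : X ≃ₜ X) (pr (b.symm v)) := rfl
      rw [← this, b.apply_symm_apply]
    replace hg' := Zc_mono himg hg'
    rw [hVz f (Zc_mono (fun v hv => hv.1.1.1) hf)]
    show I (pull b f) = _
    rw [hVw _ (Zc_mono (hVb.trans inter_subset_left) hf')]
    have e1 := otr_eval (b w) (oU _) (oU' _) (hU _) (hcl _) hVs hf hg hfg
    have e2 := otr_eval w (oU _) (oU' _) (hU _) (hcl _) (hVb.trans inter_subset_right) hf' hg' (fun v hv => by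
      have := LZ_pull (φ := b) (x := v) b.continuous.continuousAt (hfg _ hv)
      rw [pull_sub] at this
      exact this)
    show L w _ = L (b w) _
    rw [e1, e2]
    refine hV0 g (Zc_mono ?_ hg)
    rintro _ ⟨v, hv, rfl⟩
    exact hv.1.2

end int
end MS

set_option linter.unusedSectionVars false
set_option linter.unusedVariables false
namespace MS
open Set Topology

lemma conn_pos (X : Type*) [TopologicalSpace X] [T2Space X] [CompactSpace X] [ConnectedSpace X] {n : ℕ}
    (hX : LocE n X) (hn : 0 < n) : ∃ C : ℕ, ∀ (A : Type) [CommGroup A]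
    [Finite A] [MulAction A X] [ContinuousConstSMul A X] (p : ℕ), p.Prime → (∀ a : A, a ^ p = 1) →
    (∀ a : A, a ≠ 1 → ∃ x : X, a • x ≠ x) → Nat.card A ≤ p ^ C := by
  haveI := oc_t2 hX hn
  haveI := oc_compact hX hn
  obtain ⟨x0⟩ : Nonempty X := inferInstance
  haveI : Nonempty (OC n X) := by
    obtain ⟨U, oU, hx, Λ, h⟩ := LI.exists hX hn x0
    exact ⟨om x0 Λ ⟨U, oU, hx, h⟩⟩
  obtain ⟨C, hC⟩ := thmT (OC n X) (oc_locE hX) hn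
  refine ⟨C, fun A _ _ _ _ p hp hA heff => ?_⟩
  obtain ⟨I, hI⟩ := oc_integral hX hn A
  letI := ocAct n A X
  haveI : ContinuousConstSMul A (OC n X) := ⟨fun b => cont_oact _⟩
  refine hC A p hp hA I hI fun a ha D hD hDn => ?_
  obtain ⟨x, hx⟩ := heff a ha
  have h1 : IsClopen (pr '' D : Set X) := ⟨(hD.1.isCompact.image cont_pr).isClosed, open_pr hD.2⟩
  have h2 := h1.eq_univ (hDn.image _)
  obtain ⟨q, hq, rfl⟩ : x ∈ pr '' D := h2 ▸ mem_univ x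
  refine ⟨q, hq, fun h => hx ?_⟩
  exact congrArg pr h

lemma conn (X : Type*) [TopologicalSpace X] [T2Space X] [CompactSpace X] [ConnectedSpace X] {n : ℕ}
    (hX : LocE n X) : ∃ C : ℕ, ∀ (A : Type) [CommGroup A]
    [Finite A] [MulAction A X] [ContinuousConstSMul A X] (p : ℕ), p.Prime → (∀ a : A, a ^ p = 1) →
    (∀ a : A, a ≠ 1 → ∃ x : X, a • x ≠ x) → Nat.card A ≤ p ^ C := by
  rcases Nat.eq_zero_or_pos n with rfl | hn
  · have hd : ∀ x : X, IsOpen ({x} : Set X) := by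
      intro x
      obtain ⟨e, he⟩ := hX x
      have : e.source = {x} := by
        ext y
        refine ⟨fun hy => e.injOn hy he (Subsingleton.elim _ _), ?_⟩
        rintro rfl; exact he
      rw [← this]; exact e.open_source
    have hs : ∀ x y : X, x = y := by
      intro x y
      have := (IsClopen.eq_univ ⟨isClosed_singleton, hd y⟩ (singleton_nonempty y) : ({y} : Set X) = univ)
      exact (this ▸ mem_univ x : x ∈ ({y} : Set X))
    refine ⟨0, fun A _ _ _ _ p hp hA heff => ?_⟩
    have : Subsingleton A := by
      refine subsingleton_of_forall_eq 1 fun a => ?_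
      by_contra h
      obtain ⟨x, hx⟩ := heff a h
      exact hx (hs _ _)
    simp [Nat.card_unique]
  · exact conn_pos X hX hn

lemma conn' (X : Type*) [TopologicalSpace X] [T2Space X] [CompactSpace X] [ConnectedSpace X] {n : ℕ}
    (hX : LocE n X) : ∃ C : ℕ, ∀ (A : Type) [CommGroup A]
    [Finite A] [MulAction A X] [ContinuousConstSMul A X] (p : ℕ), p.Prime → (∀ a : A, a ^ p = 1) →
    ∃ K : Subgroup A, (∀ a ∈ K, ∀ x : X, a • x = x) ∧ K.index ≤ p ^ C := by
  obtain ⟨C, hC⟩ := conn X hX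
  refine ⟨C, fun A _ _ _ _ p hp hA => ?_⟩
  let K := (MulAction.toPermHom A X).ker
  have hK : ∀ a : A, a ∈ K ↔ ∀ x : X, a • x = x := by
    intro a
    rw [MonoidHom.mem_ker, Equiv.ext_iff]; rfl
  refine ⟨K, fun a ha => (hK a).1 ha, ?_⟩
  letI act : MulAction (A ⧸ K) X := MulAction.compHom X (QuotientGroup.kerLift (MulAction.toPermHom A X))
  have hact : ∀ (a : A) (x : X), (QuotientGroup.mk a : A ⧸ K) • x = a • x := fun a x => rfl
  haveI : ContinuousConstSMul (A ⧸ K) X := by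
    refine ⟨fun q => ?_⟩
    obtain ⟨a, rfl⟩ := QuotientGroup.mk_surjective q
    exact continuous_const_smul a
  refine hC (A ⧸ K) p hp ?_ ?_
  · intro q
    obtain ⟨a, rfl⟩ := QuotientGroup.mk_surjective q
    rw [← QuotientGroup.mk_pow, hA]; rfl
  · intro q hq
    obtain ⟨a, rfl⟩ := QuotientGroup.mk_surjective q
    by_contra! h
    exact hq ((QuotientGroup.eq_one_iff a).2 ((hK a).2 h))

lemma LocE.sub {X : Type*} [TopologicalSpace X] {n : ℕ} (hX : LocE n X) {U : Set X} (hU : IsOpen U) :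
    LocE n U := by
  intro x
  obtain ⟨e, he⟩ := hX x
  haveI : Nonempty U := ⟨x⟩
  refine ⟨(hU.isOpenEmbedding_subtypeVal.toOpenPartialHomeomorph _).trans e, ?_⟩
  simpa using he

theorem elem (X : Type*) [TopologicalSpace X] [T2Space X] [CompactSpace X] [LocallyConnectedSpace X] {n : ℕ}
    (hX : LocE n X) : ∃ C : ℕ, ∀ (A : Type) [CommGroup A]
    [Finite A] [MulAction A X] [ContinuousConstSMul A X] (p : ℕ), p.Prime → (∀ a : A, a ^ p = 1) →
    (∀ a : A, a ≠ 1 → ∃ x : X, a • x ≠ x) → Nat.card A ≤ p ^ C := by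
  haveI : Finite (ConnectedComponents X) := inferInstance
  classical
  haveI := Fintype.ofFinite (ConnectedComponents X)
  let W : ConnectedComponents X → Set X := fun i => (↑) ⁻¹' ({i} : Set (ConnectedComponents X))
  have hW : ∀ i, IsClopen (W i) := fun i =>
    ⟨(isClosed_discrete _).preimage ConnectedComponents.continuous_coe,
      (isOpen_discrete _).preimage ConnectedComponents.continuous_coe⟩
  have hc : ∀ i, ∃ C : ℕ, ∀ (A : Type) [CommGroup A]
      [Finite A] [MulAction A (W i)] [ContinuousConstSMul A (W i)] (p : ℕ), p.Prime → (∀ a : A, a ^ p = 1) →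
      ∃ K : Subgroup A, (∀ a ∈ K, ∀ x : W i, a • x = x) ∧ K.index ≤ p ^ C := by
    intro i
    haveI : CompactSpace (W i) := isCompact_iff_compactSpace.1 (hW i).1.isCompact
    haveI : ConnectedSpace (W i) := by
      rw [← isConnected_iff_connectedSpace]
      obtain ⟨x, rfl⟩ := ConnectedComponents.surjective_coe i
      simp only [W]
      rw [connectedComponents_preimage_singleton]
      exact isConnected_connectedComponent
    exact conn' (W i) (hX.sub (hW i).2)
  choose h hh using hc
  refine ⟨(Nat.card (Equiv.Perm (ConnectedComponents X))) + ∑ i, h i, fun A _ _ _ _ p hp hA heff => ?_⟩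
  have hmap : ∀ (a : A), Continuous (fun x : X => a • x) := fun a => continuous_const_smul a
  letI actK : MulAction A (ConnectedComponents X) :=
    { smul := fun a => (hmap a).connectedComponentsMap
      one_smul := fun i => by
        obtain ⟨x, rfl⟩ := ConnectedComponents.surjective_coe i
        exact congrArg ConnectedComponents.mk (one_smul A x)
      mul_smul := fun a b i => by
        obtain ⟨x, rfl⟩ := ConnectedComponents.surjective_coe i
        exact congrArg ConnectedComponents.mk (mul_smul a b x) }
  have hsm : ∀ (a : A) (x : X), a • (x : ConnectedComponents X) = ((a • x : X) : ConnectedComponents X) :=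
    fun a x => rfl
  let φ := MulAction.toPermHom A (ConnectedComponents X)
  have hφ : ∀ a ∈ φ.ker, ∀ i, a • i = (i : ConnectedComponents X) := fun a ha i => by
    have := MonoidHom.mem_ker.1 ha
    exact congrArg (fun σ : Equiv.Perm (ConnectedComponents X) => σ i) this
  have hK : ∀ i, ∃ K : Subgroup φ.ker, (∀ a ∈ K, ∀ x ∈ W i, a • x = x) ∧ K.index ≤ p ^ h i := by
    intro i
    letI act : MulAction φ.ker (W i) :=
      { smul := fun a x => ⟨(a : A) • (x : X), by
          have h1 : ((x : X) : ConnectedComponents X) = i := x.2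
          show (((a : A) • (x : X) : X) : ConnectedComponents X) = i
          rw [← hsm, h1, hφ a a.2]⟩
        one_smul := fun x => Subtype.ext (one_smul A (x : X))
        mul_smul := fun a b x => Subtype.ext (mul_smul (a : A) (b : A) (x : X)) }
    haveI : ContinuousConstSMul φ.ker (W i) := ⟨fun a =>
      ((hmap a).comp continuous_subtype_val).subtype_mk _⟩
    obtain ⟨K, hK, hi⟩ := hh i φ.ker p hp (fun a => Subtype.ext (hA a))
    exact ⟨K, fun a ha x hx => congrArg Subtype.val (hK a ha ⟨x, hx⟩), hi⟩
  choose K hK hKi using hK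
  have hbot : (⨅ i, K i) = ⊥ := by
    rw [eq_bot_iff]
    intro a ha
    rw [Subgroup.mem_iInf] at ha
    rw [Subgroup.mem_bot]
    by_contra hne
    obtain ⟨x, hx⟩ := heff (a : A) (fun h => hne (Subtype.ext h))
    exact hx (hK x a (ha x) x rfl)
  have h1 : Nat.card φ.ker ≤ p ^ ∑ i, h i := by
    rw [← Subgroup.index_bot, ← hbot, ← Finset.prod_pow_eq_pow_sum]
    exact (Subgroup.index_iInf_le K).trans (Finset.prod_le_prod' fun i _ => hKi i)
  have h2 : φ.ker.index ≤ p ^ Nat.card (Equiv.Perm (ConnectedComponents X)) := by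
    rw [Subgroup.index_ker]
    exact (Nat.card_le_card_of_injective _ Subtype.val_injective).trans (Nat.lt_pow_self hp.one_lt).le
  rw [pow_add, ← φ.ker.index_mul_card]
  exact Nat.mul_le_mul h2 h1

end MS

set_option linter.unusedSectionVars false
set_option linter.unusedVariables false
namespace MS
open Set Topology

lemma max_notMem {A : Type*} [CommGroup A] [Finite A] {g : A} (hg : orderOf g = Monoid.exponent A) {p : ℕ}
    (hp : p.Prime) (hd : p ∣ Monoid.exponent A) : g ∉ (powMonoidHom p : A →* A).range := by
  rintro ⟨h, rfl⟩
  have h0 : 0 < Monoid.exponent A := Monoid.exponent_ne_zero_of_finite.bot_lt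
  simp only [powMonoidHom_apply] at hg
  have h1 : orderOf h ∣ Monoid.exponent A := Monoid.order_dvd_exponent h
  have h2 : orderOf (h ^ p) ∣ orderOf h := orderOf_pow_dvd p
  have h3 : orderOf h = Monoid.exponent A := Nat.dvd_antisymm h1 (hg ▸ h2)
  have h4 := orderOf_pow_of_dvd hp.pos.ne' (h3 ▸ hd : p ∣ orderOf h)
  rw [hg, h3] at h4
  exact (Nat.div_lt_self h0 hp.one_lt).ne h4.symm

lemma gens (C : ℕ) : ∀ (A : Type) [CommGroup A] [Finite A],
    (∀ p : ℕ, p.Prime → (powMonoidHom p : A →* A).range.index ≤ p ^ C) →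
    ∃ S : Finset A, S.card ≤ C ∧ Subgroup.closure (S : Set A) = ⊤ := by
  induction C with
  | zero =>
    intro A _ _ h
    refine ⟨∅, le_rfl, ?_⟩
    obtain ⟨g, hg⟩ := Monoid.exists_orderOf_eq_exponent (G := A) Monoid.ExponentExists.of_finite
    have h1 : Monoid.exponent A = 1 := by
      by_contra hne
      obtain ⟨p, hp, hd⟩ := Nat.exists_prime_and_dvd hne
      refine max_notMem hg hp hd ?_
      have h2 := h p hp
      have h3 : (powMonoidHom p : A →* A).range.index = 1 :=
        le_antisymm (by simpa using h2) (Nat.one_le_iff_ne_zero.2 Subgroup.index_ne_zero_of_finite)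
      rw [Subgroup.index_eq_one.1 h3]; trivial
    rw [Monoid.exp_eq_one_iff] at h1
    exact Subsingleton.elim _ _
  | succ C ih =>
    intro A _ _ h
    classical
    obtain ⟨g, hg⟩ := Monoid.exists_orderOf_eq_exponent (G := A) Monoid.ExponentExists.of_finite
    let Z := Subgroup.zpowers g
    obtain ⟨S, hS, hS'⟩ := ih (A ⧸ Z) (by
      intro p hp
      set P := (powMonoidHom p : A →* A).range with hP
      have hle : P ⊔ Z ≤ ((powMonoidHom p : A ⧸ Z →* A ⧸ Z).range).comap (QuotientGroup.mk' Z) := by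
        refine sup_le ?_ ?_
        · rintro _ ⟨a, rfl⟩
          exact ⟨QuotientGroup.mk a, rfl⟩
        · intro z hz
          rw [Subgroup.mem_comap]
          have : QuotientGroup.mk' Z z = 1 := (QuotientGroup.eq_one_iff z).2 hz
          rw [this]; exact one_mem _
      rw [← Subgroup.index_comap_of_surjective _ (QuotientGroup.mk'_surjective Z)]
      have hpos : 0 < (P ⊔ Z).index := Nat.pos_of_ne_zero Subgroup.index_ne_zero_of_finite
      refine (Nat.le_of_dvd hpos (Subgroup.index_dvd_of_le hle)).trans ?_
      have hmul := Subgroup.relIndex_mul_index (le_sup_left : P ≤ P ⊔ Z)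
      have hPle := h p hp
      have hpg : IsPGroup p (A ⧸ P) := by
        intro q
        refine ⟨1, ?_⟩
        obtain ⟨a, rfl⟩ := QuotientGroup.mk_surjective q
        rw [pow_one, ← QuotientGroup.mk_pow]
        exact (QuotientGroup.eq_one_iff _).2 ⟨a, rfl⟩
      haveI := Fact.mk hp
      obtain ⟨k, hk⟩ := hpg.exists_card_eq
      have hk' : P.index = p ^ k := hk
      by_cases hd : p ∣ Monoid.exponent A
      · have hr1 : P.relIndex (P ⊔ Z) ≠ 1 := by
          intro h1
          rw [Subgroup.relIndex_eq_one] at h1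
          exact max_notMem hg hp hd (h1 (le_sup_right (a := P) (Subgroup.mem_zpowers g)))
        have hr2 : P.relIndex (P ⊔ Z) ∣ p ^ k := hk' ▸ Dvd.intro _ hmul
        obtain ⟨j, hj, hj'⟩ := (Nat.dvd_prime_pow hp).1 hr2
        have hj0 : j ≠ 0 := by rintro rfl; exact hr1 (by simpa using hj')
        have hr3 : p ≤ P.relIndex (P ⊔ Z) := by
          rw [hj']; exact Nat.le_self_pow hj0 p
        refine Nat.le_of_mul_le_mul_left ?_ hp.pos
        calc p * (P ⊔ Z).index ≤ P.relIndex (P ⊔ Z) * (P ⊔ Z).index := Nat.mul_le_mul_right _ hr3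
          _ = P.index := hmul
          _ ≤ _ := by rw [← pow_succ']; exact hPle
      · have htop : P = ⊤ := by
          rw [hP, MonoidHom.range_eq_top, ← Finite.injective_iff_surjective, injective_iff_map_eq_one]
          intro a ha
          rw [powMonoidHom_apply] at ha
          rcases (Nat.dvd_prime hp).1 (orderOf_dvd_of_pow_eq_one ha) with h1 | h1
          · exact orderOf_eq_one_iff.1 h1
          · exact absurd (h1 ▸ Monoid.order_dvd_exponent a) hd
        rw [htop, top_sup_eq, Subgroup.index_top]
        exact Nat.one_le_pow _ _ hp.pos)
    let T : Finset A := insert g (S.image Quotient.out)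
    refine ⟨T, (Finset.card_insert_le _ _).trans (Nat.succ_le_succ (Finset.card_image_le.trans hS)), ?_⟩
    have hgT : g ∈ Subgroup.closure (T : Set A) := Subgroup.subset_closure (by simp [T])
    have hZ : Z ≤ Subgroup.closure (T : Set A) := (Subgroup.zpowers_le).2 hgT
    have hmap : (Subgroup.closure (T : Set A)).map (QuotientGroup.mk' Z) = ⊤ := by
      rw [eq_top_iff, ← hS', Subgroup.closure_le]
      intro s hs
      refine ⟨Quotient.out s, Subgroup.subset_closure ?_, QuotientGroup.out_eq' s⟩
      simp only [T, Finset.coe_insert, Finset.coe_image]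
      exact Or.inr ⟨s, hs, rfl⟩
    have := congrArg (Subgroup.comap (QuotientGroup.mk' Z)) hmap
    rw [Subgroup.comap_map_eq, QuotientGroup.ker_mk', Subgroup.comap_top, sup_eq_left.2 hZ] at this
    exact this

lemma rank_le (C : ℕ) (A : Type) [CommGroup A] [Finite A]
    (h : ∀ p : ℕ, p.Prime → Nat.card (powMonoidHom p : A →* A).ker ≤ p ^ C) : Group.rank A ≤ C := by
  obtain ⟨S, hS, hS'⟩ := gens C A (fun p hp => by
    refine le_trans (le_of_eq ?_) (h p hp)
    set f := (powMonoidHom p : A →* A)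
    have h1 := f.ker.card_mul_index
    have h2 := f.range.card_mul_index
    rw [Subgroup.index_ker] at h1
    rw [← h1, mul_comm] at h2
    exact Nat.eq_of_mul_eq_mul_right Nat.card_pos h2)
  exact (Group.rank_le hS').trans hS

end MS

/-- (Mann–Su) Let `X` be a compact topological manifold. There exists a constant `C`, depending
only on `X`, such that every finite abelian group `A` admitting an effective continuous action
on `X` satisfies `d(A) ≤ C`, where `d(A)` is the minimal number of generators of `A`. -/
theorem mann_su {n : ℕ} (X : Type*) [TopologicalSpace X] [T2Space X]
    [ChartedSpace (EuclideanSpace ℝ (Fin n)) X] [CompactSpace X] :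
    ∃ C : ℕ, ∀ (A : Type) [CommGroup A] [Finite A], ∀ ρ : A →* (X ≃ₜ X),
      Function.Injective ρ → Group.rank A ≤ C := by
  have hX : MS.LocE n X := fun x => ⟨chartAt (EuclideanSpace ℝ (Fin n)) x, mem_chart_source _ x⟩
  haveI : LocallyConnectedSpace X := ChartedSpace.locallyConnectedSpace (EuclideanSpace ℝ (Fin n)) X
  obtain ⟨C, hC⟩ := MS.elem X hX
  refine ⟨C, fun A _ _ ρ hρ => MS.rank_le C A fun p hp => ?_⟩
  letI act : MulAction (powMonoidHom p : A →* A).ker X :=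
    { smul := fun a x => ρ a x
      one_smul := fun x => by
        show ρ (1 : A) x = x
        rw [map_one]; rfl
      mul_smul := fun a b x => by
        show ρ ((a : A) * (b : A)) x = ρ a (ρ b x)
        rw [map_mul]; rfl }
  haveI : ContinuousConstSMul (powMonoidHom p : A →* A).ker X := ⟨fun a => (ρ a).continuous⟩
  refine hC (powMonoidHom p : A →* A).ker p hp (fun a => Subtype.ext a.2) fun a ha => ?_
  by_contra! h
  refine ha (Subtype.ext (hρ ?_))
  show ρ (a : A) = ρ 1
  rw [map_one]
  exact Homeomorph.ext h
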